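/- arXiv:1601.03361 — 4 statements merged into one kernel-verified Lean document; each statement's English description precedes it below -/
import Mathlib

section
/- Let G be a locally finite Borel graph on a standard Borel space X, and suppose there is a decreasing sequence A₀ ⊇ A₁ ⊇ A₂ ⊇ … of Borel subsets of X with empty intersection such that for every i, A_{i+1} meets every connected component of the restriction of G to A_i. Then there is a one-ended Borel function f : [A₀]_{E_G} → [A₀]_{E_G} whose graph is contained in G. -/
open MeasureTheory

/-- A partial function `f : B → X` is *one-ended* if there is no infinite sequence
`x₀, x₁, x₂, …` of points of `B` with `f (x_{i+1}) = x_i` for all `i`. -/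
def OneEnded {X : Type*} {B : Set X} (f : B → X) : Prop :=
  ¬ ∃ u : ℕ → B, ∀ i : ℕ, f (u (i + 1)) = (u i : X)

/-- A set of vertices is `G`-invariant if it is a union of connected components of `G`. -/
def GraphInvariant {X : Type*} (G : SimpleGraph X) (A : Set X) : Prop :=
  ∀ ⦃x y : X⦄, G.Reachable x y → x ∈ A → y ∈ A

/-- `[A]_{E_G}`: the union of all connected components of `G` meeting `A`. -/
def EGSat {X : Type*} (G : SimpleGraph X) (A : Set X) : Set X :=
  {x | ∃ a ∈ A, G.Reachable x a}

/-- `S` is biconnected: the induced subgraph on `S` is connected and remains connected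
(in the sense of `Preconnected`) after deleting any single vertex of `S`. -/
def BiconnectedSet {X : Type*} (G : SimpleGraph X) (S : Set X) : Prop :=
  (G.induce S).Connected ∧ ∀ x ∈ S, (G.induce (S \ {x})).Preconnected

/-- A block of `G` is a maximal biconnected set. -/
def GraphBlock {X : Type*} (G : SimpleGraph X) (S : Set X) : Prop :=
  BiconnectedSet G S ∧ ∀ T : Set X, BiconnectedSet G T → S ⊆ T → T = S

/-- The induced subgraph on `S` is a cycle of odd length. -/
def OddCycleSet {X : Type*} (G : SimpleGraph X) (S : Set X) : Prop :=
  ∃ n : ℕ, Odd n ∧ 3 ≤ n ∧ Nonempty (G.induce S ≃g SimpleGraph.cycleGraph n)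

/-- A Gallai tree is a connected graph each of whose blocks induces a complete
graph or an odd cycle. -/
def GallaiTree {X : Type*} (G : SimpleGraph X) : Prop :=
  G.Connected ∧ ∀ S : Set X, GraphBlock G S → G.IsClique S ∨ OddCycleSet G S

/-- A graph is ample if every vertex has degree at least 2 and for every vertex `x`,
every connected component of the restriction of `G` to the complement of `{x}`
contains a vertex of degree at least 3 in that restriction. -/
def AmpleGraph {X : Type*} (G : SimpleGraph X) : Prop :=
  (∀ x : X, 2 ≤ (G.neighborSet x).encard) ∧
  ∀ x : X, ∀ y : ({x}ᶜ : Set X), ∃ z : ({x}ᶜ : Set X),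
    (G.induce ({x}ᶜ : Set X)).Reachable y z ∧
      3 ≤ ((G.induce ({x}ᶜ : Set X)).neighborSet z).encard

/-- `x E^even_G y`: `x` and `y` are joined by a path of even length in `G`. -/
def EvenRel {X : Type*} (G : SimpleGraph X) (x y : X) : Prop :=
  ∃ p : G.Walk x y, p.IsPath ∧ Even p.length

/-- A set is `E^even_G`-invariant if it is a union of `E^even_G`-classes. -/
def EvenInvariant {X : Type*} (G : SimpleGraph X) (C : Set X) : Prop :=
  ∀ ⦃x y : X⦄, EvenRel G x y → x ∈ C → y ∈ C


/-- A sequence of sets is Borel separable if it has measurable supersets with empty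
intersection. -/
def BorelSeparable {α : Type*} [MeasurableSpace α] (S : ℕ → Set α) : Prop :=
  ∃ B : ℕ → Set α, (∀ n, MeasurableSet (B n)) ∧ (∀ n, S n ⊆ B n) ∧ ⋂ n, B n = ∅

theorem BorelSeparable.of_iUnion {α : Type*} [MeasurableSpace α] {S : ℕ → Set α}
    {T : ℕ → ℕ → Set α} (m : ℕ) (hm : S m ⊆ ⋃ j, T j m)
    (hne : ∀ n, n ≠ m → ∀ j, S n ⊆ T j n) (hT : ∀ j, BorelSeparable (T j)) :
    BorelSeparable S := by
  choose B hBm hBs hBe using hT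
  refine ⟨fun n => if n = m then ⋃ j, B j n else ⋂ j, B j n, fun n => ?_, fun n => ?_, ?_⟩
  · dsimp only
    split_ifs
    · exact MeasurableSet.iUnion fun j => hBm j n
    · exact MeasurableSet.iInter fun j => hBm j n
  · dsimp only
    split_ifs with h
    · subst h
      exact hm.trans (Set.iUnion_mono fun j => hBs j n)
    · exact Set.subset_iInter fun j => (hne n h j).trans (hBs j n)
  · refine Set.eq_empty_of_forall_notMem fun x hx => ?_
    rw [Set.mem_iInter] at hx
    have h := hx m
    rw [if_pos rfl, Set.mem_iUnion] at h
    obtain ⟨j, hj⟩ := h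
    have hx' : x ∈ ⋂ n, B j n := by
      refine Set.mem_iInter.2 fun n => ?_
      by_cases hn : n = m
      · exact hn ▸ hj
      · have h := hx n
        rw [if_neg hn] at h
        exact Set.mem_iInter.1 h j
    rw [hBe j] at hx'
    exact hx'

theorem borelSeparable_of_disjoint {α : Type*} [MeasurableSpace α] {S : ℕ → Set α} {i j : ℕ}
    (hij : i ≠ j) {U V : Set α} (hU : MeasurableSet U) (hV : MeasurableSet V)
    (hUV : Disjoint U V) (hi : S i ⊆ U) (hj : S j ⊆ V) : BorelSeparable S := by
  refine ⟨fun n => if n = i then U else if n = j then V else Set.univ, fun n => ?_, fun n => ?_, ?_⟩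
  · dsimp only
    split_ifs
    exacts [hU, hV, MeasurableSet.univ]
  · dsimp only
    split_ifs with h₁ h₂
    exacts [h₁ ▸ hi, h₂ ▸ hj, Set.subset_univ _]
  · refine Set.eq_empty_of_forall_notMem fun x hx => ?_
    rw [Set.mem_iInter] at hx
    have h₁ := hx i
    have h₂ := hx j
    rw [if_pos rfl] at h₁
    rw [if_neg hij.symm, if_pos rfl] at h₂
    exact Set.disjoint_left.1 hUV h₁ h₂

/-- The points of the Baire space agreeing with the `n`-th row of `z`, the sequence `z` being read
as an array through `Nat.pair` and only its first `k` values being known. -/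
def rowCylinder (n : ℕ) (z : ℕ → ℕ) (k : ℕ) : Set (ℕ → ℕ) :=
  {x | ∀ i, Nat.pair n i < k → x i = z (Nat.pair n i)}

theorem exists_rowCylinder_subset (n : ℕ) (z : ℕ → ℕ) {U : Set (ℕ → ℕ)} (hU : IsOpen U)
    (hz : (fun i => z (Nat.pair n i)) ∈ U) : ∃ K, ∀ k, K ≤ k → rowCylinder n z k ⊆ U := by
  obtain ⟨_, ⟨y, m, rfl⟩, hy, hyU⟩ :=
    (PiNat.isTopologicalBasis_cylinders fun _ : ℕ => ℕ).exists_subset_of_mem_open hz hU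
  refine ⟨Nat.pair n m, fun k hk x hx => hyU ?_⟩
  rw [PiNat.mem_cylinder_iff] at hy ⊢
  intro i hi
  rw [← hy i hi]
  exact hx i ((Nat.pair_lt_pair_right n hi).trans_le hk)

theorem rowCylinder_subset_iUnion (z : ℕ → ℕ) (k : ℕ) :
    rowCylinder k.unpair.1 z k ⊆
      ⋃ j, rowCylinder k.unpair.1 (Function.update z k j) (k + 1) := by
  intro x hx
  refine Set.mem_iUnion.2 ⟨x k.unpair.2, fun i hi => ?_⟩
  rcases (Nat.lt_succ_iff_lt_or_eq.1 hi) with h | h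
  · rw [Function.update_of_ne h.ne]
    exact hx i h
  · rw [h, Function.update_self, ← h, Nat.unpair_pair]

theorem rowCylinder_subset_update {n k : ℕ} (hn : n ≠ k.unpair.1) (z : ℕ → ℕ) (j : ℕ) :
    rowCylinder n z k ⊆ rowCylinder n (Function.update z k j) (k + 1) := by
  intro x hx i hi
  have h : Nat.pair n i ≠ k := by
    rintro rfl
    simp at hn
  rw [Function.update_of_ne h]
  exact hx i (by omega)

theorem borelSeparable_range {α : Type*} [TopologicalSpace α] [T2Space α] [MeasurableSpace α]
    [OpensMeasurableSpace α] (f : ℕ → (ℕ → ℕ) → α) (hf : ∀ n, Continuous (f n))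
    (he : ⋂ n, Set.range (f n) = ∅) : BorelSeparable fun n => Set.range (f n) := by
  by_contra hsep
  let S : (ℕ → ℕ) → ℕ → ℕ → Set α := fun z k n => f n '' rowCylinder n z k
  have hstep : ∀ z k, ¬ BorelSeparable (S z k) →
      ∃ j, ¬ BorelSeparable (S (Function.update z k j) (k + 1)) := by
    intro z k h
    by_contra! hall
    refine h (BorelSeparable.of_iUnion k.unpair.1 ?_ ?_ hall)
    · rw [← Set.image_iUnion]
      exact Set.image_mono (rowCylinder_subset_iUnion z k)
    · exact fun n hn j => Set.image_mono (rowCylinder_subset_update hn z j)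
  choose! c hc using hstep
  let s : ℕ → ℕ → ℕ := fun k => Nat.rec (fun _ => 0) (fun k z => Function.update z k (c z k)) k
  have hs : ∀ k, s (k + 1) = Function.update (s k) k (c (s k) k) := fun _ => rfl
  have hsep' : ∀ k, ¬ BorelSeparable (S (s k) k) := by
    intro k
    induction k with
    | zero =>
      have : S (s 0) 0 = fun n => Set.range (f n) := by
        funext n
        simp [S, rowCylinder]
      rwa [this]
    | succ k ih =>
      rw [hs]
      exact hc _ _ ih
  have hstable : ∀ i k, i < k → s k i = s (i + 1) i := by
    intro i k hik
    induction k, hik using Nat.le_induction with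
    | base => rfl
    | succ k hk ih => rw [hs, Function.update_of_ne (by omega), ih]
  let z : ℕ → ℕ := fun i => s (i + 1) i
  have hz : ∀ k, ¬ BorelSeparable (S z k) := by
    intro k
    have : S z k = S (s k) k := by
      funext n
      have : rowCylinder n z k = rowCylinder n (s k) k := by
        ext x
        refine forall_congr' fun i => forall_congr' fun hi => ?_
        rw [hstable _ _ hi]
      simp only [S, this]
    rw [this]
    exact hsep' k
  let x : ℕ → ℕ → ℕ := fun n i => z (Nat.pair n i)
  have hne : ∃ n, f n (x n) ≠ f 0 (x 0) := by
    by_contra! h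
    have : f 0 (x 0) ∈ ⋂ n, Set.range (f n) := Set.mem_iInter.2 fun n => ⟨x n, h n⟩
    rw [he] at this
    exact this
  obtain ⟨n, hn⟩ := hne
  obtain ⟨U, V, hU, hV, hxU, hxV, hUV⟩ := t2_separation hn
  obtain ⟨K, hK⟩ := exists_rowCylinder_subset n z (hU.preimage (hf n)) hxU
  obtain ⟨L, hL⟩ := exists_rowCylinder_subset 0 z (hV.preimage (hf 0)) hxV
  have hn0 : n ≠ 0 := by
    rintro rfl
    exact hn rfl
  exact hz (max K L) (borelSeparable_of_disjoint hn0 hU.measurableSet hV.measurableSet hUV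
    (Set.image_subset_iff.2 (hK _ (le_max_left _ _)))
    (Set.image_subset_iff.2 (hL _ (le_max_right _ _))))

/-- The **Novikov separation theorem**: a sequence of analytic sets with empty intersection has
Borel supersets with empty intersection. -/
theorem borelSeparable_of_analyticSet {α : Type*} [TopologicalSpace α] [T2Space α]
    [MeasurableSpace α] [OpensMeasurableSpace α] (P : ℕ → Set α)
    (hP : ∀ n, AnalyticSet (P n)) (he : ⋂ n, P n = ∅) : BorelSeparable P := by
  by_cases h : ∃ n, P n = ∅
  · obtain ⟨n, hn⟩ := h
    exact borelSeparable_of_disjoint (Nat.succ_ne_self n).symm MeasurableSet.empty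
      MeasurableSet.univ (Set.empty_disjoint _) hn.subset (Set.subset_univ _)
  · push Not at h
    have hP' : ∀ n, ∃ f : (ℕ → ℕ) → α, Continuous f ∧ Set.range f = P n := by
      intro n
      have hn := hP n
      rw [AnalyticSet] at hn
      exact hn.resolve_left (h n).ne_empty
    choose f hf hfr using hP'
    have := borelSeparable_range f hf (by simpa only [hfr] using he)
    simpa only [hfr] using this

theorem exists_nat_family_isolating (Y : Type*) [MeasurableSpace Y] [StandardBorelSpace Y] :
    ∃ U : ℕ → Set Y, (∀ n, MeasurableSet (U n)) ∧
      ∀ S : Set Y, S.Finite → ∀ y ∈ S, ∃ n, y ∈ U n ∧ ∀ z ∈ U n, z ∈ S → z = y := by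
  let := upgradeStandardBorel Y
  have hc : (insert ∅ (TopologicalSpace.countableBasis Y)).Countable :=
    (TopologicalSpace.countable_countableBasis Y).insert ∅
  obtain ⟨U, hU⟩ := hc.exists_eq_range (Set.insert_nonempty _ _)
  refine ⟨U, fun n => ?_, fun S hS y hy => ?_⟩
  · have hn : U n ∈ insert ∅ (TopologicalSpace.countableBasis Y) := hU ▸ Set.mem_range_self n
    rcases hn with h | h
    · rw [h]
      exact MeasurableSet.empty
    · exact (TopologicalSpace.isOpen_of_mem_countableBasis h).measurableSet
  · have hO : IsOpen (S \ {y})ᶜ := (hS.subset Set.sdiff_subset).isClosed.isOpen_compl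
    obtain ⟨V, hV, hyV, hVO⟩ :=
      (TopologicalSpace.isBasis_countableBasis Y).exists_subset_of_mem_open
        (show y ∈ (S \ {y})ᶜ by simp) hO
    obtain ⟨n, rfl⟩ : V ∈ Set.range U := hU ▸ Set.mem_insert_of_mem _ hV
    refine ⟨n, hyV, fun z hz hzS => ?_⟩
    by_contra hne
    exact hVO hz ⟨hzS, hne⟩

/-- The **Lusin–Novikov theorem** for Borel sets with finite sections. -/
theorem exists_iUnion_injOn_fst {X Y : Type*} [MeasurableSpace X] [StandardBorelSpace X]
    [MeasurableSpace Y] [StandardBorelSpace Y] {E : Set (X × Y)} (hE : MeasurableSet E)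
    (hfin : ∀ x, {y | (x, y) ∈ E}.Finite) :
    ∃ F : ℕ → Set (X × Y), (∀ n, MeasurableSet (F n)) ∧ (∀ n, Set.InjOn Prod.fst (F n)) ∧
      ⋃ n, F n = E := by
  obtain ⟨U, hUm, hU⟩ := exists_nat_family_isolating Y
  let := upgradeStandardBorel X
  let := upgradeStandardBorel Y
  let Q : ℕ → Set ((X × Y) × Y) := fun n =>
    {q | q.1 ∈ E ∧ (q.1.2 ∉ U n ∨ (q.2 ∈ U n ∧ q.2 ≠ q.1.2 ∧ (q.1.1, q.2) ∈ E))}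
  have hQ : ∀ n, MeasurableSet (Q n) := by
    intro n
    have h₁ : MeasurableSet {q : (X × Y) × Y | q.1 ∈ E} := measurable_fst hE
    have h₂ : MeasurableSet {q : (X × Y) × Y | q.1.2 ∈ U n} :=
      (measurable_snd.comp measurable_fst) (hUm n)
    have h₃ : MeasurableSet {q : (X × Y) × Y | q.2 ∈ U n} := measurable_snd (hUm n)
    have h₄ : MeasurableSet {q : (X × Y) × Y | q.2 = q.1.2} :=
      measurableSet_eq_fun measurable_snd (measurable_snd.comp measurable_fst)
    have h₅ : MeasurableSet {q : (X × Y) × Y | (q.1.1, q.2) ∈ E} :=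
      ((measurable_fst.comp measurable_fst).prodMk measurable_snd) hE
    exact h₁.inter (h₂.compl.union (h₃.inter (h₄.compl.inter h₅)))
  have hsep : BorelSeparable fun n => Prod.fst '' Q n := by
    refine borelSeparable_of_analyticSet _
      (fun n => (hQ n).analyticSet.image_of_continuous continuous_fst) ?_
    refine Set.eq_empty_of_forall_notMem fun p hp => ?_
    rw [Set.mem_iInter] at hp
    have hpE : p ∈ E := by
      obtain ⟨q, hq, rfl⟩ := hp 0
      exact hq.1
    obtain ⟨n, hn, hn'⟩ := hU _ (hfin p.1) p.2 hpE
    obtain ⟨q, ⟨-, hq⟩, rfl⟩ := hp n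
    rcases hq with hq | ⟨hq₁, hq₂, hq₃⟩
    · exact hq hn
    · exact hq₂ (hn' _ hq₁ hq₃)
  obtain ⟨B, hBm, hBs, hBe⟩ := hsep
  refine ⟨fun n => E \ B n, fun n => hE.diff (hBm n), fun n => ?_, ?_⟩
  · rintro ⟨x, y⟩ ⟨hE₁, hB₁⟩ ⟨x', z⟩ ⟨hE₂, hB₂⟩ hx
    obtain rfl : x = x' := hx
    by_contra hne
    have hyz : z ≠ y := fun h => hne (by rw [h])
    have hzU : z ∈ U n := by
      by_contra h
      exact hB₂ (hBs n ⟨((x, z), z), ⟨hE₂, Or.inl h⟩, rfl⟩)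
    exact hB₁ (hBs n ⟨((x, y), z), ⟨hE₁, Or.inr ⟨hzU, hyz, hE₂⟩⟩, rfl⟩)
  · rw [← Set.sdiff_iInter, hBe, Set.sdiff_empty]

theorem measurableSet_image_fst_of_finite {X Y : Type*} [MeasurableSpace X]
    [StandardBorelSpace X] [MeasurableSpace Y] [StandardBorelSpace Y] {E : Set (X × Y)}
    (hE : MeasurableSet E) (hfin : ∀ x, {y | (x, y) ∈ E}.Finite) :
    MeasurableSet (Prod.fst '' E) := by
  obtain ⟨F, hFm, hFi, rfl⟩ := exists_iUnion_injOn_fst hE hfin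
  rw [Set.image_iUnion]
  exact MeasurableSet.iUnion fun n => (hFm n).image_of_measurable_injOn measurable_fst (hFi n)

theorem exists_measurable_uniformization {X Y : Type*} [MeasurableSpace X]
    [StandardBorelSpace X] [MeasurableSpace Y] [StandardBorelSpace Y] [Nonempty Y]
    {E : Set (X × Y)} (hE : MeasurableSet E) (hfin : ∀ x, {y | (x, y) ∈ E}.Finite) :
    ∃ f : X → Y, Measurable f ∧ ∀ x y, (x, y) ∈ E → (x, f x) ∈ E := by
  obtain ⟨F, hFm, hFi, rfl⟩ := exists_iUnion_injOn_fst hE hfin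
  have hFp : ∀ n, MeasurableSet (Prod.fst '' F n) := fun n =>
    (hFm n).image_of_measurable_injOn measurable_fst (hFi n)
  classical
  have hpart : ∀ n, ∃ f : X → Y, Measurable f ∧ ∀ x ∈ Prod.fst '' F n, (x, f x) ∈ F n := by
    intro n
    have hex : ∀ x, ∃ y, (x ∈ Prod.fst '' F n → (x, y) ∈ F n) ∧
        (x ∉ Prod.fst '' F n → y = Classical.arbitrary Y) := by
      intro x
      by_cases hx : x ∈ Prod.fst '' F n
      · obtain ⟨⟨x, y⟩, hp, rfl⟩ := id hx
        exact ⟨y, fun _ => hp, fun h => absurd hx h⟩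
      · exact ⟨Classical.arbitrary Y, fun h => absurd h hx, fun _ => rfl⟩
    choose f hf₁ hf₂ using hex
    refine ⟨f, fun B hB => ?_, hf₁⟩
    have : f ⁻¹' B = Prod.fst '' (F n ∩ Prod.snd ⁻¹' B) ∪
        ((Prod.fst '' F n)ᶜ ∩ {_x | Classical.arbitrary Y ∈ B}) := by
      ext x
      by_cases hx : x ∈ Prod.fst '' F n
      · constructor
        · exact fun h => Or.inl ⟨(x, f x), ⟨hf₁ x hx, h⟩, rfl⟩
        · rintro (⟨p, ⟨hp, hpB⟩, rfl⟩ | h)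
          · have : (p.1, f p.1) = p := hFi n (hf₁ _ hx) hp rfl
            rw [Set.mem_preimage, show f p.1 = p.2 from congrArg Prod.snd this]
            exact hpB
          · exact absurd hx h.1
      · constructor
        · exact fun h => Or.inr ⟨hx, by simpa [hf₂ x hx] using h⟩
        · rintro (⟨p, ⟨hp, hpB⟩, rfl⟩ | h)
          · exact absurd ⟨p, hp, rfl⟩ hx
          · rw [Set.mem_preimage, hf₂ x hx]
            exact h.2
    rw [this]
    exact (((hFm n).inter (measurable_snd hB)).image_of_measurable_injOn measurable_fst
      ((hFi n).mono Set.inter_subset_left)).union ((hFp n).compl.inter (MeasurableSet.const _))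
  choose f hfm hf using hpart
  obtain ⟨g, hgm, hg⟩ := exists_measurable_piecewise (disjointed fun n => Prod.fst '' F n)
    (fun n => MeasurableSet.disjointed hFp n) f hfm (by
      intro i j hij x hx
      exact absurd hx.2 (Set.disjoint_left.1 (disjoint_disjointed _ hij) hx.1))
  refine ⟨g, hgm, fun x y hxy => ?_⟩
  obtain ⟨m, hm⟩ := Set.mem_iUnion.1 hxy
  have hx : x ∈ ⋃ n, disjointed (fun n => Prod.fst '' F n) n := by
    rw [iUnion_disjointed]
    exact Set.mem_iUnion.2 ⟨m, (x, y), hm, rfl⟩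
  obtain ⟨n, hn⟩ := Set.mem_iUnion.1 hx
  rw [hg n hn]
  exact Set.mem_iUnion.2 ⟨n, hf n x (disjointed_subset _ n hn)⟩

namespace SimpleGraph

variable {X : Type*} (G : SimpleGraph X)

/-- The set of vertices of `C` at distance at most `k` from `D` inside `C`. -/
def distLevel (C D : Set X) : ℕ → Set X
  | 0 => D
  | k + 1 => distLevel C D k ∪ (C ∩ {x | ∃ y, G.Adj x y ∧ y ∈ distLevel C D k})

variable {G}

theorem distLevel_subset {C D : Set X} (hDC : D ⊆ C) : ∀ k, G.distLevel C D k ⊆ C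
  | 0 => hDC
  | k + 1 => Set.union_subset (distLevel_subset hDC k) Set.inter_subset_left

theorem exists_mem_distLevel {C D : Set X} {x y : X} (hy : y ∈ D)
    (hxy : Relation.ReflTransGen (fun a b => G.Adj a b ∧ a ∈ C) x y) :
    ∃ k, x ∈ G.distLevel C D k := by
  induction hxy using Relation.ReflTransGen.head_induction_on with
  | refl => exact ⟨0, hy⟩
  | head h _ ih =>
    obtain ⟨k, hk⟩ := ih
    exact ⟨k + 1, Or.inr ⟨h.2, _, h.1, hk⟩⟩

/-- The vertices with a `g`-backward chain of length `k` inside `S`. -/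
def backLevel (S : Set X) (g : X → X) : ℕ → Set X
  | 0 => Set.univ
  | k + 1 => {x | ∃ y, y ∈ S ∧ g y = x ∧ y ∈ backLevel S g k}

theorem backLevel_anti (S : Set X) (g : X → X) : Antitone (backLevel S g) := by
  refine antitone_nat_of_succ_le fun k => ?_
  induction k with
  | zero => exact Set.subset_univ _
  | succ k ih =>
    rintro x ⟨y, hy, hyx, hk⟩
    exact ⟨y, hy, hyx, ih hk⟩

theorem mem_iInter_backLevel_of_apply {S : Set X} {g : X → X} {y : X} (hy : y ∈ S)
    (h : y ∈ ⋂ k, backLevel S g k) : g y ∈ ⋂ k, backLevel S g k := by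
  rw [Set.mem_iInter] at h ⊢
  rintro (_ | k)
  · trivial
  · exact ⟨y, hy, rfl, h k⟩

theorem exists_mem_iInter_backLevel {S : Set X} {g : X → X} {x : X}
    (hfin : {y | y ∈ S ∧ g y = x}.Finite) (h : x ∈ ⋂ k, backLevel S g k) :
    ∃ y, y ∈ S ∧ g y = x ∧ y ∈ ⋂ k, backLevel S g k := by
  rw [Set.mem_iInter] at h
  have hk : ∀ k, ∃ y ∈ {y | y ∈ S ∧ g y = x}, y ∈ backLevel S g k := fun k => by
    obtain ⟨y, hy, hyx, hk⟩ := h (k + 1)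
    exact ⟨y, ⟨hy, hyx⟩, hk⟩
  by_contra! hne
  have hl : ∀ y ∈ {y | y ∈ S ∧ g y = x}, ∃ k, y ∉ backLevel S g k := fun y hy => by
    simpa using hne y hy.1 hy.2
  choose! l hl using hl
  obtain ⟨M, hM⟩ := (hfin.image l).bddAbove
  obtain ⟨y, hy, hyM⟩ := hk M
  exact hl y hy (backLevel_anti S g (hM ⟨y, hy, rfl⟩) hyM)

theorem mem_iInter_backLevel_of_chain {S : Set X} {g : X → X} {u : ℕ → X}
    (hu : ∀ i, u i ∈ S) (hgu : ∀ i, g (u (i + 1)) = u i) : u 0 ∈ ⋂ k, backLevel S g k := by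
  refine Set.mem_iInter.2 fun k => ?_
  suffices ∀ k i, u i ∈ backLevel S g k from this k 0
  intro k
  induction k with
  | zero => exact fun _ => trivial
  | succ k ih => exact fun i => ⟨u (i + 1), hu _, hgu i, ih _⟩

variable [MeasurableSpace X] [StandardBorelSpace X]

theorem measurableSet_exists_adj (hG : MeasurableSet {p : X × X | G.Adj p.1 p.2})
    (hlf : ∀ x : X, (G.neighborSet x).Finite) {P : Set (X × X)} (hP : MeasurableSet P) :
    MeasurableSet {x | ∃ y, G.Adj x y ∧ (x, y) ∈ P} := by
  have h := measurableSet_image_fst_of_finite (hG.inter hP)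
    fun x => (hlf x).subset fun y hy => hy.1
  convert h using 1
  ext x
  constructor
  · rintro ⟨y, hxy, hy⟩
    exact ⟨(x, y), ⟨hxy, hy⟩, rfl⟩
  · rintro ⟨⟨x, y⟩, ⟨hxy, hy⟩, rfl⟩
    exact ⟨y, hxy, hy⟩

theorem exists_measurable_adj (hG : MeasurableSet {p : X × X | G.Adj p.1 p.2})
    (hlf : ∀ x : X, (G.neighborSet x).Finite) {P : Set (X × X)} (hP : MeasurableSet P) :
    ∃ f : X → X, Measurable f ∧
      ∀ x, (∃ y, G.Adj x y ∧ (x, y) ∈ P) → G.Adj x (f x) ∧ (x, f x) ∈ P := by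
  cases isEmpty_or_nonempty X
  · exact ⟨id, measurable_id, fun x => isEmptyElim x⟩
  · obtain ⟨f, hfm, hf⟩ := exists_measurable_uniformization (hG.inter hP)
      fun x => (hlf x).subset fun y hy => hy.1
    exact ⟨f, hfm, fun x ⟨y, hxy, hy⟩ => hf x y ⟨hxy, hy⟩⟩

theorem measurableSet_distLevel (hG : MeasurableSet {p : X × X | G.Adj p.1 p.2})
    (hlf : ∀ x : X, (G.neighborSet x).Finite) {C D : Set X} (hC : MeasurableSet C)
    (hD : MeasurableSet D) : ∀ k, MeasurableSet (G.distLevel C D k)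
  | 0 => hD
  | k + 1 =>
    have hk := measurableSet_distLevel hG hlf hC hD k
    hk.union (hC.inter (measurableSet_exists_adj hG hlf (measurable_snd hk)))

theorem measurableSet_egSat (hG : MeasurableSet {p : X × X | G.Adj p.1 p.2})
    (hlf : ∀ x : X, (G.neighborSet x).Finite) {A : Set X} (hA : MeasurableSet A) :
    MeasurableSet (EGSat G A) := by
  have : EGSat G A = ⋃ k, G.distLevel Set.univ A k := by
    ext x
    rw [Set.mem_iUnion]
    constructor
    · rintro ⟨a, ha, hxa⟩
      refine exists_mem_distLevel ha ?_
      simpa using (reachable_iff_reflTransGen x a).1 hxa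
    · rintro ⟨k, hk⟩
      induction k generalizing x with
      | zero => exact ⟨x, hk, Reachable.refl x⟩
      | succ k ih =>
        rcases hk with hk | ⟨-, y, hxy, hy⟩
        · exact ih x hk
        · obtain ⟨a, ha, hya⟩ := ih y hy
          exact ⟨a, ha, hxy.reachable.trans hya⟩
  rw [this]
  exact MeasurableSet.iUnion (measurableSet_distLevel hG hlf MeasurableSet.univ hA)

theorem exists_measurable_descent (hG : MeasurableSet {p : X × X | G.Adj p.1 p.2})
    (hlf : ∀ x : X, (G.neighborSet x).Finite) {C D : Set X} (hC : MeasurableSet C)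
    (hD : MeasurableSet D) (hDC : D ⊆ C) (hr : ∀ x ∈ C, ∃ k, x ∈ G.distLevel C D k) :
    ∃ (g : X → X) (d : X → ℕ), Measurable g ∧
      ∀ x ∈ C \ D, G.Adj x (g x) ∧ g x ∈ C ∧ d (g x) < d x := by
  have hL := measurableSet_distLevel hG hlf hC hD
  let P : Set (X × X) := ⋃ k, {p | p.1 ∉ G.distLevel C D k ∧ p.2 ∈ G.distLevel C D k}
  have hP : MeasurableSet P := MeasurableSet.iUnion fun k =>
    (measurable_fst (hL k)).compl.inter (measurable_snd (hL k))
  obtain ⟨g, hgm, hg⟩ := exists_measurable_adj hG hlf hP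
  classical
  let d : X → ℕ := fun x => if h : ∃ k, x ∈ G.distLevel C D k then Nat.find h else 0
  have hd_le : ∀ {x k}, x ∈ G.distLevel C D k → d x ≤ k := by
    intro x k hk
    have h : ∃ k, x ∈ G.distLevel C D k := ⟨k, hk⟩
    simp only [d, dif_pos h]
    exact Nat.find_min' h hk
  have hd_mem : ∀ x ∈ C, x ∈ G.distLevel C D (d x) := by
    intro x hx
    simp only [d, dif_pos (hr x hx)]
    exact Nat.find_spec (hr x hx)
  have hmono : Monotone (G.distLevel C D) := monotone_nat_of_le_succ fun k =>
    Set.subset_union_left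
  refine ⟨g, d, hgm, fun x hx => ?_⟩
  have hex : ∃ y, G.Adj x y ∧ (x, y) ∈ P := by
    have hdx := hd_mem x hx.1
    rcases hk : d x with _ | k
    · rw [hk] at hdx
      exact absurd hdx hx.2
    · rw [hk] at hdx
      have hnk : x ∉ G.distLevel C D k := fun h => by
        have := hd_le h
        omega
      obtain ⟨-, y, hxy, hy⟩ := hdx.resolve_left hnk
      exact ⟨y, hxy, Set.mem_iUnion.2 ⟨k, hnk, hy⟩⟩
  obtain ⟨hadj, hgP⟩ := hg x hex
  obtain ⟨k, hk₁, hk₂⟩ := Set.mem_iUnion.1 hgP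
  refine ⟨hadj, distLevel_subset hDC k hk₂, (hd_le hk₂).trans_lt ?_⟩
  by_contra! hle
  exact hk₁ (hmono hle (hd_mem x hx.1))

/-- If every vertex of `C` is joined to `D` inside `C`, then there is a Borel function moving along
edges from `C \ D` into `C` with no infinite backward chain in `C \ D`. -/
theorem exists_measurable_no_backward_chain (hG : MeasurableSet {p : X × X | G.Adj p.1 p.2})
    (hlf : ∀ x : X, (G.neighborSet x).Finite) {C D : Set X} (hC : MeasurableSet C)
    (hD : MeasurableSet D) (hDC : D ⊆ C) (hr : ∀ x ∈ C, ∃ k, x ∈ G.distLevel C D k) :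
    ∃ f : X → X, Measurable f ∧ (∀ x ∈ C \ D, G.Adj x (f x) ∧ f x ∈ C) ∧
      ¬ ∃ u : ℕ → X, (∀ i, u i ∈ C \ D) ∧ ∀ i, f (u (i + 1)) = u i := by
  obtain ⟨g, d, hgm, hg⟩ := exists_measurable_descent hG hlf hC hD hDC hr
  have hS : MeasurableSet (C \ D) := hC.diff hD
  set S := C \ D
  have hgr : MeasurableSet {p : X × X | g p.2 = p.1} :=
    measurableSet_eq_fun (hgm.comp measurable_snd) measurable_fst
  have hstep : ∀ {K : Set X}, MeasurableSet K →
      MeasurableSet {p : X × X | p.2 ∈ S ∧ g p.2 = p.1 ∧ p.2 ∈ K} := fun hK =>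
    (measurable_snd hS).inter (hgr.inter (measurable_snd hK))
  have hback : ∀ x y, y ∈ S → g y = x → G.Adj x y := by
    rintro _ y hy rfl
    exact (hg y hy).1.symm
  have hJ : ∀ k, MeasurableSet (backLevel S g k) := by
    intro k
    induction k with
    | zero => exact MeasurableSet.univ
    | succ k ih =>
      convert measurableSet_exists_adj hG hlf (hstep ih) using 1
      ext x
      exact ⟨fun ⟨y, hy, hyx, hk⟩ => ⟨y, hback x y hy hyx, hy, hyx, hk⟩,
        fun ⟨y, _, hy, hyx, hk⟩ => ⟨y, hy, hyx, hk⟩⟩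
  set I := ⋂ k, backLevel S g k
  have hI : MeasurableSet I := MeasurableSet.iInter hJ
  obtain ⟨h, hhm, hh⟩ := exists_measurable_adj hG hlf (hstep hI)
  have hh' : ∀ x ∈ I, G.Adj x (h x) ∧ h x ∈ S ∧ g (h x) = x ∧ h x ∈ I := by
    intro x hx
    obtain ⟨y, hy, hyx, hyI⟩ := exists_mem_iInter_backLevel
      ((hlf x).subset fun y hy => hback x y hy.1 hy.2) hx
    exact hh x ⟨y, hback x y hy hyx, hy, hyx, hyI⟩
  classical
  refine ⟨I.piecewise h g, hhm.piecewise hI hgm, fun x hx => ?_, ?_⟩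
  · by_cases hxI : x ∈ I
    · rw [Set.piecewise_eq_of_mem _ _ _ hxI]
      exact ⟨(hh' x hxI).1, (hh' x hxI).2.1.1⟩
    · rw [Set.piecewise_eq_of_notMem _ _ _ hxI]
      exact ⟨(hg x hx).1, (hg x hx).2.1⟩
  · rintro ⟨u, huS, hu⟩
    by_cases hall : ∀ i, u i ∈ I
    · have hd : ∀ i, d (u (i + 1)) < d (u i) := by
        intro i
        have hi : h (u (i + 1)) = u i := by
          rw [← hu i, Set.piecewise_eq_of_mem _ _ _ (hall _)]
        have hgi : g (u i) = u (i + 1) := by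
          rw [← hi]
          exact (hh' _ (hall _)).2.2.1
        rw [← hgi]
        exact (hg _ (huS i)).2.2
      exact not_strictAnti_of_wellFoundedLT _
        (strictAnti_nat_of_succ_lt (f := fun i => d (u i)) hd)
    · push Not at hall
      obtain ⟨N, hN⟩ := hall
      have hnot : ∀ i, u (N + i) ∉ I := by
        intro i
        induction i with
        | zero => exact hN
        | succ i ih =>
          intro (hmem : u (N + i + 1) ∈ I)
          apply ih
          rw [← hu (N + i), Set.piecewise_eq_of_mem _ _ _ hmem]
          exact (hh' _ hmem).2.2.2
      refine hnot 0 (mem_iInter_backLevel_of_chain (u := fun i => u (N + i))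
        (fun i => huS _) fun i => ?_)
      exact (Set.piecewise_eq_of_notMem _ _ _ (hnot (i + 1))).symm.trans (hu (N + i))

/-- The one-step functions along a decreasing sequence of Borel sets glue to a single Borel function
with no infinite backward chain. -/
theorem exists_measurable_one_ended_of_antitone
    (hG : MeasurableSet {p : X × X | G.Adj p.1 p.2}) (hlf : ∀ x : X, (G.neighborSet x).Finite)
    {B : ℕ → Set X} (hB : ∀ n, MeasurableSet (B n)) (hanti : Antitone B) (he : ⋂ n, B n = ∅)
    (hr : ∀ n, ∀ x ∈ B n, ∃ k, x ∈ G.distLevel (B n) (B (n + 1)) k) :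
    ∃ f : X → X, Measurable f ∧ (∀ x ∈ B 0, G.Adj x (f x) ∧ f x ∈ B 0) ∧
      ¬ ∃ u : ℕ → X, (∀ i, u i ∈ B 0) ∧ ∀ i, f (u (i + 1)) = u i := by
  choose F hFm hF hFu using fun n => exists_measurable_no_backward_chain hG hlf (hB n)
    (hB (n + 1)) (hanti n.le_succ) (hr n)
  obtain ⟨f, hfm, hf⟩ := exists_measurable_piecewise (fun n => B n \ B (n + 1))
    (fun n => (hB n).diff (hB (n + 1))) F hFm (by
      intro i j hij x hx
      exfalso
      rcases hij.lt_or_gt with h | h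
      · exact hx.1.2 (hanti h hx.2.1)
      · exact hx.2.2 (hanti h hx.1.1))
  have hrank : ∀ x ∈ B 0, ∃ n, x ∈ B n \ B (n + 1) := by
    intro x hx
    by_contra! h
    have : x ∈ ⋂ n, B n := Set.mem_iInter.2 fun n => by
      induction n with
      | zero => exact hx
      | succ n ih => exact not_not.1 fun hn => h n ⟨ih, hn⟩
    rw [he] at this
    exact this
  choose! r hr' using hrank
  have hfB : ∀ x ∈ B 0, G.Adj x (f x) ∧ f x ∈ B (r x) := by
    intro x hx
    rw [hf (r x) (hr' x hx)]
    exact hF _ x (hr' x hx)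
  refine ⟨f, hfm, fun x hx => ⟨(hfB x hx).1, hanti (Nat.zero_le _) (hfB x hx).2⟩, ?_⟩
  rintro ⟨u, huB, hu⟩
  have hle : Antitone fun i => r (u i) := by
    refine antitone_nat_of_succ_le fun i => ?_
    by_contra! hlt
    have h := (hfB _ (huB (i + 1))).2
    rw [hu i] at h
    exact (hr' _ (huB i)).2 (hanti hlt h)
  obtain ⟨N, hN⟩ := WellFoundedGT.monotone_chain_condition
    (⟨fun i => OrderDual.toDual (r (u i)), hle⟩ : ℕ →o ℕᵒᵈ)
  have hmem : ∀ i, u (N + i) ∈ B (r (u N)) \ B (r (u N) + 1) := by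
    intro i
    have : r (u N) = r (u (N + i)) := hN (N + i) (Nat.le_add_right _ _)
    rw [this]
    exact hr' _ (huB _)
  refine hFu (r (u N)) ⟨fun i => u (N + i), hmem, fun i => ?_⟩
  rw [← hf _ (hmem (i + 1))]
  exact hu (N + i)

end SimpleGraph

theorem stmt_10 {X : Type*} [MeasurableSpace X] [StandardBorelSpace X]
    (G : SimpleGraph X) (hGmeas : MeasurableSet {p : X × X | G.Adj p.1 p.2})
    (hlf : ∀ x : X, (G.neighborSet x).Finite)
    (A : ℕ → Set X) (hAmeas : ∀ i, MeasurableSet (A i))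
    (hAdec : ∀ i, A (i + 1) ⊆ A i)
    (hAempty : ⋂ i, A i = ∅)
    (hAmeets : ∀ i, ∀ x : A i, ∃ y : A i,
      (G.induce (A i)).Reachable x y ∧ (y : X) ∈ A (i + 1)) :
    ∃ f : (EGSat G (A 0) : Set X) → X, Measurable f ∧
      (∀ x : (EGSat G (A 0) : Set X), f x ∈ EGSat G (A 0) ∧ G.Adj (x : X) (f x)) ∧
      OneEnded f := by
  let B : ℕ → Set X := fun n => Nat.casesOn n (EGSat G (A 0)) A
  have hB : ∀ n, MeasurableSet (B n) := by
    rintro (_ | n)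
    exacts [SimpleGraph.measurableSet_egSat hGmeas hlf (hAmeas 0), hAmeas n]
  have hanti : Antitone B := by
    refine antitone_nat_of_succ_le ?_
    rintro (_ | n)
    exacts [fun x hx => ⟨x, hx, SimpleGraph.Reachable.refl x⟩, hAdec n]
  have he : ⋂ n, B n = ∅ := Set.eq_empty_of_forall_notMem fun x hx => by
    have : x ∈ ⋂ i, A i := Set.mem_iInter.2 fun i => Set.mem_iInter.1 hx (i + 1)
    rw [hAempty] at this
    exact this
  have hr : ∀ n, ∀ x ∈ B n, ∃ k, x ∈ G.distLevel (B n) (B (n + 1)) k := by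
    rintro (_ | n) x hx
    · obtain ⟨a, ha, hxa⟩ := hx
      refine SimpleGraph.exists_mem_distLevel (y := a) ha ?_
      rw [SimpleGraph.reachable_iff_reflTransGen] at hxa
      induction hxa using Relation.ReflTransGen.head_induction_on with
      | refl => exact Relation.ReflTransGen.refl
      | head h h' ih =>
        refine Relation.ReflTransGen.head ⟨h, a, ha, ?_⟩ ih
        exact h.reachable.trans ((SimpleGraph.reachable_iff_reflTransGen _ _).2 h')
    · obtain ⟨y, hxy, hy⟩ := hAmeets n ⟨x, hx⟩
      rw [SimpleGraph.reachable_iff_reflTransGen] at hxy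
      exact SimpleGraph.exists_mem_distLevel hy
        (hxy.lift (p := fun a b => G.Adj a b ∧ a ∈ A n) Subtype.val fun a b h => ⟨h, a.2⟩)
  obtain ⟨f, hfm, hf, hfu⟩ :=
    SimpleGraph.exists_measurable_one_ended_of_antitone hGmeas hlf hB hanti he hr
  refine ⟨fun x => f x, hfm.comp measurable_subtype_coe,
    fun x => ⟨(hf x x.2).2, (hf x x.2).1⟩, ?_⟩
  rintro ⟨u, hu⟩
  exact hfu ⟨fun i => u i, fun i => (u i).2, hu⟩
end

section
/- Let G be an acyclic Borel graph on a standard Borel space X with all vertex degrees bounded by some natural number d, and suppose G is ample. Then for every Borel probability measure μ on X there is a μ-conull Borel set B ⊆ X and a one-ended Borel function f : B → X whose graph is contained in G. -/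
open MeasureTheory

namespace AmpleForest

section Combinatorics

variable {X : Type*} {G : SimpleGraph X} {A S : Set X}

/-- `x` is a vertex of `A` with at least three neighbours in `A`. -/
def IsBranch (G : SimpleGraph X) (A : Set X) (x : X) : Prop :=
  x ∈ A ∧ ∃ a b c, a ≠ b ∧ a ≠ c ∧ b ≠ c ∧ (G.Adj x a ∧ a ∈ A) ∧ (G.Adj x b ∧ b ∈ A) ∧
    (G.Adj x c ∧ c ∈ A)

/-- `Seg G A x y x' w` says that the non-backtracking walk in `A` starting with the dart `x → y`
and continuing through vertices that do not branch in `A` reaches its first branch vertex `w`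
through the dart `x' → w`. -/
inductive Seg (G : SimpleGraph X) (A : Set X) : X → X → X → X → Prop
  | single {x y : X} : G.Adj x y → IsBranch G A y → Seg G A x y x y
  | go {x y z x' w : X} : G.Adj x y → y ∈ A → ¬ IsBranch G A y → z ≠ x →
      Seg G A y z x' w → Seg G A x y x' w

/-- Every vertex of `A` has at least two neighbours in `A`, and every dart of `A` leads to a branch
vertex. -/
structure AmpleOn (G : SimpleGraph X) (A : Set X) : Prop where
  two_nbrs : ∀ x ∈ A, ∃ a b, a ≠ b ∧ (G.Adj x a ∧ a ∈ A) ∧ (G.Adj x b ∧ b ∈ A)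
  exists_seg : ∀ x ∈ A, ∀ y ∈ A, G.Adj x y → ∃ x' w, Seg G A x y x' w

lemma Seg.adj {x y x' w : X} (h : Seg G A x y x' w) : G.Adj x y := by
  cases h <;> assumption

lemma Seg.mem {x y x' w : X} (h : Seg G A x y x' w) : y ∈ A := by
  cases h with
  | single _ h => exact h.1
  | go _ h => exact h

lemma Seg.adj_last {x y x' w : X} (h : Seg G A x y x' w) : G.Adj x' w := by
  induction h with
  | single h _ => exact h
  | go _ _ _ _ _ ih => exact ih

lemma Seg.isBranch {x y x' w : X} (h : Seg G A x y x' w) : IsBranch G A w := by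
  induction h with
  | single _ h => exact h
  | go _ _ _ _ _ ih => exact ih

lemma Seg.reachable {x y x' w : X} (h : Seg G A x y x' w) : G.Reachable x w := by
  induction h with
  | single h _ => exact h.reachable
  | go h _ _ _ _ ih => exact h.reachable.trans ih

lemma eq_or_eq_of_not_isBranch {x a b c : X} (hx : x ∈ A) (h : ¬ IsBranch G A x) (hab : a ≠ b)
    (ha : G.Adj x a) (ha' : a ∈ A) (hb : G.Adj x b) (hb' : b ∈ A) (hc : G.Adj x c) (hc' : c ∈ A) :
    c = a ∨ c = b := by
  by_contra! hne
  exact h ⟨hx, a, b, c, hab, hne.1.symm, hne.2.symm, ⟨ha, ha'⟩, ⟨hb, hb'⟩, ⟨hc, hc'⟩⟩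

lemma Seg.eq_of_seg {x y p q p' q' : X} (h : Seg G A x y p q) (hx : x ∈ A)
    (h' : Seg G A x y p' q') : q = q' := by
  induction h with
  | single _ hb =>
    cases h' with
    | single => rfl
    | go _ _ hnb => exact absurd hb hnb
  | go hxy hy hnb hz h ih =>
    cases h' with
    | single _ hb => exact absurd hb hnb
    | go _ _ _ hz' h' =>
      rcases eq_or_eq_of_not_isBranch hy hnb hz h.adj h.mem hxy.symm hx h'.adj h'.mem with e | e
      · subst e
        exact ih hy h'
      · exact absurd e hz'

lemma Seg.reverse_append {x y x' w p q : X} (h : Seg G A x y x' w) (h' : Seg G A y x p q) :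
    Seg G A w x' p q := by
  induction h with
  | single => exact h'
  | go hxy hy hnb hz h ih => exact ih (.go h.adj.symm hy hnb hz.symm h')

lemma Seg.reverse {x y x' w : X} (h : Seg G A x y x' w) (hx : IsBranch G A x) :
    Seg G A w x' y x :=
  h.reverse_append (.single h.adj.symm hx)

/-- `v` and `w` are equal or joined by a segment of `A` without interior branch vertices. -/
def Link (G : SimpleGraph X) (A : Set X) (v w : X) : Prop :=
  v = w ∨ (IsBranch G A v ∧ ∃ y x', Seg G A v y x' w)

/-- `v` and `w` are at most three links apart. -/
def Near (G : SimpleGraph X) (A : Set X) (v w : X) : Prop :=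
  ∃ a b, Link G A v a ∧ Link G A a b ∧ Link G A b w

lemma Seg.link {x y x' w : X} (h : Seg G A x y x' w) (hx : IsBranch G A x) : Link G A x w :=
  Or.inr ⟨hx, y, x', h⟩

lemma Link.symm {v w : X} (h : Link G A v w) : Link G A w v := by
  rcases h with rfl | ⟨hv, y, x', h⟩
  · exact Or.inl rfl
  · exact (h.reverse hv).link h.isBranch

lemma Link.reachable {v w : X} (h : Link G A v w) : G.Reachable v w := by
  rcases h with rfl | ⟨hv, y, x', h⟩
  · rfl
  · exact h.reachable

lemma Near.symm {v w : X} (h : Near G A v w) : Near G A w v := by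
  obtain ⟨a, b, h1, h2, h3⟩ := h
  exact ⟨b, a, h3.symm, h2.symm, h1.symm⟩

lemma Near.reachable {v w : X} (h : Near G A v w) : G.Reachable v w := by
  obtain ⟨a, b, h1, h2, h3⟩ := h
  exact h1.reachable.trans (h2.reachable.trans h3.reachable)

lemma exists_isPath_concat {s y a : X} (hs : G.Reachable s y) (ha : G.Adj y a)
    (h : G.dist s a ≤ G.dist s y) : ∃ p : G.Walk s a, (p.concat ha.symm).IsPath := by
  classical
  obtain ⟨p, hp⟩ := (hs.trans ha.reachable).exists_walk_length_eq_dist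
  refine ⟨p, (p.isPath_of_length_eq_dist hp).concat (fun hy => ?_) _⟩
  have h1 := p.length_takeUntil_lt_length hy ha.ne
  have h2 := SimpleGraph.dist_le (p.takeUntil y hy)
  omega

lemma eq_of_dist_le (hG : G.IsAcyclic) {s y a b : X} (hs : G.Reachable s y) (ha : G.Adj y a)
    (hb : G.Adj y b) (h1 : G.dist s a ≤ G.dist s y) (h2 : G.dist s b ≤ G.dist s y) : a = b := by
  obtain ⟨p, hp⟩ := exists_isPath_concat hs ha h1
  obtain ⟨q, hq⟩ := exists_isPath_concat hs hb h2
  have := (hG.subsingleton_path s y).elim ⟨_, hp⟩ ⟨_, hq⟩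
  exact (SimpleGraph.Walk.concat_inj (congrArg Subtype.val this)).1

lemma dist_eq_add_one (hG : G.IsAcyclic) {s y a b : X} (hs : G.Reachable s y) (ha : G.Adj y a)
    (hb : G.Adj y b) (hab : b ≠ a) (h1 : G.dist s a ≤ G.dist s y) :
    G.dist s b = G.dist s y + 1 := by
  by_contra hne
  refine hab (eq_of_dist_le hG hs ha hb h1 ?_).symm
  have : G.dist s b ≤ G.dist s y + 1 := by
    have := hs.dist_triangle_left b
    rwa [SimpleGraph.dist_eq_one_iff_adj.2 hb] at this
  omega

lemma Seg.dist_last (hG : G.IsAcyclic) {s x y x' w : X} (hs : G.Reachable s x)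
    (h : Seg G A x y x' w) (hd : G.dist s y = G.dist s x + 1) :
    G.dist s w = G.dist s x' + 1 ∧ G.dist s x < G.dist s w := by
  induction h with
  | single => omega
  | go hxy hy hnb hz h ih =>
    have hsy := hs.trans hxy.reachable
    have := ih hsy (dist_eq_add_one hG hsy hxy.symm h.adj hz (by omega))
    omega

/-- Distinct elements of `S`, a set of branch vertices of `A`, are never near each other. -/
structure Sparse (G : SimpleGraph X) (A S : Set X) : Prop where
  isBranch : ∀ s ∈ S, IsBranch G A s
  eq_of_near : ∀ s ∈ S, ∀ t ∈ S, Near G A s t → s = t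

/-- `x` belongs to the open star of `s ∈ S` in `A`. -/
def Own (G : SimpleGraph X) (A S : Set X) (x s : X) : Prop :=
  s ∈ S ∧ x ∈ A ∧ (x = s ∨ (¬ IsBranch G A x ∧ ∃ y x', Seg G A x y x' s))

/-- The set obtained from `A` by removing the open stars of all elements of `S`. -/
def trim (G : SimpleGraph X) (A S : Set X) : Set X :=
  {x | x ∈ A ∧ ¬ ∃ s, Own G A S x s}

lemma trim_subset : trim G A S ⊆ A := fun _ h => h.1

lemma mem_trim_or {x : X} (hx : x ∈ A) : x ∈ trim G A S ∨ ∃ s, Own G A S x s := by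
  by_cases h : ∃ s, Own G A S x s
  · exact Or.inr h
  · exact Or.inl ⟨hx, h⟩

lemma Own.reachable {x s : X} (h : Own G A S x s) : G.Reachable x s := by
  obtain ⟨_, _, rfl | ⟨_, y, x', h⟩⟩ := h
  · rfl
  · exact h.reachable

lemma IsBranch.of_trim {x : X} (h : IsBranch G (trim G A S) x) : IsBranch G A x := by
  obtain ⟨hx, a, b, c, hab, hac, hbc, ha, hb, hc⟩ := h
  exact ⟨hx.1, a, b, c, hab, hac, hbc, ⟨ha.1, ha.2.1⟩, ⟨hb.1, hb.2.1⟩, ⟨hc.1, hc.2.1⟩⟩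

lemma Own.unique (hS : Sparse G A S) {x s t : X} (hs : Own G A S x s) (ht : Own G A S x t) :
    s = t := by
  obtain ⟨hsS, hx, rfl | ⟨hnb, y, x', h⟩⟩ := hs
  · obtain ⟨-, -, rfl | ⟨hnb, -⟩⟩ := ht
    · rfl
    · exact absurd (hS.isBranch _ hsS) hnb
  · obtain ⟨htS, -, rfl | ⟨-, y', x'', h'⟩⟩ := ht
    · exact absurd (hS.isBranch _ htS) hnb
    · by_cases hy : y' = y
      · subst hy
        exact h.eq_of_seg hx h'
      · have := h.reverse_append (.go h.adj.symm hx hnb hy h')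
        exact hS.eq_of_near _ hsS _ htS
          ⟨s, s, Or.inl rfl, Or.inl rfl, this.link (hS.isBranch _ hsS)⟩

lemma Own.of_adj (hS : Sparse G A S) {x z s : X} (hs : Own G A S x s) (hz : z ∈ A)
    (hnb : ¬ IsBranch G A z) (hxz : G.Adj x z) : Own G A S z s := by
  obtain ⟨hsS, hx, rfl | ⟨hnbx, y, x', h⟩⟩ := hs
  · exact ⟨hsS, hz, Or.inr ⟨hnb, _, _, .single hxz.symm (hS.isBranch _ hsS)⟩⟩
  · by_cases hy : y = z
    · subst hy
      cases h with
      | single _ hb => exact absurd hb hnb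
      | go _ _ _ _ h => exact ⟨hsS, hz, Or.inr ⟨hnb, _, _, h⟩⟩
    · exact ⟨hsS, hz, Or.inr ⟨hnb, _, _, .go hxz.symm hx hnbx hy h⟩⟩

lemma Own.eq_of_isBranch {x s : X} (hs : Own G A S x s) (hb : IsBranch G A x) : x = s :=
  hs.2.2.resolve_right fun h => h.1 hb

lemma Own.eq_of_adj (hS : Sparse G A S) {x z s t : X} (hs : Own G A S x s) (ht : Own G A S z t)
    (hxz : G.Adj x z) : s = t := by
  by_cases hz : IsBranch G A z
  · by_cases hx : IsBranch G A x
    · obtain rfl := hs.eq_of_isBranch hx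
      obtain rfl := ht.eq_of_isBranch hz
      exact hS.eq_of_near _ hs.1 _ ht.1
        ⟨x, x, Or.inl rfl, Or.inl rfl, (Seg.single hxz hz).link hx⟩
    · exact hs.unique hS (ht.of_adj hS hs.2.1 hx hxz.symm)
  · exact (hs.of_adj hS ht.2.1 hz hxz).unique hS ht

lemma mem_trim_of_adj (hS : Sparse G A S) {x y : X} (hx : x ∈ trim G A S) (hnb : ¬ IsBranch G A x)
    (hy : y ∈ A) (hxy : G.Adj x y) : y ∈ trim G A S :=
  ⟨hy, fun ⟨s, hs⟩ => hx.2 ⟨s, hs.of_adj hS hx.1 hnb hxy.symm⟩⟩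

lemma Own.exists_seg {w u s : X} (hS : Sparse G A S) (hs : Own G A S u s) (hw : w ∈ trim G A S)
    (hb : IsBranch G A w) (hwu : G.Adj w u) : ∃ x', Seg G A w u x' s := by
  obtain ⟨hsS, hu, rfl | ⟨hnbx, y, x', h⟩⟩ := hs
  · exact ⟨_, .single hwu (hS.isBranch _ hsS)⟩
  · by_cases hy : y = w
    · subst hy
      cases h with
      | single => exact absurd ⟨_, hsS, hw.1, Or.inl rfl⟩ hw.2
      | go _ _ hnb => exact absurd hb hnb
    · exact ⟨_, .go hwu hu hnbx hy h⟩

lemma Seg.dist_end (hG : G.IsAcyclic) {x y x' w : X} (h : Seg G A x y x' w)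
    (hx : IsBranch G A x) : G.dist w x = G.dist w y + 1 := by
  have h' := h.reverse hx
  refine (h'.dist_last hG (SimpleGraph.Reachable.refl w) ?_).1
  rw [SimpleGraph.dist_self, SimpleGraph.dist_eq_one_iff_adj.2 h'.adj]

lemma eq_of_own_of_own (hG : G.IsAcyclic) (hS : Sparse G A S) {w u v s t : X}
    (hw : w ∈ trim G A S) (hb : IsBranch G A w) (hwu : G.Adj w u) (hwv : G.Adj w v)
    (hs : Own G A S u s) (ht : Own G A S v t) : u = v := by
  by_contra hne
  obtain ⟨p, hp⟩ := hs.exists_seg hS hw hb hwu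
  obtain ⟨q, hq⟩ := ht.exists_seg hS hw hb hwv
  obtain rfl := hS.eq_of_near _ hs.1 _ ht.1
    ⟨w, w, (hp.link hb).symm, Or.inl rfl, hq.link hb⟩
  have hd := hp.dist_end hG hb
  have hd' := hq.dist_last hG hp.reachable.symm
    (dist_eq_add_one hG hp.reachable.symm hwu hwv (Ne.symm hne) (by omega))
  rw [SimpleGraph.dist_self] at hd'
  omega

lemma two_nbrs_trim (hG : G.IsAcyclic) (hA : AmpleOn G A) (hS : Sparse G A S) {x : X}
    (hx : x ∈ trim G A S) :
    ∃ a b, a ≠ b ∧ (G.Adj x a ∧ a ∈ trim G A S) ∧ (G.Adj x b ∧ b ∈ trim G A S) := by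
  by_cases hb : IsBranch G A x
  · obtain ⟨-, a, b, c, hab, hac, hbc, ⟨ha, ha'⟩, ⟨hb', hb''⟩, ⟨hc, hc'⟩⟩ := id hb
    rcases mem_trim_or (G := G) (S := S) ha' with h1 | ⟨s1, h1⟩ <;>
    rcases mem_trim_or (G := G) (S := S) hb'' with h2 | ⟨s2, h2⟩ <;>
    rcases mem_trim_or (G := G) (S := S) hc' with h3 | ⟨s3, h3⟩
    · exact ⟨a, b, hab, ⟨ha, h1⟩, ⟨hb', h2⟩⟩
    · exact ⟨a, b, hab, ⟨ha, h1⟩, ⟨hb', h2⟩⟩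
    · exact ⟨a, c, hac, ⟨ha, h1⟩, ⟨hc, h3⟩⟩
    · exact absurd (eq_of_own_of_own hG hS hx hb hb' hc h2 h3) hbc
    · exact ⟨b, c, hbc, ⟨hb', h2⟩, ⟨hc, h3⟩⟩
    · exact absurd (eq_of_own_of_own hG hS hx hb ha hc h1 h3) hac
    · exact absurd (eq_of_own_of_own hG hS hx hb ha hb' h1 h2) hab
    · exact absurd (eq_of_own_of_own hG hS hx hb ha hb' h1 h2) hab
  · obtain ⟨a, b, hab, ha, hb'⟩ := hA.two_nbrs x hx.1
    exact ⟨a, b, hab, ⟨ha.1, mem_trim_of_adj hS hx hb ha.2 ha.1⟩,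
      ⟨hb'.1, mem_trim_of_adj hS hx hb hb'.2 hb'.1⟩⟩

lemma Seg.last_mem_trim (hS : Sparse G A S) {x y x' w : X} (h : Seg G A x y x' w)
    (hx : x ∈ trim G A S) (hy : y ∈ trim G A S) : x' ∈ trim G A S ∧ w ∈ trim G A S := by
  induction h with
  | single => exact ⟨hx, hy⟩
  | go hxy hyA hnb hz h ih => exact ih hy (mem_trim_of_adj hS hy hnb h.mem h.adj)

lemma Seg.append_trim (hS : Sparse G A S) {x y x' w p q : X} (h : Seg G A x y x' w)
    (hy : y ∈ trim G A S) (h' : Seg G (trim G A S) x' w p q) : Seg G (trim G A S) x y p q := by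
  induction h with
  | single => exact h'
  | go hxy hyA hnb hz h ih =>
    exact .go hxy hy (fun hb => hnb hb.of_trim) hz
      (ih (mem_trim_of_adj hS hy hnb h.mem h.adj) h')

lemma exists_own_of_not_isBranch_trim {w : X} (hw : w ∈ trim G A S) (hb : IsBranch G A w)
    (hnb : ¬ IsBranch G (trim G A S) w) : ∃ r s, G.Adj w r ∧ Own G A S r s := by
  by_contra! hne
  have key : ∀ {a}, G.Adj w a ∧ a ∈ A → G.Adj w a ∧ a ∈ trim G A S := fun ⟨h1, h2⟩ =>
    ⟨h1, h2, fun ⟨s, hs⟩ => hne _ s h1 hs⟩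
  obtain ⟨-, a, b, c, hab, hac, hbc, ha, hb, hc⟩ := hb
  exact hnb ⟨hw, a, b, c, hab, hac, hbc, key ha, key hb, key hc⟩

lemma AmpleOn.trim (hG : G.IsAcyclic) (hA : AmpleOn G A) (hS : Sparse G A S) :
    AmpleOn G (trim G A S) := by
  refine ⟨fun x => two_nbrs_trim hG hA hS, fun x hx y hy hxy => ?_⟩
  obtain ⟨x', w, h⟩ := hA.exists_seg x hx.1 y hy.1 hxy
  obtain ⟨hx', hw⟩ := h.last_mem_trim hS hx hy
  suffices ∃ p q, Seg G (AmpleForest.trim G A S) x' w p q by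
    obtain ⟨p, q, hpq⟩ := this
    exact ⟨p, q, h.append_trim hS hy hpq⟩
  by_cases hb : IsBranch G (AmpleForest.trim G A S) w
  · exact ⟨_, _, .single h.adj_last hb⟩
  obtain ⟨u, hu, hwu, hux⟩ : ∃ u ∈ AmpleForest.trim G A S, G.Adj w u ∧ u ≠ x' := by
    obtain ⟨a, b, hab, ha, hb⟩ := two_nbrs_trim hG hA hS hw
    by_cases hax : a = x'
    · exact ⟨b, hb.2, hb.1, fun h => hab (hax.trans h.symm)⟩
    · exact ⟨a, ha.2, ha.1, hax⟩
  obtain ⟨x₂, w₂, h₂⟩ := hA.exists_seg w hw.1 u hu.1 hwu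
  obtain ⟨hx₂, hw₂⟩ := h₂.last_mem_trim hS hw hu
  refine ⟨x₂, w₂, .go h.adj_last hw hb hux (h₂.append_trim hS hu (.single h₂.adj_last ?_))⟩
  by_contra hb₂
  obtain ⟨r, s, hwr, hrs⟩ := exists_own_of_not_isBranch_trim hw h.isBranch hb
  obtain ⟨r₂, s₂, hwr₂, hrs₂⟩ := exists_own_of_not_isBranch_trim hw₂ h₂.isBranch hb₂
  obtain ⟨p, hp⟩ := hrs.exists_seg hS hw h.isBranch hwr
  obtain ⟨p₂, hp₂⟩ := hrs₂.exists_seg hS hw₂ h₂.isBranch hwr₂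
  obtain rfl := hS.eq_of_near _ hrs.1 _ hrs₂.1
    ⟨w, w₂, (hp.link h.isBranch).symm, h₂.link h.isBranch, hp₂.link h₂.isBranch⟩
  have hd := hp.dist_end hG h.isBranch
  have hur : u ≠ r := by
    rintro rfl
    exact hu.2 ⟨_, hrs⟩
  have hr₂ : r₂ ≠ x₂ := by
    rintro rfl
    exact hx₂.2 ⟨_, hrs₂⟩
  have hd₂ := h₂.dist_last hG hp.reachable.symm
    (dist_eq_add_one hG hp.reachable.symm hwr hwu hur (by omega))
  have hd₃ := hp₂.dist_last hG hp₂.reachable.symm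
    (dist_eq_add_one hG hp₂.reachable.symm h₂.adj_last.symm hwr₂ hr₂ (by omega))
  rw [SimpleGraph.dist_self] at hd₃
  omega

/-- `y` is a neighbour of `x` in `A` pointing away from the centre of the star containing `x`. -/
def Away (G : SimpleGraph X) (A S : Set X) (x y : X) : Prop :=
  G.Adj x y ∧ y ∈ A ∧ ∃ s, Own G A S x s ∧ G.dist s y = G.dist s x + 1

lemma Own.exists_away (hG : G.IsAcyclic) (hA : AmpleOn G A) {x s : X} (hs : Own G A S x s) :
    ∃ y, Away G A S x y := by
  obtain ⟨a, b, hab, ha, hb⟩ := hA.two_nbrs x hs.2.1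
  by_cases h : G.dist s a ≤ G.dist s x
  · exact ⟨b, hb.1, hb.2, s, hs, dist_eq_add_one hG hs.reachable.symm ha.1 hb.1 hab.symm h⟩
  · refine ⟨a, ha.1, ha.2, s, hs, ?_⟩
    have := hs.reachable.symm.dist_triangle_left a
    rw [SimpleGraph.dist_eq_one_iff_adj.2 ha.1] at this
    omega

open Classical in
/-- The distance of `x` to the centre of the star containing it. -/
noncomputable def starDist (G : SimpleGraph X) (A S : Set X) (x : X) : ℕ :=
  if h : ∃ s, Own G A S x s then G.dist h.choose x else 0

lemma Own.starDist_eq (hS : Sparse G A S) {x s : X} (hs : Own G A S x s) :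
    starDist G A S x = G.dist s x := by
  have h : ∃ s, Own G A S x s := ⟨s, hs⟩
  rw [starDist, dif_pos h, h.choose_spec.unique hS hs]

lemma Away.mem_trim_or_starDist_lt (hS : Sparse G A S) {x y : X} (h : Away G A S x y) :
    y ∈ AmpleForest.trim G A S ∨ starDist G A S x < starDist G A S y := by
  obtain ⟨hxy, hy, s, hs, hd⟩ := h
  refine (mem_trim_or hy).imp_right fun ⟨t, ht⟩ => ?_
  obtain rfl := hs.eq_of_adj hS ht hxy
  rw [hs.starDist_eq hS, ht.starDist_eq hS]
  omega

lemma exists_seg_of_isPath {x y z : X} (p : G.Walk y z) (hp : p.IsPath) (hx : x ∉ p.support)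
    (hxy : G.Adj x y) (hz : IsBranch G Set.univ z) : ∃ x' w, Seg G Set.univ x y x' w := by
  induction p generalizing x with
  | nil => exact ⟨_, _, .single hxy hz⟩
  | @cons y y' z h p ih =>
    by_cases hb : IsBranch G Set.univ y
    · exact ⟨_, _, .single hxy hb⟩
    · rw [SimpleGraph.Walk.cons_isPath_iff] at hp
      obtain ⟨x', w, hw⟩ := ih hp.1 hp.2 h hz
      refine ⟨x', w, .go hxy trivial hb ?_ hw⟩
      rintro rfl
      exact hx (by simp)

lemma ampleOn_univ (hG : AmpleGraph G) : AmpleOn G Set.univ := by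
  refine ⟨fun x _ => ?_, fun x _ y _ hxy => ?_⟩
  · obtain ⟨a, b, ha, hb, hab⟩ := Set.one_lt_encard_iff.1
      (lt_of_lt_of_le (by norm_num) (hG.1 x))
    exact ⟨a, b, hab, ⟨ha, trivial⟩, ⟨hb, trivial⟩⟩
  · have hy : y ∈ ({x}ᶜ : Set X) := hxy.ne'
    obtain ⟨z, ⟨p⟩, hz⟩ := hG.2 x ⟨y, hy⟩
    classical
    obtain ⟨p, hp⟩ := p.toPath
    obtain ⟨t, ht, hcard⟩ := Set.exists_subset_encard_eq hz
    obtain ⟨a, b, c, hab, hac, hbc, rfl⟩ := Set.encard_eq_three.1 hcard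
    let φ : G.induce ({x}ᶜ : Set X) →g G := (SimpleGraph.Embedding.induce _).toHom
    have hsupp : x ∉ (p.map φ).support := by
      rw [SimpleGraph.Walk.support_map]
      intro hx
      obtain ⟨v, -, hv⟩ := List.mem_map.1 hx
      exact v.2 hv
    exact exists_seg_of_isPath (p.map φ) (hp.map Subtype.val_injective) hsupp hxy
      ⟨trivial, a, b, c, fun h => hab (Subtype.ext h), fun h => hac (Subtype.ext h),
        fun h => hbc (Subtype.ext h), ⟨ht (by simp), trivial⟩, ⟨ht (by simp), trivial⟩,
        ⟨ht (by simp), trivial⟩⟩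

end Combinatorics

section Measurability

open Set

lemma exists_measurable_selectors {X : Type*} [MeasurableSpace X] [StandardBorelSpace X] (d : ℕ)
    (R : X → X → Prop) (hR : MeasurableSet {p : X × X | R p.1 p.2})
    (hd : ∀ x, {y | R x y}.encard ≤ d) :
    ∃ 𝓕 : Set (X → X), 𝓕.Countable ∧ (∀ f ∈ 𝓕, Measurable f) ∧
      ∀ x y, R x y → ∃ f ∈ 𝓕, f x = y := by
  classical
  obtain ⟨e, he⟩ := exists_measurableEmbedding_real X
  induction d generalizing R with
  | zero =>
    refine ⟨∅, countable_empty, by simp, fun x y hxy => ?_⟩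
    have := hd x
    simp only [Nat.cast_zero, nonpos_iff_eq_zero, encard_eq_zero] at this
    exact absurd hxy (eq_empty_iff_forall_notMem.1 this y)
  | succ d ih =>
    let T : Set (X × (Fin (d + 1) → X)) :=
      {p | StrictMono (e ∘ p.2) ∧ ∀ i, R p.1 (p.2 i)}
    have hT : MeasurableSet T := by
      have hmono : T = (⋂ i, ⋂ j, {p | i < j → e (p.2 i) < e (p.2 j)}) ∩
          ⋂ i, {p | R p.1 (p.2 i)} := by
        ext p
        simp [T, StrictMono]
      rw [hmono]
      refine .inter (.iInter fun i => .iInter fun j => ?_) (.iInter fun i => ?_)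
      · by_cases hij : i < j
        · simp only [hij, forall_const]
          exact measurableSet_lt (he.measurable.comp (by fun_prop))
            (he.measurable.comp (by fun_prop))
        · simp [hij]
      · exact hR.preimage (f := fun p : X × (Fin (d + 1) → X) => (p.1, p.2 i)) (by fun_prop)
    have hrange : ∀ x v, (x, v) ∈ T → range v = {y | R x y} := by
      intro x v hv
      have hinj : Function.Injective v := hv.1.injective.of_comp
      refine (finite_range v).eq_of_subset_of_encard_le
        (range_subset_iff.2 hv.2) ((hd x).trans (le_of_eq ?_))
      rw [← image_univ, hinj.encard_image, encard_univ]
      simp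
    have hinj : InjOn Prod.fst T := by
      rintro ⟨x, v⟩ hv ⟨x', v'⟩ hv' (rfl : x = x')
      have : e ∘ v = e ∘ v' := by
        rw [← hv.1.range_inj hv'.1, range_comp, range_comp, hrange _ _ hv, hrange _ _ hv']
      rw [he.injective.comp_left this]
    have himg : ∀ {U}, MeasurableSet U → MeasurableSet (Prod.fst '' (T ∩ U)) := fun hU =>
      (hT.inter hU).image_of_measurable_injOn measurable_fst (hinj.mono inter_subset_left)
    let g : Fin (d + 1) → X → X := fun i x => if h : ∃ v, (x, v) ∈ T then h.choose i else x
    have hD : MeasurableSet {x | ∃ v, (x, v) ∈ T} := by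
      convert himg MeasurableSet.univ using 1
      ext x
      simp
    have hg : ∀ i, Measurable (g i) := by
      intro i U hU
      have : g i ⁻¹' U = Prod.fst '' (T ∩ {p | p.2 i ∈ U}) ∪ ({x | ∃ v, (x, v) ∈ T}ᶜ ∩ U) := by
        ext x
        by_cases h : ∃ v, (x, v) ∈ T
        · have hgx : g i x = h.choose i := by simp only [g, dif_pos h]
          simp only [mem_preimage, hgx, mem_union, mem_image, mem_inter_iff, mem_ofPred_eq,
            mem_compl_iff, h, not_true_eq_false, false_and, or_false]
          constructor
          · exact fun hU => ⟨_, ⟨h.choose_spec, hU⟩, rfl⟩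
          · rintro ⟨⟨x', v⟩, ⟨hv, hvU⟩, rfl⟩
            have := hinj hv h.choose_spec rfl
            simp only [Prod.mk.injEq, true_and] at this
            rwa [this] at hvU
        · have hgx : g i x = x := by simp only [g, dif_neg h]
          simp only [mem_preimage, hgx, mem_union, mem_image, mem_inter_iff, mem_ofPred_eq,
            mem_compl_iff, h, not_false_eq_true, true_and]
          constructor
          · exact Or.inr
          · rintro (⟨⟨x', v⟩, ⟨hv, -⟩, rfl⟩ | h)
            · exact absurd ⟨v, hv⟩ h
            · exact h
      rw [this]
      exact (himg (hU.preimage (by fun_prop))).union (hD.compl.inter hU)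
    obtain ⟨𝓕, hc, hm, hcov⟩ := ih (fun x y => R x y ∧ ¬ ∃ v, (x, v) ∈ T)
      (hR.inter (hD.compl.preimage measurable_fst)) (by
        intro x
        by_cases h : ∃ v, (x, v) ∈ T
        · simp [h]
        have hle : {y | R x y ∧ ¬ ∃ v, (x, v) ∈ T}.encard ≤ {y | R x y}.encard :=
          encard_le_encard fun y hy => hy.1
        refine hle.trans ?_
        by_contra! hlt
        refine h ?_
        have heq : {y | R x y}.encard = (d + 1 : ℕ) := by
          refine le_antisymm (hd x) ?_
          push_cast
          exact Order.add_one_le_of_lt hlt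
        have hfin : (e '' {y | R x y}).Finite :=
          (finite_of_encard_eq_coe heq).image e
        have hcard : hfin.toFinset.card = d + 1 := by
          have h1 : (e '' {y | R x y}).encard = (d + 1 : ℕ) := by
            rw [he.injective.encard_image, heq]
          rw [hfin.encard_eq_coe_toFinset_card] at h1
          exact_mod_cast h1
        have hmem : ∀ i, ∃ y, R x y ∧ e y = hfin.toFinset.orderEmbOfFin hcard i := by
          intro i
          have := hfin.toFinset.orderEmbOfFin_mem hcard i
          rwa [hfin.mem_toFinset] at this
        choose v hv hev using hmem
        refine ⟨v, ?_, hv⟩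
        have : e ∘ v = hfin.toFinset.orderEmbOfFin hcard := funext hev
        rw [this]
        exact OrderEmbedding.strictMono _)
    refine ⟨𝓕 ∪ range g, hc.union (countable_range g), ?_, fun x y hxy => ?_⟩
    · rintro f (hf | ⟨i, rfl⟩)
      exacts [hm f hf, hg i]
    · by_cases h : ∃ v, (x, v) ∈ T
      · have : y ∈ range h.choose := by
          rw [hrange _ _ h.choose_spec]
          exact hxy
        obtain ⟨i, hi⟩ := this
        refine ⟨g i, Or.inr ⟨i, rfl⟩, ?_⟩
        simp only [g, dif_pos h, hi]
      · obtain ⟨f, hf, hfx⟩ := hcov x y ⟨hxy, h⟩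
        exact ⟨f, Or.inl hf, hfx⟩

/-- The countably many Borel maps `F n` exhaust the connectedness relation of `G`. -/
structure Exhausts {X : Type*} [MeasurableSpace X] (G : SimpleGraph X) (F : ℕ → X → X) : Prop where
  measurable : ∀ n, Measurable (F n)
  exists_eq : ∀ x y, G.Reachable x y → ∃ n, F n x = y

variable {X : Type*} [MeasurableSpace X] {G : SimpleGraph X}

lemma exists_exhausts [StandardBorelSpace X]
    (hGmeas : MeasurableSet {p : X × X | G.Adj p.1 p.2}) (d : ℕ)
    (hdeg : ∀ x : X, (G.neighborSet x).encard ≤ (d : ℕ∞)) : ∃ F, Exhausts G F := by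
  obtain ⟨𝓕, hc, hm, hcov⟩ := exists_measurable_selectors d G.Adj hGmeas hdeg
  have := hc.to_subtype
  let W : List 𝓕 → X → X := fun l x => l.foldl (fun z f => f.1 z) x
  obtain ⟨r, hr⟩ := exists_surjective_nat (List 𝓕)
  refine ⟨fun n => W (r n), fun n => ?_, fun x y hxy => ?_⟩
  · have : ∀ l, Measurable (W l) := by
      intro l
      induction l with
      | nil => exact measurable_id
      | cons f l ih => exact ih.comp (hm f f.2)
    exact this _
  · obtain ⟨p⟩ := hxy
    suffices ∃ l, W l x = y by
      obtain ⟨l, hl⟩ := this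
      obtain ⟨n, rfl⟩ := hr l
      exact ⟨n, hl⟩
    induction p with
    | nil => exact ⟨[], rfl⟩
    | cons h p ih =>
      obtain ⟨f, hf, rfl⟩ := hcov _ _ h
      obtain ⟨l, hl⟩ := ih
      exact ⟨⟨f, hf⟩ :: l, hl⟩

variable {F : ℕ → X → X}

lemma Exhausts.measurableSet_exists (hF : Exhausts G F) {α : Type*} [MeasurableSpace α]
    {R : α → X → Prop} (hR : MeasurableSet {q : α × X | R q.1 q.2}) {b : α → X}
    (hb : Measurable b) (hsub : ∀ a z, R a z → G.Reachable (b a) z) :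
    MeasurableSet {a | ∃ z, R a z} := by
  have : {a | ∃ z, R a z} = ⋃ n, (fun a => (a, F n (b a))) ⁻¹' {q : α × X | R q.1 q.2} := by
    ext a
    simp only [mem_ofPred_eq, mem_iUnion, mem_preimage]
    constructor
    · rintro ⟨z, hz⟩
      obtain ⟨n, rfl⟩ := hF.exists_eq _ _ (hsub a z hz)
      exact ⟨n, hz⟩
    · rintro ⟨n, hn⟩
      exact ⟨_, hn⟩
  rw [this]
  exact .iUnion fun n => hR.preimage (measurable_id.prodMk ((hF.measurable n).comp hb))

/-- `R x` has at most `n` elements for every `x`. -/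
def BddBy {X : Type*} (R : X → X → Prop) (n : ℕ) : Prop :=
  ∀ x, ∃ t : Finset X, t.card ≤ n ∧ ∀ y, R x y → y ∈ t

lemma BddBy.comp {X : Type*} {R T : X → X → Prop} {m n : ℕ} (hR : BddBy R m) (hT : BddBy T n) :
    BddBy (fun x z => ∃ y, R x y ∧ T y z) (m * n) := by
  classical
  intro x
  obtain ⟨t, ht, hRt⟩ := hR x
  choose u hu hTu using hT
  refine ⟨t.biUnion u, (Finset.card_biUnion_le_card_mul _ _ n fun y _ => hu y).trans (by gcongr),
    fun z ⟨y, hxy, hyz⟩ => Finset.mem_biUnion.2 ⟨y, hRt y hxy, hTu y z hyz⟩⟩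

lemma BddBy.mono {X : Type*} {R T : X → X → Prop} {n : ℕ} (hR : BddBy R n)
    (h : ∀ x y, T x y → R x y) : BddBy T n := fun x =>
  (hR x).imp fun _ ht => ⟨ht.1, fun y hy => ht.2 y (h x y hy)⟩

variable {K : X → X → Prop}

lemma Exhausts.exists_coloring_nat [StandardBorelSpace X] (hF : Exhausts G F)
    (hKm : MeasurableSet {p : X × X | K p.1 p.2}) (hKr : ∀ x y, K x y → G.Reachable x y)
    (hKne : ∀ x y, K x y → x ≠ y) {N : ℕ} (hKN : BddBy K N) :
    ∃ c : X → ℕ, Measurable c ∧ ∀ x y, K x y → c x ≠ c y := by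
  classical
  obtain ⟨e, he⟩ := exists_measurableEmbedding_real X
  obtain ⟨r, hr⟩ := exists_surjective_nat (ℚ × ℚ)
  let I : ℕ → Set ℝ := fun n => Ioo ((r n).1 : ℝ) (r n).2
  let P : ℕ → X → Prop := fun n x => e x ∈ I n ∧ ¬ ∃ y, K x y ∧ e y ∈ I n
  have hI : ∀ n, MeasurableSet (e ⁻¹' I n) := fun n => he.measurable measurableSet_Ioo
  have hP : ∀ n, MeasurableSet {x | P n x} := fun n =>
    (hI n).inter (hF.measurableSet_exists (R := fun x y => K x y ∧ e y ∈ I n)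
      (hKm.inter ((hI n).preimage measurable_snd)) measurable_id
      (fun x y h => hKr x y h.1)).compl
  have hex : ∀ x, ∃ n, P n x := by
    intro x
    obtain ⟨t, -, ht⟩ := hKN x
    have hopen : (e '' (↑(t.erase x) : Set X))ᶜ ∈ nhds (e x) := by
      refine (((t.erase x).finite_toSet.image e).isClosed.isOpen_compl).mem_nhds ?_
      rintro ⟨y, hy, hyx⟩
      rw [he.injective hyx] at hy
      simp at hy
    obtain ⟨a, b, ⟨ha, hb⟩, hab⟩ := mem_nhds_iff_exists_Ioo_subset.1 hopen
    obtain ⟨p, hp, hp'⟩ := exists_rat_btwn ha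
    obtain ⟨q, hq, hq'⟩ := exists_rat_btwn hb
    obtain ⟨n, hn⟩ := hr (p, q)
    refine ⟨n, ?_, ?_⟩
    · simp only [I, hn]
      exact ⟨hp', hq⟩
    · rintro ⟨y, hxy, hy⟩
      simp only [I, hn] at hy
      refine hab ⟨hp.trans hy.1, hy.2.trans hq'⟩ ⟨y, ?_, rfl⟩
      exact Finset.mem_coe.2 (Finset.mem_erase.2 ⟨(hKne x y hxy).symm, ht y hxy⟩)
  refine ⟨fun x => Nat.find (hex x), measurable_find hex hP, fun x y hxy heq => ?_⟩
  have h1 := Nat.find_spec (hex x)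
  have h2 := Nat.find_spec (hex y)
  simp only at heq
  rw [← heq] at h2
  exact h1.2 ⟨y, hxy, h2.1⟩

/-- The greedy recolouring of a graph `K` along a proper colouring `c` by natural numbers. -/
noncomputable def greedy {X : Type*} (K : X → X → Prop) (c : X → ℕ) (x : X) : ℕ :=
  sInf {k | ∀ y, K x y → (h : c y < c x) → greedy K c y ≠ k}
termination_by c x

lemma greedy_spec {X : Type*} {K : X → X → Prop} {N : ℕ} (hKN : BddBy K N) (c : X → ℕ) (x : X) :
    greedy K c x ≤ N ∧ ∀ y, K x y → c y < c x → greedy K c y ≠ greedy K c x := by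
  classical
  obtain ⟨t, htN, ht⟩ := hKN x
  obtain ⟨k, hk, hkt⟩ : ∃ k ∈ Finset.range (N + 1), k ∉ t.image (greedy K c) :=
    Finset.exists_mem_notMem_of_card_lt_card
      ((Finset.card_image_le.trans htN).trans_lt (by simp))
  have hmem : k ∈ {k | ∀ y, K x y → (h : c y < c x) → greedy K c y ≠ k} := fun y hy _ h =>
    hkt (Finset.mem_image.2 ⟨y, ht y hy, h⟩)
  have h1 := Nat.sInf_le hmem
  have h2 := Nat.sInf_mem ⟨k, hmem⟩
  rw [← greedy] at h1 h2
  exact ⟨h1.trans (Nat.lt_succ_iff.1 (Finset.mem_range.1 hk)), h2⟩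

lemma greedy_eq_iff {X : Type*} {K : X → X → Prop} {N : ℕ} (hKN : BddBy K N) (c : X → ℕ) (x : X)
    (k : ℕ) : greedy K c x = k ↔ (¬ ∃ y, K x y ∧ c y < c x ∧ greedy K c y = k) ∧
      ∀ j < k, ∃ y, K x y ∧ c y < c x ∧ greedy K c y = j := by
  have key : ∀ j < greedy K c x, ∃ y, K x y ∧ c y < c x ∧ greedy K c y = j := by
    intro j hj
    rw [greedy] at hj
    simpa using Nat.notMem_of_lt_sInf hj
  constructor
  · rintro rfl
    exact ⟨fun ⟨y, hy, hlt, h⟩ => (greedy_spec hKN c x).2 y hy hlt h, key⟩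
  · rintro ⟨h1, h2⟩
    rcases lt_trichotomy (greedy K c x) k with h | h | h
    · obtain ⟨y, hy, hlt, h⟩ := h2 _ h
      exact absurd h ((greedy_spec hKN c x).2 y hy hlt)
    · exact h
    · exact absurd (key k h) h1

lemma Exhausts.exists_coloring [StandardBorelSpace X] (hF : Exhausts G F)
    (hKm : MeasurableSet {p : X × X | K p.1 p.2}) (hKr : ∀ x y, K x y → G.Reachable x y)
    (hKne : ∀ x y, K x y → x ≠ y) (hKsymm : ∀ x y, K x y → K y x) {N : ℕ} (hKN : BddBy K N) :
    ∃ c : X → ℕ, Measurable c ∧ (∀ x, c x ≤ N) ∧ ∀ x y, K x y → c x ≠ c y := by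
  obtain ⟨c, hc, hcK⟩ := hF.exists_coloring_nat hKm hKr hKne hKN
  refine ⟨greedy K c, ?_, fun x => (greedy_spec hKN c x).1, fun x y hxy => ?_⟩
  · have hstage : ∀ n k, MeasurableSet {x | c x = n ∧ greedy K c x = k} := by
      intro n
      induction n using Nat.strong_induction_on with
      | _ n ih =>
      have hE : ∀ j, MeasurableSet {x | ∃ y, K x y ∧ c y < n ∧ greedy K c y = j} := by
        intro j
        have heq : {y | c y < n ∧ greedy K c y = j} =
            ⋃ m, ⋃ _ : m < n, {y | c y = m ∧ greedy K c y = j} := by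
          ext y
          simp
        have hlow : MeasurableSet {y | c y < n ∧ greedy K c y = j} := by
          rw [heq]
          exact .iUnion fun m => .iUnion fun hm => ih m hm j
        exact hF.measurableSet_exists (R := fun x y => K x y ∧ c y < n ∧ greedy K c y = j)
          (hKm.inter (hlow.preimage measurable_snd)) measurable_id (fun x y h => hKr x y h.1)
      intro k
      have : {x | c x = n ∧ greedy K c x = k} = (c ⁻¹' {n}) ∩
          ({x | ∃ y, K x y ∧ c y < n ∧ greedy K c y = k}ᶜ ∩
            ⋂ j, ⋂ _ : j < k, {x | ∃ y, K x y ∧ c y < n ∧ greedy K c y = j}) := by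
        ext x
        simp only [mem_ofPred_eq, mem_inter_iff, mem_preimage, mem_singleton_iff, mem_compl_iff,
          mem_iInter]
        refine and_congr_right fun hx => ?_
        rw [greedy_eq_iff hKN, hx]
      rw [this]
      exact (hc (measurableSet_singleton n)).inter
        ((hE k).compl.inter (.iInter fun j => .iInter fun _ => hE j))
    refine measurable_to_countable' fun k => ?_
    have : greedy K c ⁻¹' {k} = ⋃ n, {x | c x = n ∧ greedy K c x = k} := by
      ext x
      simp
    rw [this]
    exact .iUnion fun n => hstage n k
  · rcases lt_or_gt_of_ne (hcK x y hxy) with h | h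
    · exact (greedy_spec hKN c y).2 x (hKsymm x y hxy) h
    · exact ((greedy_spec hKN c x).2 y hxy h).symm

end Measurability

section Step

open Set

variable {X : Type*} [MeasurableSpace X] {G : SimpleGraph X} {F : ℕ → X → X} {A S : Set X}

lemma Exhausts.measurableSet_isBranch (hF : Exhausts G F)
    (hGmeas : MeasurableSet {p : X × X | G.Adj p.1 p.2}) (hA : MeasurableSet A)
    [StandardBorelSpace X] : MeasurableSet {x | IsBranch G A x} := by
  have hN : ∀ n, MeasurableSet {x | G.Adj x (F n x) ∧ F n x ∈ A} := fun n =>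
    (hGmeas.preimage (measurable_id.prodMk (hF.measurable n))).inter
      (hA.preimage (hF.measurable n))
  have hne : ∀ m n, MeasurableSet {x | F m x ≠ F n x} := fun m n =>
    (measurableSet_eq_fun (hF.measurable m) (hF.measurable n)).compl
  have : {x | IsBranch G A x} = A ∩ ⋃ i, ⋃ j, ⋃ k, {x | F i x ≠ F j x} ∩ ({x | F i x ≠ F k x} ∩
      ({x | F j x ≠ F k x} ∩ ({x | G.Adj x (F i x) ∧ F i x ∈ A} ∩
      ({x | G.Adj x (F j x) ∧ F j x ∈ A} ∩ {x | G.Adj x (F k x) ∧ F k x ∈ A})))) := by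
    ext x
    simp only [mem_inter_iff, mem_iUnion, mem_ofPred_eq, IsBranch]
    refine and_congr_right fun _ => ⟨?_, ?_⟩
    · rintro ⟨a, b, c, hab, hac, hbc, ha, hb, hc⟩
      obtain ⟨i, rfl⟩ := hF.exists_eq _ _ ha.1.reachable
      obtain ⟨j, rfl⟩ := hF.exists_eq _ _ hb.1.reachable
      obtain ⟨k, rfl⟩ := hF.exists_eq _ _ hc.1.reachable
      exact ⟨i, j, k, hab, hac, hbc, ha, hb, hc⟩
    · rintro ⟨i, j, k, h⟩
      exact ⟨_, _, _, h⟩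
  rw [this]
  exact hA.inter (.iUnion fun i => .iUnion fun j => .iUnion fun k => (hne i j).inter
    ((hne i k).inter ((hne j k).inter ((hN i).inter ((hN j).inter (hN k))))))

/-- The segment starting with the dart `x → y` ends at `w`, with exactly `n` vertices between `x`
and `w`. -/
def SegLen (G : SimpleGraph X) (A : Set X) : ℕ → X → X → X → Prop
  | 0, x, y, w => G.Adj x y ∧ IsBranch G A y ∧ y = w
  | n + 1, x, y, w => G.Adj x y ∧ y ∈ A ∧ ¬ IsBranch G A y ∧
      ∃ z, G.Adj y z ∧ z ≠ x ∧ SegLen G A n y z w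

omit [MeasurableSpace X] in
lemma exists_seg_iff {x y w : X} : (∃ x', Seg G A x y x' w) ↔ ∃ n, SegLen G A n x y w := by
  constructor
  · rintro ⟨x', h⟩
    induction h with
    | single h hb => exact ⟨0, h, hb, rfl⟩
    | go hxy hy hnb hz h ih =>
      obtain ⟨n, hn⟩ := ih
      exact ⟨n + 1, hxy, hy, hnb, _, h.adj, hz, hn⟩
  · rintro ⟨n, h⟩
    induction n generalizing x y with
    | zero =>
      obtain ⟨hxy, hb, rfl⟩ := h
      exact ⟨_, .single hxy hb⟩
    | succ n ih =>
      obtain ⟨hxy, hy, hnb, z, -, hz, h⟩ := h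
      obtain ⟨x', h⟩ := ih h
      exact ⟨x', .go hxy hy hnb hz h⟩

lemma Exhausts.measurableSet_segLen [StandardBorelSpace X] (hF : Exhausts G F)
    (hGmeas : MeasurableSet {p : X × X | G.Adj p.1 p.2}) (hA : MeasurableSet A) (n : ℕ) :
    MeasurableSet {p : X × X × X | SegLen G A n p.1 p.2.1 p.2.2} := by
  have hB := hF.measurableSet_isBranch hGmeas hA
  have hxy : MeasurableSet {p : X × X × X | G.Adj p.1 p.2.1} :=
    hGmeas.preimage (f := fun p : X × X × X => (p.1, p.2.1)) (by fun_prop)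
  have hy : Measurable fun p : X × X × X => p.2.1 := by fun_prop
  induction n with
  | zero =>
    exact hxy.inter ((hB.preimage hy).inter
      (measurableSet_eq_fun hy (by fun_prop : Measurable fun p : X × X × X => p.2.2)))
  | succ n ih =>
    refine hxy.inter ((hA.preimage hy).inter ((hB.preimage hy).compl.inter ?_))
    refine hF.measurableSet_exists
      (R := fun p z => G.Adj p.2.1 z ∧ z ≠ p.1 ∧ SegLen G A n p.2.1 z p.2.2) ?_ hy
      (fun p z h => h.1.reachable)
    refine .inter (hGmeas.preimage (f := fun q : (X × X × X) × X => (q.1.2.1, q.2)) (by fun_prop))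
      (.inter (measurableSet_eq_fun (by fun_prop) (by fun_prop)).compl
        (ih.preimage (f := fun q : (X × X × X) × X => (q.1.2.1, q.2, q.1.2.2)) (by fun_prop)))

lemma Exhausts.measurableSet_exists_seg [StandardBorelSpace X] (hF : Exhausts G F)
    (hGmeas : MeasurableSet {p : X × X | G.Adj p.1 p.2}) (hA : MeasurableSet A) :
    MeasurableSet {p : X × X | ∃ y x', Seg G A p.1 y x' p.2} := by
  refine hF.measurableSet_exists (R := fun p y => ∃ x', Seg G A p.1 y x' p.2) ?_ measurable_fst
    (fun p y ⟨x', h⟩ => h.adj.reachable)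
  simp only [exists_seg_iff]
  have : {q : (X × X) × X | ∃ n, SegLen G A n q.1.1 q.2 q.1.2} =
      ⋃ n, {q : (X × X) × X | SegLen G A n q.1.1 q.2 q.1.2} := by
    ext
    simp
  rw [this]
  exact .iUnion fun n => (hF.measurableSet_segLen hGmeas hA n).preimage
    (f := fun q : (X × X) × X => (q.1.1, q.2, q.1.2)) (by fun_prop)

lemma Exhausts.measurableSet_near [StandardBorelSpace X] (hF : Exhausts G F)
    (hGmeas : MeasurableSet {p : X × X | G.Adj p.1 p.2}) (hA : MeasurableSet A) :
    MeasurableSet {p : X × X | Near G A p.1 p.2} := by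
  have hL : MeasurableSet {p : X × X | Link G A p.1 p.2} :=
    (measurableSet_eq_fun measurable_fst measurable_snd).union
      (((hF.measurableSet_isBranch hGmeas hA).preimage measurable_fst).inter
        (hF.measurableSet_exists_seg hGmeas hA))
  refine hF.measurableSet_exists
    (R := fun p a => ∃ b, Link G A p.1 a ∧ Link G A a b ∧ Link G A b p.2) ?_ measurable_fst
    (fun p a ⟨b, h, _⟩ => h.reachable)
  refine hF.measurableSet_exists
    (R := fun (q : (X × X) × X) b => Link G A q.1.1 q.2 ∧ Link G A q.2 b ∧ Link G A b q.1.2) ?_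
    measurable_snd (fun q b ⟨_, h, _⟩ => h.reachable)
  exact (hL.preimage (f := fun q : ((X × X) × X) × X => (q.1.1.1, q.1.2)) (by fun_prop)).inter
    ((hL.preimage (f := fun q : ((X × X) × X) × X => (q.1.2, q.2)) (by fun_prop)).inter
      (hL.preimage (f := fun q : ((X × X) × X) × X => (q.2, q.1.1.2)) (by fun_prop)))

lemma Exhausts.measurableSet_own [StandardBorelSpace X] (hF : Exhausts G F)
    (hGmeas : MeasurableSet {p : X × X | G.Adj p.1 p.2}) (hA : MeasurableSet A)
    (hS : MeasurableSet S) : MeasurableSet {p : X × X | Own G A S p.1 p.2} :=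
  (hS.preimage measurable_snd).inter ((hA.preimage measurable_fst).inter
    ((measurableSet_eq_fun measurable_fst measurable_snd).union
      (((hF.measurableSet_isBranch hGmeas hA).preimage measurable_fst).compl.inter
        (hF.measurableSet_exists_seg hGmeas hA))))

lemma Exhausts.measurableSet_exists_own [StandardBorelSpace X] (hF : Exhausts G F)
    (hGmeas : MeasurableSet {p : X × X | G.Adj p.1 p.2}) (hA : MeasurableSet A)
    (hS : MeasurableSet S) : MeasurableSet {x : X | ∃ s, Own G A S x s} :=
  hF.measurableSet_exists (hF.measurableSet_own hGmeas hA hS) measurable_id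
    fun _ _ h => h.reachable

omit [MeasurableSpace X] in
lemma exists_walk_length_succ_iff {x y : X} {n : ℕ} :
    (∃ w : G.Walk x y, w.length = n + 1) ↔
      ∃ z, G.Adj x z ∧ ∃ w : G.Walk z y, w.length = n := by
  constructor
  · rintro ⟨w, hw⟩
    cases w with
    | nil => simp at hw
    | cons h w => exact ⟨_, h, w, by simpa using hw⟩
  · rintro ⟨z, h, w, hw⟩
    exact ⟨.cons h w, by simpa using hw⟩

lemma Exhausts.measurable_dist [StandardBorelSpace X] (hF : Exhausts G F)
    (hGmeas : MeasurableSet {p : X × X | G.Adj p.1 p.2}) :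
    Measurable fun p : X × X => G.dist p.1 p.2 := by
  have hW : ∀ n, MeasurableSet {p : X × X | ∃ w : G.Walk p.1 p.2, w.length = n} := by
    intro n
    induction n with
    | zero =>
      convert measurableSet_eq_fun (measurable_fst (α := X) (β := X)) measurable_snd using 3 with p
      constructor
      · rintro ⟨w, hw⟩
        exact SimpleGraph.Walk.eq_of_length_eq_zero hw
      · intro h
        exact ⟨(SimpleGraph.Walk.nil : G.Walk p.1 p.1).copy rfl h, by simp⟩
    | succ n ih =>
      simp only [exists_walk_length_succ_iff]
      exact hF.measurableSet_exists
        (R := fun (p : X × X) z => G.Adj p.1 z ∧ ∃ w : G.Walk z p.2, w.length = n)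
        (.inter (hGmeas.preimage (f := fun q : (X × X) × X => (q.1.1, q.2)) (by fun_prop))
          (ih.preimage (f := fun q : (X × X) × X => (q.2, q.1.2)) (by fun_prop)))
        measurable_fst (fun p z h => h.1.reachable)
  refine measurable_to_countable' fun n => ?_
  have : (fun p : X × X => G.dist p.1 p.2) ⁻¹' {n} =
      ({p : X × X | ∃ w : G.Walk p.1 p.2, w.length = n} ∩
        ⋂ m, ⋂ _ : m < n, {p : X × X | ∃ w : G.Walk p.1 p.2, w.length = m}ᶜ) ∪
      ({p | n = 0} ∩ ⋂ m, {p : X × X | ∃ w : G.Walk p.1 p.2, w.length = m}ᶜ) := by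
    ext p
    simp only [mem_preimage, mem_singleton_iff, mem_union, mem_inter_iff, mem_iInter,
      mem_compl_iff, mem_ofPred_eq]
    constructor
    · rintro rfl
      by_cases h : G.Reachable p.1 p.2
      · refine Or.inl ⟨h.exists_walk_length_eq_dist, ?_⟩
        rintro m hm ⟨w, rfl⟩
        exact absurd (SimpleGraph.dist_le w) (not_le.2 hm)
      · exact Or.inr ⟨SimpleGraph.dist_eq_zero_of_not_reachable h, fun m ⟨w, _⟩ => h ⟨w⟩⟩
    · rintro (⟨⟨w, rfl⟩, h⟩ | ⟨rfl, h⟩)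
      · refine le_antisymm (SimpleGraph.dist_le w) (not_lt.1 fun hlt => ?_)
        exact h _ hlt (SimpleGraph.Reachable.exists_walk_length_eq_dist ⟨w⟩)
      · exact SimpleGraph.dist_eq_zero_of_not_reachable fun ⟨w⟩ => h _ ⟨w, rfl⟩
  rw [this]
  exact ((hW n).inter (.iInter fun m => .iInter fun _ => (hW m).compl)).union
    ((MeasurableSet.const _).inter (.iInter fun m => (hW m).compl))

lemma Exhausts.measurableSet_away [StandardBorelSpace X] (hF : Exhausts G F)
    (hGmeas : MeasurableSet {p : X × X | G.Adj p.1 p.2}) (hA : MeasurableSet A)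
    (hS : MeasurableSet S) : MeasurableSet {p : X × X | Away G A S p.1 p.2} := by
  refine hGmeas.inter ((hA.preimage measurable_snd).inter ?_)
  refine hF.measurableSet_exists
    (R := fun (p : X × X) s => Own G A S p.1 s ∧ G.dist s p.2 = G.dist s p.1 + 1) ?_
    measurable_fst (fun p s h => h.1.reachable)
  refine ((hF.measurableSet_own hGmeas hA hS).preimage
    (f := fun q : (X × X) × X => (q.1.1, q.2)) (by fun_prop)).inter ?_
  have hd := hF.measurable_dist hGmeas
  exact measurableSet_eq_fun
    (hd.comp (by fun_prop : Measurable fun q : (X × X) × X => (q.2, q.1.2)))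
    ((hd.comp (by fun_prop : Measurable fun q : (X × X) × X => (q.2, q.1.1))).add_const 1)

omit [MeasurableSpace X] in
lemma bddBy_near {d : ℕ} (hdeg : ∀ x : X, (G.neighborSet x).encard ≤ (d : ℕ∞)) :
    BddBy (Near G A) ((d + 1) * ((d + 1) * (d + 1))) := by
  classical
  have hL : BddBy (Link G A) (d + 1) := by
    intro v
    have hfin : (G.neighborSet v).Finite := finite_of_encard_le_coe (hdeg v)
    let φ : X → X := fun y => if h : ∃ w x', Seg G A v y x' w then h.choose else v
    refine ⟨insert v (hfin.toFinset.image φ), ?_, ?_⟩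
    · refine (Finset.card_insert_le _ _).trans (Nat.succ_le_succ (Finset.card_image_le.trans ?_))
      have := hdeg v
      rw [hfin.encard_eq_coe_toFinset_card] at this
      exact_mod_cast this
    · rintro w (rfl | ⟨hv, y, x', h⟩)
      · exact Finset.mem_insert_self _ _
      · refine Finset.mem_insert_of_mem (Finset.mem_image.2
          ⟨y, hfin.mem_toFinset.2 h.adj, ?_⟩)
        have hex : ∃ w x', Seg G A v y x' w := ⟨w, x', h⟩
        obtain ⟨p, hp⟩ := hex.choose_spec
        simp only [φ, dif_pos hex]
        exact hp.eq_of_seg hv.1 h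
  refine (hL.comp (hL.comp hL)).mono ?_
  rintro x y ⟨a, b, h1, h2, h3⟩
  exact ⟨a, h1, b, h2, h3⟩

lemma exists_sparse_measureReal_trim_le [StandardBorelSpace X] (hF : Exhausts G F)
    (hGmeas : MeasurableSet {p : X × X | G.Adj p.1 p.2}) {d : ℕ}
    (hdeg : ∀ x : X, (G.neighborSet x).encard ≤ (d : ℕ∞)) (hA : MeasurableSet A)
    (hAG : AmpleOn G A) (μ : Measure X) [IsFiniteMeasure μ] :
    ∃ S, MeasurableSet S ∧ Sparse G A S ∧
      μ.real (trim G A S) ≤ (1 - 1 / ((d + 1) * ((d + 1) * (d + 1)) + 1)) * μ.real A := by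
  set N := (d + 1) * ((d + 1) * (d + 1)) with hN
  obtain ⟨c, hc, hcN, hcK⟩ := hF.exists_coloring (K := fun x y => x ≠ y ∧ Near G A x y) (N := N)
    ((measurableSet_eq_fun measurable_fst measurable_snd).compl.inter
      (hF.measurableSet_near hGmeas hA)) (fun x y h => h.2.reachable) (fun x y h => h.1)
    (fun x y h => ⟨h.1.symm, h.2.symm⟩) ((bddBy_near hdeg).mono fun x y h => h.2)
  let T : ℕ → Set X := fun i => {x | IsBranch G A x} ∩ c ⁻¹' {i}
  have hT : ∀ i, MeasurableSet (T i) := fun i =>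
    (hF.measurableSet_isBranch hGmeas hA).inter (hc (measurableSet_singleton i))
  let R : ℕ → Set X := fun i => {x | ∃ s, Own G A (T i) x s}
  have hR : ∀ i, MeasurableSet (R i) := fun i =>
    hF.measurableSet_exists_own hGmeas hA (hT i)
  have hcover : A ⊆ ⋃ i ∈ Finset.range (N + 1), R i := by
    intro x hx
    obtain ⟨s, hs, hxs⟩ : ∃ s, IsBranch G A s ∧
        (x = s ∨ (¬ IsBranch G A x ∧ ∃ y x', Seg G A x y x' s)) := by
      by_cases hb : IsBranch G A x
      · exact ⟨x, hb, Or.inl rfl⟩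
      · obtain ⟨y, -, -, ⟨hxy, hy⟩, -⟩ := hAG.two_nbrs x hx
        obtain ⟨x', w, h⟩ := hAG.exists_seg x hx y hy hxy
        exact ⟨w, h.isBranch, Or.inr ⟨hb, y, x', h⟩⟩
    exact mem_biUnion (Finset.mem_range.2 (Nat.lt_succ_of_le (hcN s))) ⟨s, ⟨hs, rfl⟩, hx, hxs⟩
  have hsum : ∑ _i ∈ Finset.range (N + 1), μ.real A / (N + 1) ≤
      ∑ i ∈ Finset.range (N + 1), μ.real (R i) := by
    rw [Finset.sum_const, Finset.card_range, nsmul_eq_mul]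
    push_cast
    rw [mul_div_cancel₀ _ (by positivity)]
    exact (measureReal_mono hcover (measure_ne_top μ _)).trans (measureReal_biUnion_finset_le _ _)
  obtain ⟨i, -, hi⟩ := Finset.exists_le_of_sum_le (by simp) hsum
  refine ⟨T i, hT i, ⟨fun s hs => hs.1, fun s hs t ht hst => ?_⟩, ?_⟩
  · by_contra hne
    exact hcK s t ⟨hne, hst⟩ (hs.2.trans ht.2.symm)
  · have hsub : R i ⊆ A := fun x ⟨s, hs⟩ => hs.2.1
    have htrim : trim G A (T i) = A \ R i := rfl
    have hNr : ((d : ℝ) + 1) * ((d + 1) * (d + 1)) = N := by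
      rw [hN]
      push_cast
      rfl
    rw [htrim, measureReal_sdiff hsub (hR i), hNr, sub_mul, one_mul, one_div_mul_eq_div]
    linarith

/-- A sequence of sets obtained from the whole space by successively removing the open stars around
sparse sets `S n` of branch vertices. -/
structure IsTrimSeq (G : SimpleGraph X) (A S : ℕ → Set X) : Prop where
  zero : A 0 = univ
  succ : ∀ n, A (n + 1) = trim G (A n) (S n)
  sparse : ∀ n, Sparse G (A n) (S n)
  ampleOn : ∀ n, AmpleOn G (A n)
  measurableSet_left : ∀ n, MeasurableSet (A n)
  measurableSet_right : ∀ n, MeasurableSet (S n)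

lemma exists_isTrimSeq [StandardBorelSpace X] (hF : Exhausts G F)
    (hGmeas : MeasurableSet {p : X × X | G.Adj p.1 p.2}) (hG : G.IsAcyclic) {d : ℕ}
    (hdeg : ∀ x : X, (G.neighborSet x).encard ≤ (d : ℕ∞)) (hample : AmpleGraph G)
    (μ : Measure X) [IsFiniteMeasure μ] :
    ∃ A S : ℕ → Set X, IsTrimSeq G A S ∧ μ (⋂ n, A n) = 0 := by
  choose! T hTm hTs hTμ using fun (A : Set X) (hA : MeasurableSet A ∧ AmpleOn G A) =>
    exists_sparse_measureReal_trim_le hF hGmeas hdeg hA.1 hA.2 μ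
  let A : ℕ → Set X := fun n => (fun A => trim G A (T A))^[n] univ
  have hsucc : ∀ n, A (n + 1) = trim G (A n) (T (A n)) := fun n =>
    Function.iterate_succ_apply' _ _ _
  have hA : ∀ n, MeasurableSet (A n) ∧ AmpleOn G (A n) := by
    intro n
    induction n with
    | zero => exact ⟨.univ, ampleOn_univ hample⟩
    | succ n ih =>
      rw [hsucc]
      exact ⟨ih.1.diff (hF.measurableSet_exists_own hGmeas ih.1 (hTm _ ih)),
        ih.2.trim hG (hTs _ ih)⟩
  refine ⟨A, fun n => T (A n), ⟨rfl, hsucc, fun n => hTs _ (hA n), fun n => (hA n).2,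
    fun n => (hA n).1, fun n => hTm _ (hA n)⟩, ?_⟩
  set q : ℝ := 1 - 1 / (((d : ℝ) + 1) * ((d + 1) * (d + 1)) + 1) with hq
  have hpos : 0 < ((d : ℝ) + 1) * ((d + 1) * (d + 1)) + 1 := by positivity
  have hq0 : 0 ≤ q := by
    rw [hq, sub_nonneg, div_le_one hpos, le_add_iff_nonneg_left]
    positivity
  have hq1 : q < 1 := sub_lt_self _ (one_div_pos.2 hpos)
  have hbound : ∀ n, μ.real (A n) ≤ q ^ n * μ.real univ := by
    intro n
    induction n with
    | zero => simp [A]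
    | succ n ih =>
      rw [hsucc, pow_succ', mul_assoc]
      exact (hTμ _ (hA n)).trans (mul_le_mul_of_nonneg_left ih hq0)
  have hlim : Filter.Tendsto (fun n => q ^ n * μ.real univ) Filter.atTop (nhds 0) := by
    simpa using (tendsto_pow_atTop_nhds_zero_of_lt_one hq0 hq1).mul_const (μ.real univ)
  rw [← measureReal_eq_zero_iff]
  exact le_antisymm (ge_of_tendsto' hlim fun n =>
    (measureReal_mono (iInter_subset _ n)).trans (hbound n)) measureReal_nonneg

namespace IsTrimSeq

variable {A S : ℕ → Set X}

/-- `y` is a neighbour of `x` away from the centre of the star around `x`, at the stage where this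
star is removed. -/
def Forward (G : SimpleGraph X) (A S : ℕ → Set X) (n : ℕ) (x y : X) : Prop :=
  (x ∈ A n ∧ x ∉ A (n + 1)) ∧ Away G (A n) (S n) x y

lemma antitone (h : IsTrimSeq G A S) : Antitone A :=
  antitone_nat_of_succ_le fun n => (h.succ n).trans_subset trim_subset

lemma exists_forward (h : IsTrimSeq G A S) (hG : G.IsAcyclic) {x : X} (hx : x ∉ ⋂ n, A n) :
    ∃ n y, Forward G A S n x y := by
  classical
  have hex : ∃ n, x ∉ A n := by simpa using hx
  obtain ⟨n, hn⟩ : ∃ n, Nat.find hex = n + 1 := by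
    refine Nat.exists_eq_succ_of_ne_zero fun h0 => ?_
    exact Nat.find_spec hex (by rw [h0, h.zero]; trivial)
  have hxn : x ∈ A n := not_not.1 (Nat.find_min hex (hn ▸ n.lt_succ_self))
  have hxn' : x ∉ A (n + 1) := hn ▸ Nat.find_spec hex
  obtain ⟨s, hs⟩ := (mem_trim_or (G := G) (S := S n) hxn).resolve_left (h.succ n ▸ hxn')
  obtain ⟨y, hy⟩ := hs.exists_away hG (h.ampleOn n)
  exact ⟨n, y, ⟨hxn, hxn'⟩, hy⟩

lemma Forward.lt (h : IsTrimSeq G A S) {m n : ℕ} {x y z : X} (hx : Forward G A S n x y)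
    (hy : Forward G A S m y z) :
    toLex (n, starDist G (A n) (S n) x) < toLex (m, starDist G (A m) (S m) y) := by
  rw [Prod.Lex.toLex_lt_toLex]
  have hyn : y ∈ A n := hx.2.2.1
  have hnm : n ≤ m := by
    by_contra! hlt
    exact hy.1.2 (h.antitone hlt hyn)
  rcases hx.2.mem_trim_or_starDist_lt (h.sparse n) with hyt | hlt
  · rw [← h.succ] at hyt
    refine Or.inl (lt_of_le_of_ne hnm ?_)
    rintro rfl
    exact hy.1.2 hyt
  · rcases hnm.lt_or_eq with hlt' | rfl
    · exact Or.inl hlt'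
    · exact Or.inr ⟨rfl, hlt⟩

lemma oneEnded (h : IsTrimSeq G A S) {B : Set X} {f : B → X}
    (hf : ∀ x : B, ∃ n, Forward G A S n x (f x)) : OneEnded f := by
  rintro ⟨u, hu⟩
  choose n hn using hf
  let r : ℕ → ℕ ×ₗ ℕ := fun i => toLex (n (u i), starDist G (A (n (u i))) (S (n (u i))) (u i))
  have hr (i : ℕ) : r (i + 1) < r i := Forward.lt h (hu i ▸ hn (u (i + 1))) (hn (u i))
  exact (RelEmbedding.natGT (r := (· < ·)) r hr).not_wellFounded wellFounded_lt

lemma measurableSet_forward [StandardBorelSpace X] (h : IsTrimSeq G A S) (hF : Exhausts G F)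
    (hGmeas : MeasurableSet {p : X × X | G.Adj p.1 p.2}) (n : ℕ) :
    MeasurableSet {p : X × X | Forward G A S n p.1 p.2} :=
  (((h.measurableSet_left n).preimage measurable_fst).inter
    ((h.measurableSet_left (n + 1)).preimage measurable_fst).compl).inter
    (hF.measurableSet_away hGmeas (h.measurableSet_left n) (h.measurableSet_right n))

lemma exists_measurable_forward [StandardBorelSpace X] (h : IsTrimSeq G A S) (hF : Exhausts G F)
    (hGmeas : MeasurableSet {p : X × X | G.Adj p.1 p.2}) (hG : G.IsAcyclic) :
    ∃ f : ↥(⋂ n, A n)ᶜ → X,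
      Measurable f ∧ ∀ x : ↥(⋂ n, A n)ᶜ, ∃ n, Forward G A S n x (f x) := by
  classical
  have hex : ∀ x : ↥(⋂ n, A n)ᶜ, ∃ i, ∃ n, Forward G A S n x (F i x) := by
    intro x
    obtain ⟨n, y, hy⟩ := h.exists_forward hG x.2
    obtain ⟨i, rfl⟩ := hF.exists_eq _ _ hy.2.1.reachable
    exact ⟨i, n, hy⟩
  refine ⟨fun x => F (Nat.find (hex x)) x, ?_, fun x => Nat.find_spec (hex x)⟩
  refine Measurable.find (f := fun i (x : ↥(⋂ n, A n)ᶜ) => F i x)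
    (fun i => (hF.measurable i).comp measurable_subtype_coe) (fun i => ?_) hex
  have : {x : ↥(⋂ n, A n)ᶜ | ∃ n, Forward G A S n x (F i x)} =
      ⋃ n, {x : ↥(⋂ n, A n)ᶜ | Forward G A S n x (F i x)} := by
    ext
    simp
  rw [this]
  exact .iUnion fun n => (h.measurableSet_forward hF hGmeas n).preimage
    (measurable_subtype_coe.prodMk ((hF.measurable i).comp measurable_subtype_coe))

end IsTrimSeq

end Step

end AmpleForest

theorem stmt_11 {X : Type*} [MeasurableSpace X] [StandardBorelSpace X]
    (G : SimpleGraph X) (hGmeas : MeasurableSet {p : X × X | G.Adj p.1 p.2})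
    (hacyc : G.IsAcyclic)
    (d : ℕ) (hdeg : ∀ x : X, (G.neighborSet x).encard ≤ (d : ℕ∞))
    (hample : AmpleGraph G)
    (μ : Measure X) [IsProbabilityMeasure μ] :
    ∃ B : Set X, MeasurableSet B ∧ μ Bᶜ = 0 ∧
      ∃ f : B → X, Measurable f ∧ (∀ x : B, G.Adj (x : X) (f x)) ∧ OneEnded f := by
  obtain ⟨F, hF⟩ := AmpleForest.exists_exhausts hGmeas d hdeg
  obtain ⟨A, S, hAS, hμ⟩ := AmpleForest.exists_isTrimSeq hF hGmeas hacyc hdeg hample μ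
  obtain ⟨f, hf, hfwd⟩ := hAS.exists_measurable_forward hF hGmeas hacyc
  refine ⟨(⋂ n, A n)ᶜ, (MeasurableSet.iInter hAS.measurableSet_left).compl, by rwa [compl_compl],
    f, hf, fun x => ?_, hAS.oneEnded hfwd⟩
  obtain ⟨n, h⟩ := hfwd x
  exact h.2.1
end

section
/- Let G be a locally finite acyclic Borel graph on a standard Borel space X such that no connected component of G has exactly 0 ends or exactly 2 ends. Then there is a Borel set B ⊆ X such that the restriction of G to B is ample, and there is a one-ended Borel function f : X ∖ [B]_{E_G} → X ∖ [B]_{E_G} whose graph is contained in the restriction of G to X ∖ [B]_{E_G}. -/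
open MeasureTheory

section Novikov

open Set PiNat Function

/-- A sequence of sets is Borel separated if it has Borel enlargements with empty intersection. -/
def BorelSeparated {α : Type*} [MeasurableSpace α] (S : ℕ → Set α) : Prop :=
  ∃ B : ℕ → Set α, (∀ n, S n ⊆ B n) ∧ (∀ n, MeasurableSet (B n)) ∧ ⋂ n, B n = ∅

/-- Novikov's separation theorem for ranges of continuous functions on Baire space. -/
theorem borelSeparated_range {α : Type*} [TopologicalSpace α] [T2Space α] [MeasurableSpace α]
    [OpensMeasurableSpace α] {f : ℕ → (ℕ → ℕ) → α} (hf : ∀ n, Continuous (f n))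
    (h : ⋂ n, range (f n) = ∅) : BorelSeparated fun n => range (f n) := by
  by_contra hsep
  let g : ℕ → (ℕ → ℕ) → α := fun n z => f n fun i => z (Nat.pair n i)
  have hg : ∀ n, Continuous (g n) := fun n =>
    (hf n).comp (continuous_pi fun i => continuous_apply _)
  let S : (ℕ → ℕ) → ℕ → ℕ → Set α := fun z k n => g n '' cylinder z k
  have step : ∀ (z : ℕ → ℕ) (k : ℕ), ∃ m, ¬ BorelSeparated (S z k) →
      ¬ BorelSeparated (S (update z k m) (k + 1)) := by
    intro z k
    by_contra! H
    have H1 := (H 0).1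
    choose B hSB hB hBe using fun m => (H m).2
    refine H1 ⟨fun n => if n = (Nat.unpair k).1 then ⋃ m, B m n else ⋂ m, B m n, ?_, ?_, ?_⟩
    · intro n
      dsimp only
      split_ifs with hn
      · simp only [S]
        rw [← iUnion_cylinder_update z k, image_iUnion]
        exact iUnion_mono fun m => hSB m n
      · rintro _ ⟨w, hw, rfl⟩
        refine mem_iInter.2 fun m => hSB m n ⟨update w k m, ?_, ?_⟩
        · intro i hi
          rcases eq_or_ne i k with rfl | hik
          · simp
          · simp only [update_of_ne hik]
            exact hw i (by omega)
        · simp only [g]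
          congr 1
          ext i
          refine update_of_ne ?_ _ _
          rintro rfl
          exact hn (by simp)
    · intro n
      dsimp only
      split_ifs
      · exact MeasurableSet.iUnion fun m => hB m n
      · exact MeasurableSet.iInter fun m => hB m n
    · rw [eq_empty_iff_forall_notMem]
      intro x hx
      rw [mem_iInter] at hx
      have h1 := hx (Nat.unpair k).1
      simp only [if_true, mem_iUnion] at h1
      obtain ⟨m, hm⟩ := h1
      refine (eq_empty_iff_forall_notMem.1 (hBe m)) x (mem_iInter.2 fun n => ?_)
      have h2 := hx n
      split_ifs at h2 with hn
      · rwa [hn]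
      · exact mem_iInter.1 h2 m
  choose m hm using step
  let Z : ℕ → ℕ → ℕ := fun k => Nat.rec (fun _ => 0) (fun k z => update z k (m z k)) k
  have hZ : ∀ k, ¬ BorelSeparated (S (Z k) k) := by
    intro k
    induction k with
    | zero =>
      rintro ⟨B, h1, h2, h3⟩
      refine hsep ⟨B, fun n => ?_, h2, h3⟩
      rintro _ ⟨y, rfl⟩
      refine h1 n ⟨fun j => y (Nat.unpair j).2, by simp, ?_⟩
      simp [g]
    | succ k ih => exact hm _ _ ih
  have hZs : ∀ i k, i + 1 ≤ k → Z k i = Z (i + 1) i := by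
    intro i
    apply Nat.le_induction
    · rfl
    · intro k hk ih
      rw [← ih]
      exact update_of_ne (by omega) _ _
  let x : ℕ → ℕ := fun i => Z (i + 1) i
  have hx : ∀ k, cylinder x k = cylinder (Z k) k := by
    intro k
    rw [← mem_cylinder_iff_eq]
    intro i hi
    exact (hZs i k hi).symm
  obtain ⟨n, n', hne⟩ : ∃ n n', g n x ≠ g n' x := by
    by_contra! H
    refine (eq_empty_iff_forall_notMem.1 h) (g 0 x) (mem_iInter.2 fun n => ?_)
    rw [H 0 n]
    exact mem_range_self _
  obtain ⟨U, V, hU, hV, hxU, hxV, hUV⟩ := t2_separation hne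
  have cyl : ∀ {n : ℕ} {U : Set α}, IsOpen U → g n x ∈ U →
      ∃ k, cylinder x k ⊆ g n ⁻¹' U := by
    intro n U hU hxU
    obtain ⟨t, ⟨y, k, rfl⟩, hxt, htU⟩ :=
      (isTopologicalBasis_cylinders fun _ : ℕ => ℕ).mem_nhds_iff.1
        ((hU.preimage (hg n)).mem_nhds hxU)
    exact ⟨k, by rwa [mem_cylinder_iff_eq.1 hxt]⟩
  obtain ⟨k, hk⟩ := cyl hU hxU
  obtain ⟨k', hk'⟩ := cyl hV hxV
  have hnn : n ≠ n' := by
    rintro rfl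
    exact hne rfl
  refine hZ (max k k') ⟨fun i => if i = n then U else if i = n' then V else univ, ?_, ?_, ?_⟩
  · intro i
    simp only [S]
    rw [← hx]
    split_ifs with h1 h2
    · subst h1
      exact image_subset_iff.2 ((cylinder_anti _ (le_max_left _ _)).trans hk)
    · subst h2
      exact image_subset_iff.2 ((cylinder_anti _ (le_max_right _ _)).trans hk')
    · exact subset_univ _
  · intro i
    dsimp only
    split_ifs
    exacts [hU.measurableSet, hV.measurableSet, MeasurableSet.univ]
  · rw [eq_empty_iff_forall_notMem]
    intro y hy
    rw [mem_iInter] at hy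
    have h1 := hy n
    have h2 := hy n'
    simp only [if_true, if_neg hnn.symm] at h1 h2
    exact disjoint_left.1 hUV h1 h2

/-- **Novikov's separation theorem**: a sequence of analytic sets with empty intersection can be
enlarged to a sequence of Borel sets with empty intersection. -/
theorem MeasureTheory.AnalyticSet.borelSeparated {α : Type*} [TopologicalSpace α] [T2Space α]
    [MeasurableSpace α] [OpensMeasurableSpace α] {S : ℕ → Set α} (hS : ∀ n, AnalyticSet (S n))
    (h : ⋂ n, S n = ∅) : BorelSeparated S := by
  by_cases he : ∃ n, S n = ∅
  · obtain ⟨n, hn⟩ := he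
    refine ⟨fun i => if i = n then ∅ else univ, fun i => ?_, fun i => ?_, ?_⟩
    · dsimp only
      split_ifs with hi
      · rw [hi, hn]
      · exact subset_univ _
    · dsimp only
      split_ifs
      exacts [MeasurableSet.empty, MeasurableSet.univ]
    · refine eq_empty_iff_forall_notMem.2 fun x hx => ?_
      simpa using mem_iInter.1 hx n
  · have : ∀ n, ∃ f : (ℕ → ℕ) → α, Continuous f ∧ range f = S n := by
      intro n
      have hn := hS n
      rw [AnalyticSet] at hn
      rcases hn with h0 | h1
      · exact (he ⟨n, h0⟩).elim
      · exact h1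
    choose f hf hfS using this
    simp only [← hfS] at h
    have := borelSeparated_range hf h
    simpa only [hfS] using this

end Novikov

section FiniteSections

open Set

universe u

theorem measurableSet_fst_image_of_encard_le {Y : Type u} [MeasurableSpace Y]
    [StandardBorelSpace Y] (k : ℕ) : ∀ {X : Type u} [MeasurableSpace X] [StandardBorelSpace X]
    {P : Set (X × Y)}, MeasurableSet P → (∀ x, {y | (x, y) ∈ P}.encard ≤ k) →
    MeasurableSet (Prod.fst '' P) := by
  induction k with
  | zero =>
    intro X _ _ P hP h
    have : P = ∅ := by
      refine eq_empty_iff_forall_notMem.2 fun p hp => ?_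
      have h1 := h p.1
      simp only [Nat.cast_zero, nonpos_iff_eq_zero, encard_eq_zero] at h1
      exact (eq_empty_iff_forall_notMem.1 h1) p.2 hp
    simp [this]
  | succ k ih =>
    intro X _ _ P hP h
    let φ := embeddingReal Y
    have hφ : MeasurableEmbedding φ := measurableEmbedding_embeddingReal Y
    let P2 : Set ((X × Y) × Y) := {q | q.1 ∈ P ∧ (q.1.1, q.2) ∈ P ∧ φ q.2 < φ q.1.2}
    have hP2 : MeasurableSet P2 := by
      refine (measurable_fst hP).inter (MeasurableSet.inter ?_ ?_)
      · exact (show Measurable fun q : (X × Y) × Y => (q.1.1, q.2) by fun_prop) hP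
      · exact measurableSet_lt (hφ.measurable.comp measurable_snd)
          (hφ.measurable.comp (measurable_snd.comp measurable_fst))
    have hQ : MeasurableSet (Prod.fst '' P2) := by
      refine ih hP2 fun p => ?_
      by_cases hp : p ∈ P
      · have h1 : insert p.2 {y | (p, y) ∈ P2} ⊆ {y | (p.1, y) ∈ P} := by
          rintro y (rfl | hy)
          exacts [hp, hy.2.1]
        have h2 := (encard_le_encard h1).trans (h p.1)
        rw [encard_insert_of_notMem (fun hh => lt_irrefl _ hh.2.2)] at h2
        push_cast at h2
        exact (WithTop.add_le_add_iff_right ENat.one_ne_top).1 h2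
      · have : {y | (p, y) ∈ P2} = ∅ := eq_empty_iff_forall_notMem.2 fun y hy => hp hy.1
        simp [this]
    have himg : Prod.fst '' P = Prod.fst '' (P \ Prod.fst '' P2) := by
      refine Subset.antisymm ?_ (image_mono sdiff_subset)
      rintro x ⟨⟨x, y⟩, hp, rfl⟩
      have hfin : {y | (x, y) ∈ P}.Finite := by
        rw [← encard_lt_top_iff]
        exact (h x).trans_lt (ENat.natCast_lt_top _)
      obtain ⟨z, hz, hmin⟩ := hfin.exists_minimalFor φ _ ⟨y, hp⟩
      refine ⟨(x, z), ⟨hz, ?_⟩, rfl⟩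
      rintro ⟨⟨_, w⟩, ⟨-, h2, h3⟩, rfl⟩
      exact absurd (hmin h2 h3.le) (not_le.2 h3)
    rw [himg]
    refine (hP.diff hQ).image_of_measurable_injOn measurable_fst ?_
    rintro ⟨x, y⟩ ⟨h1, h2⟩ ⟨x', y'⟩ ⟨h1', h2'⟩ hxx
    obtain rfl : x = x' := hxx
    have key : ∀ {a b : Y}, (x, a) ∈ P → (x, b) ∈ P → (x, b) ∉ Prod.fst '' P2 → φ b ≤ φ a :=
      fun {a b} ha hb hn => not_lt.1 fun hlt => hn ⟨((x, b), a), ⟨hb, ha, hlt⟩, rfl⟩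
    rw [hφ.injective (le_antisymm (key h1' h1 h2) (key h1 h1' h2'))]

theorem analyticSet_le_encard_section {X Y : Type*} [TopologicalSpace X] [PolishSpace X]
    [MeasurableSpace X] [BorelSpace X] [MeasurableSpace Y] [StandardBorelSpace Y]
    {P : Set (X × Y)} (hP : MeasurableSet P) (k : ℕ) :
    AnalyticSet {x | (k : ℕ∞) ≤ {y | (x, y) ∈ P}.encard} := by
  let Q : Set (X × (Fin k → Y)) :=
    {q | (∀ i, (q.1, q.2 i) ∈ P) ∧ ∀ i j, i ≠ j → q.2 i ≠ q.2 j}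
  have hQ : MeasurableSet Q := by
    have e : Q = (⋂ i, {q | (q.1, q.2 i) ∈ P}) ∩
        ⋂ i, ⋂ j, ⋂ (_ : i ≠ j), {q | q.2 i = q.2 j}ᶜ := by
      ext q
      simp [Q]
    rw [e]
    refine (MeasurableSet.iInter fun i => ?_).inter (MeasurableSet.iInter fun i =>
      MeasurableSet.iInter fun j => MeasurableSet.iInter fun _ => MeasurableSet.compl ?_)
    · exact (show Measurable fun q : X × (Fin k → Y) => (q.1, q.2 i) by fun_prop) hP
    · exact measurableSet_eq_fun (by fun_prop) (by fun_prop)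
  convert hQ.analyticSet_image measurable_fst using 1
  ext x
  constructor
  · intro hx
    obtain ⟨t, ht, htk⟩ := exists_subset_encard_eq hx
    have htf : t.Finite := finite_of_encard_eq_coe htk
    let s := htf.toFinset
    have hs : s.card = k := by
      rw [← Nat.cast_inj (R := ℕ∞), ← htk, htf.encard_eq_coe_toFinset_card]
    refine ⟨(x, fun i => (s.equivFinOfCardEq hs).symm i), ⟨fun i => ?_, fun i j hij h => ?_⟩, rfl⟩
    · exact ht (htf.mem_toFinset.1 ((s.equivFinOfCardEq hs).symm i).2)
    · exact hij ((s.equivFinOfCardEq hs).symm.injective (Subtype.ext h))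
  · rintro ⟨⟨x, t⟩, ⟨h1, h2⟩, rfl⟩
    have hinj : Function.Injective t := fun i j hij => by
      by_contra hne
      exact h2 i j hne hij
    have h3 : range t ⊆ {y | (x, y) ∈ P} := by
      rintro _ ⟨i, rfl⟩
      exact h1 i
    have h4 := encard_le_encard h3
    rw [← image_univ, hinj.encard_image] at h4
    simpa using h4

/-- A Borel set with finite sections has a Borel projection. -/
theorem measurableSet_fst_image_of_finite {X Y : Type u} [MeasurableSpace X]
    [StandardBorelSpace X] [MeasurableSpace Y] [StandardBorelSpace Y] {P : Set (X × Y)}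
    (hP : MeasurableSet P) (h : ∀ x, {y | (x, y) ∈ P}.Finite) :
    MeasurableSet (Prod.fst '' P) := by
  let := upgradeStandardBorel X
  obtain ⟨B, hB, hBm, hBe⟩ := AnalyticSet.borelSeparated
    (fun k => analyticSet_le_encard_section hP k) (by
      refine eq_empty_iff_forall_notMem.2 fun x hx => ?_
      have h1 := mem_iInter.1 hx ((h x).toFinset.card + 1)
      simp only [mem_ofPred_eq] at h1
      rw [(h x).encard_eq_coe_toFinset_card] at h1
      norm_cast at h1
      omega)
  have e : Prod.fst '' P = ⋃ k, Prod.fst '' (P ∩ Prod.fst ⁻¹' (B k)ᶜ) := by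
    rw [← image_iUnion, ← inter_iUnion, ← preimage_iUnion, ← compl_iInter, hBe]
    simp
  rw [e]
  refine MeasurableSet.iUnion fun k => measurableSet_fst_image_of_encard_le k
    (hP.inter (measurable_fst (hBm k).compl)) fun x => ?_
  by_contra! hlt
  have hle : {y | (x, y) ∈ P ∩ Prod.fst ⁻¹' (B k)ᶜ} ⊆ {y | (x, y) ∈ P} := fun y hy => hy.1
  obtain ⟨y, hy⟩ : {y | (x, y) ∈ P ∩ Prod.fst ⁻¹' (B k)ᶜ}.Nonempty := by
    rw [← encard_pos]
    exact (zero_le).trans_lt hlt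
  exact hy.2 (hB k (hlt.le.trans (encard_le_encard hle)))

/-- A Borel relation with finite sections has a Borel selector. -/
theorem exists_measurable_selector {X : Type u} [MeasurableSpace X] [StandardBorelSpace X]
    {P : Set (X × X)} (hP : MeasurableSet P) (h : ∀ x, {y | (x, y) ∈ P}.Finite)
    (hne : ∀ x, ∃ y, (x, y) ∈ P) :
    ∃ f : X → X, Measurable f ∧ ∀ x, (x, f x) ∈ P := by
  let φ := embeddingReal X
  have hφ : MeasurableEmbedding φ := measurableEmbedding_embeddingReal X
  let P2 : Set ((X × X) × X) := {q | (q.1.1, q.2) ∈ P ∧ φ q.2 < φ q.1.2}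
  have hP2 : MeasurableSet P2 := by
    refine MeasurableSet.inter ?_ ?_
    · exact (show Measurable fun q : (X × X) × X => (q.1.1, q.2) by fun_prop) hP
    · exact measurableSet_lt (hφ.measurable.comp measurable_snd)
        (hφ.measurable.comp (measurable_snd.comp measurable_fst))
  have hQ : MeasurableSet (Prod.fst '' P2) :=
    measurableSet_fst_image_of_finite hP2 fun p => (h p.1).subset fun y hy => hy.1
  have hex : ∀ x, ∃ y, (x, y) ∈ P \ Prod.fst '' P2 := by
    intro x
    obtain ⟨z, hz, hmin⟩ := (h x).exists_minimalFor φ _ (hne x)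
    refine ⟨z, hz, ?_⟩
    rintro ⟨⟨⟨_, _⟩, w⟩, ⟨h2, h3⟩, hw⟩
    obtain ⟨rfl, rfl⟩ := Prod.mk.inj hw
    exact absurd (hmin h2 h3.le) (not_le.2 h3)
  choose f hf using hex
  refine ⟨f, fun U hU => ?_, fun x => (hf x).1⟩
  have e : f ⁻¹' U = Prod.fst '' ((P \ Prod.fst '' P2) ∩ Prod.snd ⁻¹' U) := by
    ext x
    constructor
    · intro hx
      exact ⟨(x, f x), ⟨hf x, hx⟩, rfl⟩
    · rintro ⟨⟨x, y⟩, ⟨hxy, hy⟩, rfl⟩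
      have key : ∀ {a b : X}, (x, a) ∈ P → (x, b) ∉ Prod.fst '' P2 → φ b ≤ φ a :=
        fun {a b} ha hn => not_lt.1 fun hlt => hn ⟨((x, b), a), ⟨ha, hlt⟩, rfl⟩
      have : f x = y :=
        hφ.injective (le_antisymm (key hxy.1 (hf x).2) (key (hf x).1 hxy.2))
      exact this.symm ▸ hy
  rw [e]
  exact measurableSet_fst_image_of_finite ((hP.diff hQ).inter (measurable_snd hU))
    fun x => (h x).subset fun y hy => hy.1.1

end FiniteSections

namespace SimpleGraph

section Escape

variable {V : Type*} {G : SimpleGraph V}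

/-- Some nonbacktracking walk of length `n + 1` starting with `x`, `y` ends in a vertex
satisfying `Q`. -/
def Reaches (G : SimpleGraph V) (Q : V → Prop) : ℕ → V → V → Prop
  | 0, x, y => G.Adj x y ∧ Q y
  | n + 1, x, y => G.Adj x y ∧ ∃ z, z ≠ x ∧ Reaches G Q n y z

/-- There are arbitrarily long nonbacktracking walks starting with `x`, `y`. -/
def Escapes (G : SimpleGraph V) (x y : V) : Prop :=
  ∀ n, G.Reaches (fun _ => True) n x y

/-- A core vertex is one with at least two escaping neighbors. -/
def IsCore (G : SimpleGraph V) (x : V) : Prop :=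
  ∃ a b, a ≠ b ∧ G.Escapes x a ∧ G.Escapes x b

/-- A branching vertex is one with at least three escaping neighbors. -/
def IsBranching (G : SimpleGraph V) (x : V) : Prop :=
  ∃ a b c, a ≠ b ∧ a ≠ c ∧ b ≠ c ∧ G.Escapes x a ∧ G.Escapes x b ∧ G.Escapes x c

/-- The branch from `x` in the direction of `y` is infinite, but has no branching vertex. -/
def Thin (G : SimpleGraph V) (x y : V) : Prop :=
  G.Escapes x y ∧ ∀ n, ¬ G.Reaches G.IsBranching n x y

theorem Reaches.adj {Q : V → Prop} {n : ℕ} {x y : V} (h : G.Reaches Q n x y) : G.Adj x y := by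
  cases n
  exacts [h.1, h.1]

theorem Escapes.adj {x y : V} (h : G.Escapes x y) : G.Adj x y := (h 0).1

theorem Thin.adj {x y : V} (h : G.Thin x y) : G.Adj x y := h.1.adj

theorem IsBranching.isCore {x : V} (h : G.IsBranching x) : G.IsCore x := by
  obtain ⟨a, b, c, hab, -, -, ha, hb, -⟩ := h
  exact ⟨a, b, hab, ha, hb⟩

theorem Reaches.of_succ {n : ℕ} {x y : V} (h : G.Reaches (fun _ => True) (n + 1) x y) :
    G.Reaches (fun _ => True) n x y := by
  induction n generalizing x y with
  | zero => exact ⟨h.1, trivial⟩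
  | succ n ih =>
    obtain ⟨h1, z, hz, h2⟩ := h
    exact ⟨h1, z, hz, ih h2⟩

theorem Reaches.antitone {x y : V} :
    Antitone fun n => G.Reaches (fun _ => True) n x y :=
  antitone_nat_of_succ_le fun _ h => h.of_succ

theorem Escapes.exists_next (hlf : ∀ x, (G.neighborSet x).Finite) {x y : V}
    (h : G.Escapes x y) : ∃ z, z ≠ x ∧ G.Escapes y z := by
  by_contra! H
  have : ∀ z, ∃ n, z ≠ x → ¬ G.Reaches (fun _ => True) n y z := by
    intro z
    by_cases hz : z = x
    · exact ⟨0, fun h => (h hz).elim⟩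
    · obtain ⟨n, hn⟩ := not_forall.1 (H z hz)
      exact ⟨n, fun _ => hn⟩
  choose N hN using this
  obtain ⟨M, hM⟩ := ((hlf y).image N).bddAbove
  obtain ⟨-, z, hz, h2⟩ := h (M + 1)
  exact hN z hz (Reaches.antitone (hM ⟨z, h2.adj, rfl⟩) h2)

theorem Escapes.cons {x y z : V} (h : G.Escapes y z) (hxy : G.Adj x y) (hz : z ≠ x) :
    G.Escapes x y := by
  rintro (_ | n)
  exacts [⟨hxy, trivial⟩, ⟨hxy, z, hz, h n⟩]

theorem Escapes.of_seq {u : ℕ → V} (hu : ∀ n, G.Adj (u n) (u (n + 1)))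
    (hu' : ∀ n, u (n + 2) ≠ u n) : G.Escapes (u 0) (u 1) := by
  intro n
  suffices ∀ k, G.Reaches (fun _ => True) n (u k) (u (k + 1)) from this 0
  induction n with
  | zero => exact fun k => ⟨hu k, trivial⟩
  | succ n ih => exact fun k => ⟨hu k, _, hu' k, ih (k + 1)⟩

theorem Thin.next {x y z : V} (h : G.Thin x y) (hz : z ≠ x) (hyz : G.Escapes y z) :
    G.Thin y z :=
  ⟨hyz, fun n hn => h.2 (n + 1) ⟨h.adj, z, hz, hn⟩⟩

theorem IsCore.escapes_of_adj {a b : V} (h : G.IsCore a) (hab : G.Adj b a) :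
    G.Escapes b a := by
  obtain ⟨c, d, hcd, hc, hd⟩ := h
  by_cases hcb : c = b
  · exact hd.cons hab (hcb ▸ hcd.symm)
  · exact hc.cons hab hcb

theorem IsCore.of_escapes (hlf : ∀ x, (G.neighborSet x).Finite) {a b : V} (h : G.IsCore a)
    (hab : G.Escapes a b) : G.IsCore b := by
  obtain ⟨z, hz, hbz⟩ := hab.exists_next hlf
  exact ⟨a, z, hz.symm, h.escapes_of_adj hab.adj.symm, hbz⟩

/-- A backward sequence of thin directed edges forces the component to be a two-ended one. -/
theorem exists_isCore_of_thin_seq (hlf : ∀ x, (G.neighborSet x).Finite) {u : ℕ → V}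
    (hu : ∀ i, G.Thin (u (i + 1)) (u i)) :
    ∃ x, G.IsCore x ∧ ∀ w, G.Reachable x w → ¬ G.IsBranching w := by
  have walk : ∀ (k : ℕ) (Q : V → Prop) {a w : V} (p : G.Walk a w), p.IsPath → Q w →
      p.length = k → ∀ i, a = u i → ∃ n j, G.Reaches Q n (u (j + 1)) (u j) := by
    intro k Q
    have aux : ∀ {a w : V} (p : G.Walk a w), p.IsPath → Q w → ∀ b, G.Adj b a → b ≠ p.snd →
        G.Reaches Q p.length b a := by
      intro a w p
      induction p with
      | nil => exact fun _ hw b hb _ => ⟨hb, hw⟩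
      | cons h p ih =>
        intro hp hw b hb hne
        rw [Walk.cons_isPath_iff] at hp
        refine ⟨hb, _, fun h => hne (by simpa using h.symm), ih hp.1 hw _ h ?_⟩
        rintro rfl
        exact hp.2 (p.getVert_mem_support 1)
    induction k with
    | zero =>
      intro a w p _ hw hk i hi
      obtain rfl := p.eq_of_length_eq_zero hk
      exact ⟨0, i, (hu i).adj, hi ▸ hw⟩
    | succ k ih =>
      intro a w p hp hw hk i hi
      by_cases hs : u (i + 1) = p.snd
      · cases p with
        | nil => simp at hk
        | cons h p =>
          rw [Walk.cons_isPath_iff] at hp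
          exact ih p hp.1 hw (by simpa using hk) (i + 1) (by simpa using hs.symm)
      · exact ⟨p.length, i, hi ▸ aux p hp hw _ (hi ▸ (hu i).adj) hs⟩
  have key : ∀ i w, G.Reachable (u i) w → ¬ G.IsBranching w := by
    intro i w hr hw
    obtain ⟨p, hp⟩ := hr.exists_isPath
    obtain ⟨n, j, hnj⟩ := walk _ _ p hp hw rfl i rfl
    exact (hu j).2 n hnj
  by_cases hb : ∃ i, u (i + 2) = u i
  · obtain ⟨i, hi⟩ := hb
    have h1 := (hu (i + 1)).1
    have h2 := (hu i).1
    rw [show i + 1 + 1 = i + 2 from rfl, hi] at h1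
    obtain ⟨z, hz, hz'⟩ := h2.exists_next hlf
    exact ⟨u i, ⟨z, u (i + 1), hz, hz', h1⟩, key i⟩
  · push Not at hb
    refine ⟨u 1, ⟨u 0, u 2, (hb 0).symm, (hu 0).1, ?_⟩, key 1⟩
    exact Escapes.of_seq (u := fun n => u (n + 1)) (fun n => (hu (n + 1)).adj.symm)
      fun n => hb (n + 1)

theorem IsAcyclic.isPath_cons (hG : G.IsAcyclic) {u v w : V} {p : G.Walk v w} (hp : p.IsPath)
    (h : G.Adj u v) (hne : u ≠ p.snd) : (p.cons h).IsPath := by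
  rw [Walk.cons_isPath_iff]
  exact ⟨hp, fun hu => hne (hG.eq_snd_of_adj_start hp h.symm hu)⟩

theorem Reaches.exists_isPath (hG : G.IsAcyclic) {Q : V → Prop} {n : ℕ} {x y : V}
    (h : G.Reaches Q n x y) :
    ∃ (z : V) (hxy : G.Adj x y) (p : G.Walk y z), (p.cons hxy).IsPath ∧ Q z := by
  induction n generalizing x y with
  | zero => exact ⟨y, h.1, .nil, hG.isPath_cons .nil h.1 (by simpa using h.1.ne), h.2⟩
  | succ n ih =>
    obtain ⟨hxy, z, hz, h2⟩ := h
    obtain ⟨w, hyz, p, hp, hw⟩ := ih h2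
    exact ⟨w, hxy, _, hG.isPath_cons hp hxy (by simpa using hz.symm), hw⟩

theorem Walk.IsPath.escapes_of_isCore {a v b : V} {h : G.Adj a v} {p : G.Walk v b}
    (hp : (p.cons h).IsPath) (hb : G.IsCore b) : G.Escapes a v := by
  induction p generalizing a with
  | nil => exact hb.escapes_of_adj h
  | cons h' p ih =>
    have h1 := ih hp.of_cons hb
    refine h1.cons h ?_
    rintro rfl
    rw [Walk.cons_isPath_iff] at hp
    exact hp.2 (by simp)

/-- The set of core vertices is convex. -/
theorem Walk.IsPath.isCore_of_mem_support {a b : V} {p : G.Walk a b} (hp : p.IsPath)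
    (ha : G.IsCore a) (hb : G.IsCore b) : ∀ v ∈ p.support, G.IsCore v := by
  induction p with
  | nil => simpa using ha
  | @cons a v b h p ih =>
    have hv : G.IsCore v := by
      cases p with
      | nil => exact hb
      | @cons _ w _ h' p =>
        refine ⟨a, w, ?_, ha.escapes_of_adj h.symm, hp.of_cons.escapes_of_isCore hb⟩
        rintro rfl
        rw [Walk.cons_isPath_iff] at hp
        exact hp.2 (by simp)
    intro w hw
    rw [Walk.support_cons, List.mem_cons] at hw
    rcases hw with rfl | hw
    exacts [ha, ih hp.of_cons hv hb w hw]

theorem Escapes.exists_ray (hlf : ∀ x, (G.neighborSet x).Finite) {x y : V}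
    (h : G.Escapes x y) : ∃ u : ℕ → V, u 0 = x ∧ u 1 = y ∧ (∀ n, G.Adj (u n) (u (n + 1))) ∧
      ∀ n, u (n + 2) ≠ u n := by
  have : ∀ e : {e : V × V // G.Escapes e.1 e.2}, ∃ e' : {e : V × V // G.Escapes e.1 e.2},
      e'.1.1 = e.1.2 ∧ e'.1.2 ≠ e.1.1 := by
    rintro ⟨⟨a, b⟩, hab⟩
    obtain ⟨z, hz, hbz⟩ := hab.exists_next hlf
    exact ⟨⟨(b, z), hbz⟩, rfl, hz⟩
  choose F hF1 hF2 using this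
  let s : ℕ → {e : V × V // G.Escapes e.1 e.2} := fun n => F^[n] ⟨(x, y), h⟩
  have hs : ∀ n, s (n + 1) = F (s n) := fun n => Function.iterate_succ_apply' _ _ _
  refine ⟨fun n => (s n).1.1, rfl, ?_, fun n => ?_, fun n => ?_⟩
  · simp only [hs 0, hF1]
    rfl
  · simp only [hs n, hF1]
    exact (s n).2.adj
  · simp only [hs (n + 1), hF1, hs n]
    exact hF2 _

end Escape

section Ends

variable {V : Type*} {G : SimpleGraph V}

theorem Walk.mem_componentCompl {K : Set V} {C : G.ComponentCompl K} {u v : V} (p : G.Walk u v)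
    (hp : ∀ w ∈ p.support, w ∉ K) (hu : u ∈ C) : v ∈ C := by
  induction p with
  | nil => exact hu
  | cons h p ih =>
    simp only [Walk.support_cons, List.mem_cons, forall_eq_or_imp] at hp
    exact ih hp.2 (ComponentCompl.mem_of_adj _ _ hu (hp.2 _ p.start_mem_support) h)

theorem ComponentCompl.exists_isPath {K : Set V} {C : G.ComponentCompl K} {u v : V}
    (hu : u ∈ C) (hv : v ∈ C) : ∃ p : G.Walk u v, p.IsPath ∧ ∀ w ∈ p.support, w ∉ K := by
  classical
  obtain ⟨huK, rfl⟩ := hu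
  obtain ⟨hvK, h⟩ := hv
  obtain ⟨p⟩ := ConnectedComponent.exact h.symm
  have hq : ∀ w ∈ (p.map (Embedding.induce Kᶜ).toHom).support, w ∉ K := by
    intro w hw
    rw [Walk.support_map, List.mem_map] at hw
    obtain ⟨⟨w', hw'⟩, -, rfl⟩ := hw
    exact hw'
  exact ⟨_, Walk.bypass_isPath _, fun w hw => hq w (Walk.support_bypass_subset_support _ hw)⟩

theorem ComponentCompl.eq_of_mem {K : Set V} {C D : G.ComponentCompl K} {v : V} (hC : v ∈ C)
    (hD : v ∈ D) : C = D :=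
  hC.choose_spec.symm.trans hD.choose_spec

/-- The component of the complement of a finite set selected by an end. -/
def endComp (e : (j : (Finset V)ᵒᵖ) → G.componentComplFunctor.obj j) (K : Finset V) :
    G.ComponentCompl (K : Set V) :=
  e (.op K)

theorem end_mem_of_subset {e : (j : (Finset V)ᵒᵖ) → G.componentComplFunctor.obj j}
    (he : e ∈ G.end) {K L : Finset V} (h : K ⊆ L) {v : V}
    (hv : v ∈ endComp e L) : v ∈ endComp e K := by
  have h1 := he (CategoryTheory.opHomOfLE (x := Opposite.op K) (y := Opposite.op L) h)
  have h2 : endComp e K = (endComp e L).hom (by exact_mod_cast h) := h1.symm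
  rw [h2]
  exact ComponentCompl.subset_hom (endComp e L) (by exact_mod_cast h) hv

theorem IsAcyclic.eq_of_mem_componentCompl (hG : G.IsAcyclic) {a b b' : V} {K : Set V}
    {C : G.ComponentCompl K} (ha : a ∈ K) (hab : G.Adj a b) (hab' : G.Adj a b') (hb : b ∈ C)
    (hb' : b' ∈ C) : b = b' := by
  obtain ⟨p, hp, hpK⟩ := ComponentCompl.exists_isPath hb hb'
  have h1 : (p.cons hab).IsPath := by
    rw [Walk.cons_isPath_iff]
    exact ⟨hp, fun h => hpK a h ha⟩
  have h2 := hG.eq_snd_of_adj_start h1 hab' (by simp)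
  simpa using h2.symm

/-- An end of a tree gives a coherent direction at every vertex. -/
theorem exists_direction_of_end (hG : G.IsTree)
    {e : (j : (Finset V)ᵒᵖ) → G.componentComplFunctor.obj j} (he : e ∈ G.end) :
    ∃ f : V → V, (∀ v, G.Adj v (f v)) ∧
      (∀ v, f v ∈ endComp e {v}) ∧ (∀ v, f (f v) ≠ v) ∧ ∀ a b, G.Adj a b → f a = b ∨ f b = a := by
  classical
  have hex : ∀ v, ∃ b, G.Adj v b ∧ b ∈ endComp e {v} := by
    intro v
    obtain ⟨⟨c, k⟩, hc, hk, hck⟩ := ComponentCompl.exists_adj_boundary_pair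
      hG.connected.preconnected (by simp) (endComp e {v})
    obtain rfl : k = v := by simpa using hk
    exact ⟨c, hck.symm, hc⟩
  choose f hf hf' using hex
  refine ⟨f, hf, hf', fun v hv => ?_, fun a b hab => ?_⟩
  · obtain ⟨w, hw⟩ := (endComp e {v, f v}).nonempty
    have hw1 := end_mem_of_subset he (K := {v}) (by simp) hw
    have hw2 := end_mem_of_subset he (K := {f v}) (by simp) hw
    have h3 := hf' (f v)
    rw [hv] at h3
    obtain ⟨p, hp, hpv⟩ := ComponentCompl.exists_isPath hw1 (hf' v)
    obtain ⟨q, hq, hqv⟩ := ComponentCompl.exists_isPath hw2 h3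
    have h4 := hG.isAcyclic.mem_support_of_ne_mem_support_of_adj_of_isPath hq hp (hf v)
      fun h => hpv v h (by simp)
    exact hqv _ h4 (by simp)
  · obtain ⟨w, hw⟩ := (endComp e {a, b}).nonempty
    have hw1 := end_mem_of_subset he (K := {a}) (by simp) hw
    have hw2 := end_mem_of_subset he (K := {b}) (by simp) hw
    obtain ⟨p, hp⟩ := hG.connected.exists_isPath w a
    by_cases hb : b ∈ p.support
    · left
      refine hG.isAcyclic.eq_of_mem_componentCompl (by simp) (hf a) hab (hf' a) ?_
      refine (p.takeUntil b hb).mem_componentCompl (fun x hx => ?_) hw1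
      have := Walk.endpoint_notMem_support_takeUntil hp hb hab.ne
      simp only [Finset.coe_singleton, Set.mem_singleton_iff]
      rintro rfl
      exact this hx
    · right
      refine hG.isAcyclic.eq_of_mem_componentCompl (by simp) (hf b) hab.symm (hf' b) ?_
      refine p.mem_componentCompl (fun x hx => ?_) hw2
      simp only [Finset.coe_singleton, Set.mem_singleton_iff]
      rintro rfl
      exact hb hx

theorem escapes_direction {f : V → V} (hf : ∀ v, G.Adj v (f v)) (hf' : ∀ v, f (f v) ≠ v) (v : V) :
    G.Escapes v (f v) := by
  refine Escapes.of_seq (u := fun n => f^[n] v) (fun n => ?_) fun n => ?_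
  · simp only [Function.iterate_succ_apply']
    exact hf _
  · simp only [Function.iterate_succ_apply']
    exact hf' _

theorem end_ext (hG : G.IsTree) {e e' : (j : (Finset V)ᵒᵖ) → G.componentComplFunctor.obj j}
    (he : e ∈ G.end) (he' : e' ∈ G.end)
    (h : ∀ v : V, endComp e {v} = endComp e' {v}) : e = e' := by
  funext L
  obtain ⟨w, hw⟩ := (endComp e L.unop).nonempty
  obtain ⟨w', hw'⟩ := (endComp e' L.unop).nonempty
  obtain ⟨p, hp⟩ := hG.connected.exists_isPath w w'
  refine ComponentCompl.eq_of_mem (v := w') (p.mem_componentCompl (fun v hv hvL => ?_) hw) hw'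
  have hvL' : ({v} : Finset V) ⊆ L.unop := by simpa using hvL
  have h1 := end_mem_of_subset he hvL' hw
  have h2 := end_mem_of_subset he' hvL' hw'
  rw [← h v] at h2
  obtain ⟨q, hq, hqv⟩ := ComponentCompl.exists_isPath h1 h2
  have : p = q := congrArg Subtype.val
    ((hG.isAcyclic.subsingleton_path _ _).elim (⟨p, hp⟩ : G.Path w w') ⟨q, hq⟩)
  exact hqv v (this ▸ hv) (by simp)

theorem exists_end_of_ray (hG : G.IsAcyclic) {u : ℕ → V} (hu : ∀ n, G.Adj (u n) (u (n + 1)))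
    (hu' : ∀ n, u (n + 2) ≠ u n) :
    ∃ e ∈ G.end, u 1 ∈ endComp e {u 0} := by
  have hpath : ∀ k m, ∃ p : G.Walk (u (m + k + 1)) (u m), p.IsPath ∧ p.snd = u (m + k) ∧
      p.length = k + 1 := by
    intro k m
    induction k with
    | zero =>
      exact ⟨.cons (hu m).symm .nil, hG.isPath_cons .nil _ (by simpa using (hu m).ne'), rfl, rfl⟩
    | succ k ih =>
      obtain ⟨p, hp, hs, hl⟩ := ih
      exact ⟨p.cons (hu (m + k + 1)).symm, hG.isPath_cons hp _ (hs ▸ hu' (m + k)),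
        by simp [add_assoc], by simp [hl]⟩
  have hne : ∀ m k, u (m + k + 1) ≠ u m := by
    intro m k h
    obtain ⟨p, hp, -, hl⟩ := hpath k m
    have aux : ∀ {a b : V} (q : G.Walk a b), q.IsPath → a = b → q.length = 0 := by
      rintro a b q hq rfl
      exact Walk.length_eq_zero_iff.2 (Walk.isPath_iff_nil.1 hq)
    have := aux p hp h
    omega
  have hinj : Function.Injective u := by
    intro a b hab
    by_contra hne'
    rcases lt_or_gt_of_ne hne' with h | h
    · obtain ⟨k, rfl⟩ := Nat.exists_eq_add_of_lt h
      exact hne a k hab.symm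
    · obtain ⟨k, rfl⟩ := Nat.exists_eq_add_of_lt h
      exact hne b k hab
  have hev : ∀ L : Finset V, ∃ N, ∀ n, N ≤ n → u n ∉ (L : Set V) := by
    intro L
    obtain ⟨N, hN⟩ := (L.finite_toSet.preimage hinj.injOn).bddAbove
    exact ⟨N + 1, fun n hn h => by have := hN h; omega⟩
  choose N hN using hev
  have htail : ∀ (L : Finset V) (M : ℕ) (hM : ∀ n, M ≤ n → u n ∉ (L : Set V)) (n : ℕ), M ≤ n →
      u n ∈ G.componentComplMk (hM M le_rfl) := by
    intro L M hM n hn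
    induction n, hn using Nat.le_induction with
    | base => exact componentComplMk_mem _ _
    | succ n hn ih => exact ComponentCompl.mem_of_adj _ _ ih (hM _ (by omega)) (hu n)
  refine ⟨fun L => G.componentComplMk (hN L.unop _ le_rfl), fun {L L'} h => ?_, ?_⟩
  · refine ComponentCompl.eq_of_mem (v := u (max (N L.unop) (N L'.unop))) ?_
      (htail _ _ (hN L'.unop) _ (le_max_right _ _))
    exact ComponentCompl.subset_hom _ (CategoryTheory.le_of_op_hom h)
      (htail _ _ (hN L.unop) _ (le_max_left _ _))
  · have h1 : ∀ n, 1 ≤ n → u n ∉ ((({u 0} : Finset V)) : Set V) := by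
      intro n hn h
      have := hinj (by simpa using h : u n = u 0)
      omega
    have h2 := htail _ _ (hN {u 0}) _ (le_max_right 1 _)
    have h3 := htail _ _ h1 _ (le_max_left 1 (N {u 0}))
    have h4 := ComponentCompl.eq_of_mem h2 h3
    change u 1 ∈ G.componentComplMk (hN {u 0} _ le_rfl)
    rw [h4]
    exact componentComplMk_mem _ _

/-- A tree with a core vertex and no branching vertices has exactly two ends. -/
theorem ncard_end_eq_two (hG : G.IsTree) (hlf : ∀ x, (G.neighborSet x).Finite) {x : V}
    (hx : G.IsCore x) (hbr : ∀ w, ¬ G.IsBranching w) : G.end.ncard = 2 := by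
  obtain ⟨y, y', hyy, hy, hy'⟩ := hx
  have hend : ∀ z, G.Escapes x z → ∃ e ∈ G.end, z ∈ endComp e {x} := by
    intro z hz
    obtain ⟨u, rfl, rfl, h1, h2⟩ := hz.exists_ray hlf
    exact exists_end_of_ray hG.isAcyclic h1 h2
  have huniq : ∀ e ∈ G.end, ∀ e' ∈ G.end, ∀ z, G.Adj x z →
      z ∈ endComp e {x} → z ∈ endComp e' {x} → e = e' := by
    intro e he e' he' z hxz hz hz'
    obtain ⟨f, hf1, hf2, hf3, hf4⟩ := exists_direction_of_end hG he
    obtain ⟨f', hf1', hf2', hf3', hf4'⟩ := exists_direction_of_end hG he'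
    have hfx : f x = f' x :=
      (hG.isAcyclic.eq_of_mem_componentCompl (by simp) (hf1 x) hxz (hf2 x) hz).trans
        (hG.isAcyclic.eq_of_mem_componentCompl (by simp) (hf1' x) hxz (hf2' x) hz').symm
    have prop : ∀ {a v : V} (p : G.Walk a v), (∀ w ∈ p.support, G.IsCore w) → f a = f' a →
        f v = f' v := by
      intro a v p
      induction p with
      | nil => exact fun _ h => h
      | @cons a b _ h p ih =>
        intro hc hfa
        simp only [Walk.support_cons, List.mem_cons, forall_eq_or_imp] at hc
        refine ih hc.2 ?_
        by_cases hb : f a = b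
        · by_contra hne
          have h1 : f b ≠ a := hb ▸ hf3 a
          have h2 : f' b ≠ a := by
            rw [← hb, hfa]
            exact hf3' a
          exact hbr b ⟨f b, f' b, a, hne, h1, h2, escapes_direction hf1 hf3 b,
            escapes_direction hf1' hf3' b, hc.1.escapes_of_adj h.symm⟩
        · rw [(hf4 a b h).resolve_left hb, (hf4' a b h).resolve_left (hfa ▸ hb)]
    have hff : ∀ v, f v = f' v := by
      intro v
      by_contra hne
      have hv : G.IsCore v :=
        ⟨f v, f' v, hne, escapes_direction hf1 hf3 v, escapes_direction hf1' hf3' v⟩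
      obtain ⟨p, hp⟩ := hG.connected.exists_isPath x v
      exact hne (prop p (hp.isCore_of_mem_support ⟨y, y', hyy, hy, hy'⟩ hv) hfx)
    refine end_ext hG he he' fun v => ComponentCompl.eq_of_mem (hf2 v) ?_
    rw [hff v]
    exact hf2' v
  obtain ⟨e, he, hey⟩ := hend y hy
  obtain ⟨e', he', hey'⟩ := hend y' hy'
  rw [Set.ncard_eq_two]
  refine ⟨e, e', ?_, ?_⟩
  · rintro rfl
    exact hyy (hG.isAcyclic.eq_of_mem_componentCompl (by simp) hy.adj hy'.adj hey hey')
  · refine Set.Subset.antisymm (fun e'' he'' => ?_) ?_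
    · obtain ⟨f, hf1, hf2, hf3, -⟩ := exists_direction_of_end hG he''
      by_cases h1 : f x = y
      · exact Or.inl (huniq _ he'' _ he y hy.adj (h1 ▸ hf2 x) hey)
      by_cases h2 : f x = y'
      · exact Or.inr (huniq _ he'' _ he' y' hy'.adj (h2 ▸ hf2 x) hey')
      exact (hbr x ⟨f x, y, y', h1, h2, hyy, escapes_direction hf1 hf3 x, hy, hy'⟩).elim
    · rintro _ (rfl | rfl)
      exacts [he, he']

end Ends

section Transfer

variable {V : Type*} {G : SimpleGraph V}

theorem reaches_induce_supp (c : G.ConnectedComponent) {n : ℕ} {x y : c.supp} :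
    (G.induce c.supp).Reaches (fun _ => True) n x y ↔ G.Reaches (fun _ => True) n x y := by
  induction n generalizing x y with
  | zero => rfl
  | succ n ih =>
    refine and_congr_right fun _ => ⟨?_, ?_⟩
    · rintro ⟨z, hz, h⟩
      exact ⟨z, fun h' => hz (Subtype.ext h'), ih.1 h⟩
    · rintro ⟨z, hz, h⟩
      exact ⟨⟨z, c.mem_supp_of_adj_mem_supp y.2 h.adj⟩, fun h' => hz (congrArg Subtype.val h'),
        ih.2 h⟩

theorem escapes_induce_supp (c : G.ConnectedComponent) {x y : c.supp} :
    (G.induce c.supp).Escapes x y ↔ G.Escapes x y :=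
  forall_congr' fun _ => reaches_induce_supp c

theorem IsAcyclic.isTree_induce_supp (hG : G.IsAcyclic) (c : G.ConnectedComponent) :
    (G.induce c.supp).IsTree :=
  ⟨c.connected_toSimpleGraph, hG.induce _⟩

theorem IsAcyclic.exists_escapes_of_end_ne_empty (hG : G.IsAcyclic)
    (h : ∀ c : G.ConnectedComponent, (G.induce c.supp).end ≠ ∅) (x : V) :
    ∃ y, G.Escapes x y := by
  obtain ⟨e, he⟩ := Set.nonempty_iff_ne_empty.2 (h (G.connectedComponentMk x))
  obtain ⟨f, hf1, -, hf3, -⟩ := exists_direction_of_end (hG.isTree_induce_supp _) he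
  exact ⟨_, (escapes_induce_supp _).1 (escapes_direction hf1 hf3 ⟨x, rfl⟩)⟩

theorem IsAcyclic.exists_isBranching_of_ncard_end_ne_two (hG : G.IsAcyclic)
    (hlf : ∀ x, (G.neighborSet x).Finite)
    (h : ∀ c : G.ConnectedComponent, (G.induce c.supp).end.ncard ≠ 2) {x : V} (hx : G.IsCore x) :
    ∃ w, G.Reachable x w ∧ G.IsBranching w := by
  by_contra! H
  set c := G.connectedComponentMk x with hc
  refine h c (ncard_end_eq_two (hG.isTree_induce_supp c) (fun v => ?_) (x := ⟨x, rfl⟩) ?_ ?_)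
  · exact Set.Finite.preimage Subtype.val_injective.injOn (hlf v)
  · obtain ⟨a, b, hab, ha, hb⟩ := hx
    refine ⟨⟨a, c.mem_supp_of_adj_mem_supp rfl ha.adj⟩, ⟨b, c.mem_supp_of_adj_mem_supp rfl hb.adj⟩,
      fun h => hab (congrArg Subtype.val h), (escapes_induce_supp c).2 ha,
      (escapes_induce_supp c).2 hb⟩
  · rintro ⟨w, hw⟩ ⟨a, b, d, hab, had, hbd, ha, hb, hd⟩
    refine H w (ConnectedComponent.exact hw.symm) ⟨a, b, d, fun h => hab (Subtype.ext h),
      fun h => had (Subtype.ext h), fun h => hbd (Subtype.ext h), (escapes_induce_supp c).1 ha,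
      (escapes_induce_supp c).1 hb, (escapes_induce_supp c).1 hd⟩

end Transfer

section Measurability

universe u

variable {X : Type u} [MeasurableSpace X] [StandardBorelSpace X] {G : SimpleGraph X}

theorem measurableSet_exists_of_adj (hlf : ∀ x, (G.neighborSet x).Finite) {α : Type u}
    [MeasurableSpace α] [StandardBorelSpace α] (g : α → X) {Q : α → X → Prop}
    (hQ : MeasurableSet {p : α × X | Q p.1 p.2}) (hadj : ∀ a y, Q a y → G.Adj (g a) y) :
    MeasurableSet {a | ∃ y, Q a y} := by
  have h := measurableSet_fst_image_of_finite hQ fun a => (hlf (g a)).subset (hadj a)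
  convert h using 1
  ext a
  simp

theorem measurableSet_reaches (hG : MeasurableSet {p : X × X | G.Adj p.1 p.2})
    (hlf : ∀ x, (G.neighborSet x).Finite) {Q : X → Prop} (hQ : MeasurableSet {x | Q x}) (n : ℕ) :
    MeasurableSet {p : X × X | G.Reaches Q n p.1 p.2} := by
  induction n with
  | zero => exact hG.inter (measurable_snd hQ)
  | succ n ih =>
    refine hG.inter (measurableSet_exists_of_adj (G := G) hlf Prod.snd ?_ fun a y h => h.2.adj)
    refine MeasurableSet.inter ?_ ?_
    · exact (measurableSet_eq_fun measurable_snd measurable_fst.fst).compl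
    · exact (measurable_fst.snd.prodMk measurable_snd) ih

theorem measurableSet_escapes (hG : MeasurableSet {p : X × X | G.Adj p.1 p.2})
    (hlf : ∀ x, (G.neighborSet x).Finite) : MeasurableSet {p : X × X | G.Escapes p.1 p.2} := by
  simp only [Escapes, Set.ofPred_forall]
  exact MeasurableSet.iInter fun n => measurableSet_reaches hG hlf MeasurableSet.univ n

theorem measurableSet_isCore (hG : MeasurableSet {p : X × X | G.Adj p.1 p.2})
    (hlf : ∀ x, (G.neighborSet x).Finite) : MeasurableSet {x | G.IsCore x} := by
  have hE := measurableSet_escapes hG hlf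
  refine measurableSet_exists_of_adj hlf id (Q := fun x a => ∃ b, a ≠ b ∧ G.Escapes x a ∧
    G.Escapes x b) ?_ fun x a h => h.choose_spec.2.1.adj
  refine measurableSet_exists_of_adj (α := X × X) hlf Prod.fst (Q := fun p b => p.2 ≠ b ∧
    G.Escapes p.1 p.2 ∧ G.Escapes p.1 b) ?_ fun x a h => h.2.2.adj
  refine .inter ?_ (.inter ?_ ?_)
  · exact (measurableSet_eq_fun measurable_fst.snd measurable_snd).compl
  · exact measurable_fst hE
  · exact (measurable_fst.fst.prodMk measurable_snd) hE

theorem measurableSet_isBranching (hG : MeasurableSet {p : X × X | G.Adj p.1 p.2})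
    (hlf : ∀ x, (G.neighborSet x).Finite) : MeasurableSet {x | G.IsBranching x} := by
  have hE := measurableSet_escapes hG hlf
  refine measurableSet_exists_of_adj hlf id (Q := fun x a => ∃ b c, a ≠ b ∧ a ≠ c ∧ b ≠ c ∧
    G.Escapes x a ∧ G.Escapes x b ∧ G.Escapes x c) ?_
    fun x a ⟨_, _, _, _, _, h, _⟩ => h.adj
  refine measurableSet_exists_of_adj (α := X × X) hlf Prod.fst (Q := fun p b => ∃ c, p.2 ≠ b ∧
    p.2 ≠ c ∧ b ≠ c ∧ G.Escapes p.1 p.2 ∧ G.Escapes p.1 b ∧ G.Escapes p.1 c) ?_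
    fun x a ⟨_, _, _, _, _, h, _⟩ => h.adj
  refine measurableSet_exists_of_adj (α := (X × X) × X) hlf (fun p => p.1.1)
    (Q := fun p c => p.1.2 ≠ p.2 ∧ p.1.2 ≠ c ∧ p.2 ≠ c ∧ G.Escapes p.1.1 p.1.2 ∧
      G.Escapes p.1.1 p.2 ∧ G.Escapes p.1.1 c) ?_
    fun x a ⟨_, _, _, _, _, h⟩ => h.adj
  refine .inter ?_ (.inter ?_ (.inter ?_ (.inter ?_ (.inter ?_ ?_))))
  · exact (measurableSet_eq_fun measurable_fst.fst.snd measurable_fst.snd).compl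
  · exact (measurableSet_eq_fun measurable_fst.fst.snd measurable_snd).compl
  · exact (measurableSet_eq_fun measurable_fst.snd measurable_snd).compl
  · exact measurable_fst.fst hE
  · exact (measurable_fst.fst.fst.prodMk measurable_fst.snd) hE
  · exact (measurable_fst.fst.fst.prodMk measurable_snd) hE

theorem measurableSet_thin (hG : MeasurableSet {p : X × X | G.Adj p.1 p.2})
    (hlf : ∀ x, (G.neighborSet x).Finite) : MeasurableSet {p : X × X | G.Thin p.1 p.2} := by
  have h : {p : X × X | G.Thin p.1 p.2} = {p : X × X | G.Escapes p.1 p.2} ∩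
      ⋂ n, {p : X × X | G.Reaches G.IsBranching n p.1 p.2}ᶜ := by
    ext p
    simp [Thin]
  rw [h]
  exact (measurableSet_escapes hG hlf).inter (MeasurableSet.iInter fun n =>
    (measurableSet_reaches hG hlf (measurableSet_isBranching hG hlf) n).compl)

end Measurability

section Ample

variable {V : Type*} {G : SimpleGraph V}

theorem mem_EGSat_of_reachable {A : Set V} {x y : V} (h : G.Reachable x y)
    (hx : x ∈ EGSat G A) : y ∈ EGSat G A := by
  obtain ⟨a, ha, hxa⟩ := hx
  exact ⟨a, ha, h.symm.trans hxa⟩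

/-- The vertices from which some branch is infinite without branching vertices. -/
def thinSet (G : SimpleGraph V) : Set V := {x | ∃ y, G.Thin x y}

/-- The core vertices of the components not containing a thin branch. -/
def ampleCore (G : SimpleGraph V) : Set V := {x | G.IsCore x} \ EGSat G G.thinSet

theorem mem_ampleCore_of_reachable {x y : V} (hx : x ∈ G.ampleCore) (h : G.Reachable x y)
    (hy : G.IsCore y) : y ∈ G.ampleCore :=
  ⟨hy, fun h' => hx.2 (mem_EGSat_of_reachable h.symm h')⟩

theorem EGSat_ampleCore (hG : G.IsAcyclic) (h : ∀ x, ∃ y, G.Escapes x y) :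
    EGSat G G.ampleCore = (EGSat G G.thinSet)ᶜ := by
  ext x
  constructor
  · rintro ⟨b, hb, hxb⟩ hx
    exact hb.2 (mem_EGSat_of_reachable hxb hx)
  · intro hx
    obtain ⟨y, hy⟩ := h x
    have hthin : ¬ G.Thin x y := fun h => hx ⟨x, ⟨y, h⟩, .rfl⟩
    simp only [Thin, hy, true_and, not_forall, not_not] at hthin
    obtain ⟨n, hn⟩ := hthin
    obtain ⟨z, hxy, p, -, hz⟩ := hn.exists_isPath hG
    have hr : G.Reachable x z := (p.cons hxy).reachable
    exact ⟨z, ⟨hz.isCore, fun h => hx (mem_EGSat_of_reachable hr.symm h)⟩, hr⟩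

theorem Walk.reachable_induce_induce {B : Set V} {S : Set B} {u v : V} (p : G.Walk u v)
    (hp : ∀ w ∈ p.support, ∃ h : w ∈ B, ⟨w, h⟩ ∈ S) :
    ((G.induce B).induce S).Reachable
      ⟨⟨u, (hp u p.start_mem_support).fst⟩, (hp u p.start_mem_support).snd⟩
      ⟨⟨v, (hp v p.end_mem_support).fst⟩, (hp v p.end_mem_support).snd⟩ := by
  induction p with
  | nil => exact .rfl
  | cons h p ih =>
    have hp' : ∀ w ∈ p.support, ∃ h : w ∈ B, ⟨w, h⟩ ∈ S :=
      fun w hw => hp w (List.mem_cons_of_mem _ hw)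
    refine Reachable.trans (Adj.reachable ?_) (ih hp')
    exact h

theorem ampleGraph_ampleCore (hG : G.IsAcyclic) (hlf : ∀ x, (G.neighborSet x).Finite) :
    AmpleGraph (G.induce G.ampleCore) := by
  have hmem : ∀ {x a : V}, x ∈ G.ampleCore → G.Escapes x a → a ∈ G.ampleCore :=
    fun hx ha => mem_ampleCore_of_reachable hx ha.adj.reachable (hx.1.of_escapes hlf ha)
  constructor
  · rintro ⟨x, hx⟩
    obtain ⟨a, b, hab, ha, hb⟩ := hx.1
    have hne : (⟨a, hmem hx ha⟩ : G.ampleCore) ≠ ⟨b, hmem hx hb⟩ :=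
      fun h => hab (congrArg Subtype.val h)
    rw [← Set.encard_pair hne]
    refine Set.encard_le_encard ?_
    rintro _ (rfl | rfl)
    exacts [ha.adj, hb.adj]
  · rintro ⟨x, hx⟩ ⟨⟨y, hy⟩, hyx⟩
    have hyx' : y ≠ x := fun h => hyx (Subtype.ext h)
    obtain ⟨s, hs, hsx⟩ : ∃ s, G.Escapes y s ∧ ∀ r : G.Walk y x, r.IsPath → r.snd ≠ s := by
      obtain ⟨a, b, hab, ha, hb⟩ := hy.1
      by_cases h : ∃ r : G.Walk y x, r.IsPath ∧ r.snd = a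
      · obtain ⟨r, hr, rfl⟩ := h
        refine ⟨b, hb, fun r' hr' => ?_⟩
        have : r = r' := congrArg Subtype.val
          ((hG.subsingleton_path _ _).elim (⟨r, hr⟩ : G.Path y x) ⟨r', hr'⟩)
        exact this ▸ hab
      · push Not at h
        exact ⟨a, ha, h⟩
    have hthin : ¬ G.Thin y s := fun h => hy.2 ⟨y, ⟨s, h⟩, .rfl⟩
    simp only [Thin, hs, true_and, not_forall, not_not] at hthin
    obtain ⟨n, hn⟩ := hthin
    obtain ⟨z, hys, p, hp, hz⟩ := hn.exists_isPath hG
    have hxp : x ∉ (p.cons hys).support := by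
      classical
      intro h
      refine hsx _ (hp.takeUntil h) ?_
      rw [Walk.snd_takeUntil hyx'.symm]
      simp
    have hzx : ¬ G.Adj z x := by
      intro h
      exact hsx _ (hp.concat hxp h) (by simp [Walk.concat_cons])
    have hsupp : ∀ w ∈ (p.cons hys).support,
        ∃ h : w ∈ G.ampleCore, (⟨w, h⟩ : G.ampleCore) ∈ ({⟨x, hx⟩}ᶜ : Set G.ampleCore) := by
      classical
      intro w hw
      refine ⟨mem_ampleCore_of_reachable hy ((p.cons hys).takeUntil w hw).reachable
        (hp.isCore_of_mem_support hy.1 hz.isCore w hw), fun h => ?_⟩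
      obtain rfl : w = x := congrArg Subtype.val h
      exact hxp hw
    have hr := (p.cons hys).reachable_induce_induce hsupp
    refine ⟨_, hr, ?_⟩
    obtain ⟨hzB, -⟩ := hsupp z (Walk.end_mem_support _)
    obtain ⟨a, b, c, hab, hac, hbc, ha, hb, hc⟩ := hz
    have hne : ∀ {a : V}, G.Escapes z a → a ≠ x := by
      rintro a ha rfl
      exact hzx ha.adj
    have h3 : ({⟨⟨a, hmem hzB ha⟩, fun h => hne ha (congrArg Subtype.val h)⟩,
        ⟨⟨b, hmem hzB hb⟩, fun h => hne hb (congrArg Subtype.val h)⟩,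
        ⟨⟨c, hmem hzB hc⟩, fun h => hne hc (congrArg Subtype.val h)⟩} :
          Set ({⟨x, hx⟩}ᶜ : Set G.ampleCore)).encard = 3 := by
      rw [Set.encard_eq_three]
      refine ⟨_, _, _, ?_, ?_, ?_, rfl⟩ <;> simpa
    rw [← h3]
    refine Set.encard_le_encard ?_
    rintro _ (rfl | rfl | rfl)
    exacts [ha.adj, hb.adj, hc.adj]

end Ample

section Step

variable {V : Type*} {G : SimpleGraph V} {A : Set V}

/-- The vertices at distance at most `n` from `A`. -/
def nhd (G : SimpleGraph V) (A : Set V) : ℕ → Set V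
  | 0 => A
  | n + 1 => nhd G A n ∪ {x | ∃ y, G.Adj x y ∧ y ∈ nhd G A n}

/-- `y` is a neighbor of `x` that is nearer to `A` than `x`. -/
def Nearer (G : SimpleGraph V) (A : Set V) (x y : V) : Prop :=
  G.Adj x y ∧ ∃ n, y ∈ G.nhd A n ∧ x ∉ G.nhd A n

/-- The endpoints of paths of length `n` along which the distance to `A` decreases. -/
def descents (G : SimpleGraph V) (A : Set V) : ℕ → Set V
  | 0 => Set.univ
  | n + 1 => {x | ∃ z, G.Nearer A z x ∧ z ∈ descents G A n}

/-- The relation selecting the values of the one-ended function: in the thin set move along thin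
branches, and elsewhere move away from the thin set if this is possible forever, and towards it
otherwise. -/
def Step (G : SimpleGraph V) (x y : V) : Prop :=
  x ∈ G.thinSet ∧ G.Thin x y ∨
    x ∉ G.thinSet ∧ x ∈ ⋂ n, G.descents G.thinSet n ∧ y ∈ ⋂ n, G.descents G.thinSet n ∧
      G.Nearer G.thinSet y x ∨
    x ∉ G.thinSet ∧ x ∉ ⋂ n, G.descents G.thinSet n ∧ G.Nearer G.thinSet x y

theorem monotone_nhd : Monotone (G.nhd A) :=
  monotone_nat_of_le_succ fun _ => Set.subset_union_left

theorem exists_mem_nhd_iff {x : V} : (∃ n, x ∈ G.nhd A n) ↔ x ∈ EGSat G A := by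
  constructor
  · rintro ⟨n, hn⟩
    induction n generalizing x with
    | zero => exact ⟨x, hn, .rfl⟩
    | succ n ih =>
      rcases hn with hn | ⟨y, hxy, hy⟩
      · exact ih hn
      · exact mem_EGSat_of_reachable hxy.symm.reachable (ih hy)
  · rintro ⟨a, ha, ⟨p⟩⟩
    induction p with
    | nil => exact ⟨0, ha⟩
    | cons h p ih =>
      obtain ⟨n, hn⟩ := ih ha
      exact ⟨n + 1, Or.inr ⟨_, h, hn⟩⟩

theorem antitone_descents : Antitone (G.descents A) := by
  refine antitone_nat_of_succ_le fun n => ?_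
  induction n with
  | zero => exact Set.subset_univ _
  | succ n ih => exact fun x ⟨z, hz, h⟩ => ⟨z, hz, ih h⟩

theorem exists_nearer_of_mem_descents (hlf : ∀ x, (G.neighborSet x).Finite) {x : V}
    (hx : x ∈ ⋂ n, G.descents A n) : ∃ z ∈ ⋂ n, G.descents A n, G.Nearer A z x := by
  by_contra! H
  have : ∀ z, ∃ n, G.Nearer A z x → z ∉ G.descents A n := by
    intro z
    by_cases hz : z ∈ ⋂ n, G.descents A n
    · exact ⟨0, fun h => (H z hz h).elim⟩
    · rw [Set.mem_iInter, not_forall] at hz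
      exact ⟨hz.choose, fun _ => hz.choose_spec⟩
  choose N hN using this
  obtain ⟨M, hM⟩ := ((hlf x).image N).bddAbove
  obtain ⟨z, hz, h2⟩ := Set.mem_iInter.1 hx (M + 1)
  exact hN z hz (antitone_descents (hM ⟨z, hz.1.symm, rfl⟩) h2)

theorem exists_nearer {x : V} (hx : x ∈ EGSat G A) (hxA : x ∉ A) : ∃ y, G.Nearer A x y := by
  classical
  have h := exists_mem_nhd_iff.2 hx
  obtain ⟨m, hm⟩ : ∃ m, Nat.find h = m + 1 :=
    Nat.exists_eq_succ_of_ne_zero fun h0 => hxA ((Nat.find_eq_zero h).1 h0)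
  have h1 : x ∉ G.nhd A m := Nat.find_min h (by omega)
  have h2 := Nat.find_spec h
  rw [hm] at h2
  obtain ⟨y, hxy, hy⟩ := h2.resolve_left h1
  exact ⟨y, hxy, m, hy, h1⟩

theorem exists_step (hlf : ∀ x, (G.neighborSet x).Finite) {x : V}
    (hx : x ∈ EGSat G G.thinSet) : ∃ y, G.Step x y := by
  by_cases hA : x ∈ G.thinSet
  · exact ⟨hA.choose, Or.inl ⟨hA, hA.choose_spec⟩⟩
  by_cases hd : x ∈ ⋂ n, G.descents G.thinSet n
  · obtain ⟨z, hz, h⟩ := exists_nearer_of_mem_descents hlf hd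
    exact ⟨z, Or.inr (Or.inl ⟨hA, hd, hz, h⟩)⟩
  · obtain ⟨y, hy⟩ := exists_nearer hx hA
    exact ⟨y, Or.inr (Or.inr ⟨hA, hd, hy⟩)⟩

theorem Step.adj {x y : V} (h : G.Step x y) : G.Adj x y := by
  obtain h | h | h := h
  exacts [h.2.adj, h.2.2.2.1.symm, h.2.2.1]

theorem Step.mem_thinSet (hlf : ∀ x, (G.neighborSet x).Finite) {x y : V} (h : G.Step x y)
    (hx : x ∈ G.thinSet) : y ∈ G.thinSet := by
  have h1 : G.Thin x y := by
    obtain h | h | h := h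
    exacts [h.2, (h.1 hx).elim, (h.1 hx).elim]
  obtain ⟨z, hz, hyz⟩ := h1.1.exists_next hlf
  exact ⟨z, h1.next hz hyz⟩

theorem not_exists_step_seq (hlf : ∀ x, (G.neighborSet x).Finite)
    (hbr : ∀ x, G.IsCore x → ∃ w, G.Reachable x w ∧ G.IsBranching w) :
    ¬ ∃ u : ℕ → V, ∀ i, G.Step (u (i + 1)) (u i) := by
  rintro ⟨u, hu⟩
  by_cases hA : ∀ i, u i ∈ G.thinSet
  · obtain ⟨x, hx, H⟩ := exists_isCore_of_thin_seq hlf (u := u) fun i => by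
      obtain h | h | h := hu i
      exacts [h.2, (h.1 (hA _)).elim, (h.1 (hA _)).elim]
    obtain ⟨w, hw, hw'⟩ := hbr x hx
    exact H w hw hw'
  push Not at hA
  obtain ⟨i, hi⟩ := hA
  have hA : ∀ j, i ≤ j → u j ∉ G.thinSet := by
    intro j hj
    induction j, hj using Nat.le_induction with
    | base => exact hi
    | succ j _ ih => exact fun h => ih ((hu j).mem_thinSet hlf h)
  by_cases hd : ∀ j, i ≤ j → u j ∈ ⋂ n, G.descents G.thinSet n
  · have hn : ∀ j, i ≤ j → G.Nearer G.thinSet (u j) (u (j + 1)) := by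
      intro j hj
      obtain h | h | h := hu j
      exacts [(hA _ (by omega) h.1).elim, h.2.2.2, (h.2.1 (hd _ (by omega))).elim]
    have key : ∀ n j, i ≤ j → u j ∉ G.nhd G.thinSet n := by
      intro n
      induction n with
      | zero => exact hA
      | succ n ih =>
        intro j hj h
        obtain ⟨-, m, hm, hm'⟩ := hn j hj
        have hlt : m < n + 1 := by
          by_contra! hle
          exact hm' (monotone_nhd hle h)
        exact ih (j + 1) (by omega) (monotone_nhd (Nat.lt_succ_iff.1 hlt) hm)
    obtain ⟨-, m, hm, -⟩ := hn i le_rfl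
    exact key m (i + 1) (by omega) hm
  · push Not at hd
    obtain ⟨j, hij, hj⟩ := hd
    have hd : ∀ k, j ≤ k → u k ∉ ⋂ n, G.descents G.thinSet n := by
      intro k hk
      induction k, hk using Nat.le_induction with
      | base => exact hj
      | succ k hk ih =>
        intro h'
        obtain h | h | h := hu k
        exacts [hA _ (by omega) h.1, ih h.2.2.1, h.2.1 h']
    refine hj (Set.mem_iInter.2 fun n => ?_)
    suffices ∀ k, j ≤ k → u k ∈ G.descents G.thinSet n from this j le_rfl
    induction n with
    | zero => exact fun _ _ => Set.mem_univ _
    | succ n ih =>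
      intro k hk
      refine ⟨u (k + 1), ?_, ih _ (by omega)⟩
      obtain h | h | h := hu k
      exacts [(hA _ (by omega) h.1).elim, (hd _ (by omega) h.2.1).elim, h.2.2]

end Step

section MeasurableStep

universe u

variable {X : Type u} [MeasurableSpace X] [StandardBorelSpace X] {G : SimpleGraph X} {A : Set X}

theorem measurableSet_nhd (hG : MeasurableSet {p : X × X | G.Adj p.1 p.2})
    (hlf : ∀ x, (G.neighborSet x).Finite) (hA : MeasurableSet A) (n : ℕ) :
    MeasurableSet (G.nhd A n) := by
  induction n with
  | zero => exact hA
  | succ n ih =>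
    exact ih.union (measurableSet_exists_of_adj hlf id (hG.inter (measurable_snd ih))
      fun _ _ h => h.1)

theorem measurableSet_EGSat (hG : MeasurableSet {p : X × X | G.Adj p.1 p.2})
    (hlf : ∀ x, (G.neighborSet x).Finite) (hA : MeasurableSet A) :
    MeasurableSet (EGSat G A) := by
  have h : EGSat G A = ⋃ n, G.nhd A n := by
    ext x
    rw [← exists_mem_nhd_iff, Set.mem_iUnion]
  rw [h]
  exact MeasurableSet.iUnion (measurableSet_nhd hG hlf hA)

theorem measurableSet_nearer (hG : MeasurableSet {p : X × X | G.Adj p.1 p.2})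
    (hlf : ∀ x, (G.neighborSet x).Finite) (hA : MeasurableSet A) :
    MeasurableSet {p : X × X | G.Nearer A p.1 p.2} := by
  have h : {p : X × X | G.Nearer A p.1 p.2} = {p : X × X | G.Adj p.1 p.2} ∩
      ⋃ n, (Prod.snd ⁻¹' G.nhd A n) ∩ (Prod.fst ⁻¹' G.nhd A n)ᶜ := by
    ext p
    simp [Nearer]
  rw [h]
  exact hG.inter (MeasurableSet.iUnion fun n =>
    (measurable_snd (measurableSet_nhd hG hlf hA n)).inter
      (measurable_fst (measurableSet_nhd hG hlf hA n)).compl)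

theorem measurableSet_descents (hG : MeasurableSet {p : X × X | G.Adj p.1 p.2})
    (hlf : ∀ x, (G.neighborSet x).Finite) (hA : MeasurableSet A) (n : ℕ) :
    MeasurableSet (G.descents A n) := by
  induction n with
  | zero => exact MeasurableSet.univ
  | succ n ih =>
    refine measurableSet_exists_of_adj hlf id ?_ fun _ _ h => h.1.1.symm
    exact (measurable_swap (measurableSet_nearer hG hlf hA)).inter (measurable_snd ih)

theorem measurableSet_thinSet (hG : MeasurableSet {p : X × X | G.Adj p.1 p.2})
    (hlf : ∀ x, (G.neighborSet x).Finite) : MeasurableSet G.thinSet :=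
  measurableSet_exists_of_adj hlf id (measurableSet_thin hG hlf) fun _ _ h => h.adj

theorem measurableSet_step (hG : MeasurableSet {p : X × X | G.Adj p.1 p.2})
    (hlf : ∀ x, (G.neighborSet x).Finite) : MeasurableSet {p : X × X | G.Step p.1 p.2} := by
  have hA := measurableSet_thinSet hG hlf
  have hD := MeasurableSet.iInter (measurableSet_descents hG hlf hA)
  have hN := measurableSet_nearer hG hlf hA
  refine .union ?_ (.union ?_ ?_)
  · exact (measurable_fst hA).inter (measurableSet_thin hG hlf)
  · exact (measurable_fst hA.compl).inter ((measurable_fst hD).inter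
      ((measurable_snd hD).inter (measurable_swap hN)))
  · exact (measurable_fst hA.compl).inter ((measurable_fst hD.compl).inter hN)

end MeasurableStep

end SimpleGraph

theorem stmt_13 {X : Type*} [MeasurableSpace X] [StandardBorelSpace X]
    (G : SimpleGraph X) (hGmeas : MeasurableSet {p : X × X | G.Adj p.1 p.2})
    (hlf : ∀ x : X, (G.neighborSet x).Finite)
    (hacyc : G.IsAcyclic)
    (hends : ∀ c : G.ConnectedComponent,
      SimpleGraph.end (G.induce c.supp) ≠ ∅ ∧
        (SimpleGraph.end (G.induce c.supp)).ncard ≠ 2) :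
    ∃ B : Set X, MeasurableSet B ∧ AmpleGraph (G.induce B) ∧
      ∃ f : ((EGSat G B)ᶜ : Set X) → X, Measurable f ∧
        (∀ x : ((EGSat G B)ᶜ : Set X), f x ∈ (EGSat G B)ᶜ ∧ G.Adj (x : X) (f x)) ∧
        OneEnded f := by
  have hesc := hacyc.exists_escapes_of_end_ne_empty fun c => (hends c).1
  have hbr := fun x => hacyc.exists_isBranching_of_ncard_end_ne_two hlf (fun c => (hends c).2)
    (x := x)
  have hsat : (EGSat G G.ampleCore)ᶜ = EGSat G G.thinSet := by
    rw [SimpleGraph.EGSat_ampleCore hacyc hesc, compl_compl]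
  have hmeas := SimpleGraph.measurableSet_EGSat hGmeas hlf
    (SimpleGraph.measurableSet_thinSet hGmeas hlf)
  obtain ⟨f, hf, hf'⟩ := exists_measurable_selector
    (P := {p : X × X | G.Step p.1 p.2} ∪ {p | p.1 ∉ EGSat G G.thinSet ∧ p.1 = p.2})
    (.union (SimpleGraph.measurableSet_step hGmeas hlf) (.inter (measurable_fst hmeas.compl)
      (measurableSet_eq_fun measurable_fst measurable_snd)))
    (fun x => ((hlf x).insert x).subset (by
      rintro y (h | h)
      exacts [Or.inr h.adj, Or.inl h.2.symm]))
    (fun x => by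
      by_cases hx : x ∈ EGSat G G.thinSet
      · obtain ⟨y, hy⟩ := SimpleGraph.exists_step hlf hx
        exact ⟨y, Or.inl hy⟩
      · exact ⟨x, Or.inr ⟨hx, rfl⟩⟩)
  have hstep : ∀ x ∈ EGSat G G.thinSet, G.Step x (f x) := fun x hx =>
    (hf' x).resolve_right fun h => h.1 hx
  refine ⟨G.ampleCore, (SimpleGraph.measurableSet_isCore hGmeas hlf).diff hmeas,
    SimpleGraph.ampleGraph_ampleCore hacyc hlf, fun x => f x, hf.comp measurable_subtype_coe,
    ?_, ?_⟩
  · rintro ⟨x, hx⟩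
    have hx' : x ∈ EGSat G G.thinSet := by rwa [hsat] at hx
    have hadj := (hstep x hx').adj
    exact ⟨hsat.superset (SimpleGraph.mem_EGSat_of_reachable hadj.reachable hx'), hadj⟩
  · rintro ⟨u, hu⟩
    refine SimpleGraph.not_exists_step_seq hlf hbr ⟨fun i => u i, fun i => ?_⟩
    have h := hstep (u (i + 1)) (hsat ▸ (u (i + 1)).2)
    have hi : f (u (i + 1)) = u i := hu i
    rwa [hi] at h
end

section
/- Let G be a locally finite Borel graph on a standard Borel space X, let B ⊆ X be Borel, let Y be a Polish space, and let L : B → [Y]^{<∞} be a Borel function such that for every x ∈ B, the degree of x in the restriction of G to B is strictly less than |L(x)|. Then the restriction of G to B admits a Borel coloring from the lists L, i.e. a Borel map c : B → Y with c(x) ∈ L(x) for all x ∈ B and c(x) ≠ c(y) whenever x, y ∈ B are adjacent in G. -/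
open MeasureTheory

open PiNat in
/-- The **Novikov separation theorem** for continuous images of the Baire space. -/
theorem exists_measurableSet_iInter_eq_empty_of_continuous {α : Type*} [TopologicalSpace α]
    [T2Space α] [MeasurableSpace α] [OpensMeasurableSpace α] (f : ℕ → (ℕ → ℕ) → α)
    (hf : ∀ n, Continuous (f n)) (hinter : ⋂ n, Set.range (f n) = ∅) :
    ∃ u : ℕ → Set α, (∀ n, MeasurableSet (u n)) ∧ (∀ n, Set.range (f n) ⊆ u n) ∧
      ⋂ n, u n = ∅ := by
  let Sep (S : ℕ → Set α) : Prop :=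
    ∃ u : ℕ → Set α, (∀ n, MeasurableSet (u n)) ∧ (∀ n, S n ⊆ u n) ∧ ⋂ n, u n = ∅
  -- reindex so that all the maps depend on disjoint sets of coordinates of a common point
  let g (n : ℕ) (x : ℕ → ℕ) : α := f n fun i => x (Nat.pair n i)
  have hg (n : ℕ) : Continuous (g n) :=
    (hf n).comp (continuous_pi fun i => continuous_apply (Nat.pair n i))
  have hrange (n : ℕ) : Set.range (f n) = Set.range (g n) := by
    apply Set.Subset.antisymm
    · rintro _ ⟨x, rfl⟩
      exact ⟨fun m => x m.unpair.2, by simp [g]⟩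
    · rintro _ ⟨x, rfl⟩
      exact ⟨_, rfl⟩
  have g_update {n m : ℕ} (h : n ≠ m.unpair.1) (x : ℕ → ℕ) (k : ℕ) :
      g n (Function.update x m k) = g n x := by
    have (i : ℕ) : Nat.pair n i ≠ m := by rintro rfl; simp at h
    simp [g, this]
  have step (m : ℕ) (x : ℕ → ℕ) (hx : ¬ Sep fun n => g n '' cylinder x m) :
      ∃ k, ¬ Sep fun n => g n '' cylinder (Function.update x m k) (m + 1) := by
    contrapose! hx
    choose u hu hsub hemp using hx
    refine ⟨fun n => if n = m.unpair.1 then ⋃ k, u k n else ⋂ k, u k n, fun n => ?_, fun n => ?_,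
      ?_⟩
    · dsimp only
      split_ifs
      exacts [.iUnion fun k => hu k n, .iInter fun k => hu k n]
    · dsimp only
      split_ifs with h
      · rw [← iUnion_cylinder_update x m, Set.image_iUnion]
        exact Set.iUnion_mono fun k => hsub k n
      · refine Set.subset_iInter fun k => ?_
        rintro _ ⟨y, hy, rfl⟩
        rw [← g_update h y k]
        refine hsub k n ⟨_, fun i hi => ?_, rfl⟩
        rcases eq_or_ne i m with rfl | hi'
        · simp
        · simpa [hi'] using hy i (by omega)
    · refine Set.eq_empty_of_forall_notMem fun a ha => ?_
      rw [Set.mem_iInter] at ha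
      obtain ⟨k, hk⟩ := Set.mem_iUnion.1 (by simpa using ha m.unpair.1)
      refine Set.eq_empty_iff_forall_notMem.1 (hemp k) a (Set.mem_iInter.2 fun n => ?_)
      by_cases h : n = m.unpair.1
      · rwa [h]
      · have := ha n
        rw [if_neg h] at this
        exact Set.mem_iInter.1 this k
  by_contra hsep
  choose! k hk using step
  let p (m : ℕ) : ℕ → ℕ := m.rec (fun _ => 0) fun m x => Function.update x m (k m x)
  have hp (m : ℕ) : ¬ Sep fun n => g n '' cylinder (p m) m := by
    induction m with
    | zero => simpa [← hrange, Sep] using hsep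
    | succ m ih => exact hk m _ ih
  have stable (i m : ℕ) (h : i + 1 ≤ m) : p m i = p (i + 1) i := by
    induction m, h using Nat.le_induction with
    | base => rfl
    | succ m hm ih =>
      rw [← ih]
      exact Function.update_of_ne (by omega) _ _
  let x (i : ℕ) : ℕ := p (i + 1) i
  have hx (m : ℕ) : ¬ Sep fun n => g n '' cylinder x m := by
    have : cylinder x m = cylinder (p m) m :=
      mem_cylinder_iff_eq.1 fun i hi => (stable i m hi).symm
    rw [this]
    exact hp m
  obtain ⟨i, j, hij⟩ : ∃ i j, g i x ≠ g j x := by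
    by_contra! h
    refine Set.eq_empty_iff_forall_notMem.1 hinter (g 0 x) (Set.mem_iInter.2 fun n => ?_)
    rw [hrange]
    exact ⟨x, h n 0⟩
  obtain ⟨u, v, hu, hv, hxu, hxv, huv⟩ := t2_separation hij
  obtain ⟨_, ⟨y, m, rfl⟩, hxy, hsub⟩ :=
    (isTopologicalBasis_cylinders fun _ : ℕ => ℕ).exists_subset_of_mem_open
      (show x ∈ g i ⁻¹' u ∩ g j ⁻¹' v from ⟨hxu, hxv⟩)
      ((hu.preimage (hg i)).inter (hv.preimage (hg j)))
  rw [← mem_cylinder_iff_eq.1 hxy] at hsub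
  have hne : i ≠ j := by rintro rfl; exact hij rfl
  refine hx m ⟨fun n => if n = i then u else if n = j then v else Set.univ, fun n => ?_,
    fun n => ?_, ?_⟩
  · dsimp only
    split_ifs
    exacts [hu.measurableSet, hv.measurableSet, .univ]
  · dsimp only
    rw [Set.image_subset_iff]
    split_ifs with h h'
    · exact h ▸ fun y hy => (hsub hy).1
    · exact h' ▸ fun y hy => (hsub hy).2
    · exact Set.subset_univ _
  · refine Set.eq_empty_of_forall_notMem fun a ha => ?_
    rw [Set.mem_iInter] at ha
    exact Set.disjoint_left.1 huv (by simpa using ha i) (by simpa [hne.symm] using ha j)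

/-- The **Novikov separation theorem**: a sequence of analytic sets with empty intersection is
contained termwise in a sequence of Borel sets with empty intersection. -/
theorem exists_measurableSet_iInter_eq_empty_of_analyticSet {α : Type*} [TopologicalSpace α]
    [T2Space α] [MeasurableSpace α] [OpensMeasurableSpace α] {A : ℕ → Set α}
    (hA : ∀ n, AnalyticSet (A n)) (hinter : ⋂ n, A n = ∅) :
    ∃ u : ℕ → Set α, (∀ n, MeasurableSet (u n)) ∧ (∀ n, A n ⊆ u n) ∧ ⋂ n, u n = ∅ := by
  by_cases h : ∃ n, A n = ∅
  · obtain ⟨m, hm⟩ := h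
    refine ⟨fun n => if n = m then ∅ else Set.univ, fun n => ?_, fun n => ?_, ?_⟩
    · dsimp only
      split_ifs
      exacts [.empty, .univ]
    · dsimp only
      split_ifs with h
      exacts [(h ▸ hm).subset, Set.subset_univ _]
    · exact Set.eq_empty_of_forall_notMem fun a ha => by simpa using Set.mem_iInter.1 ha m
  · have hA' (n : ℕ) : ∃ f : (ℕ → ℕ) → α, Continuous f ∧ Set.range f = A n := by
      have := hA n
      rw [AnalyticSet] at this
      exact this.resolve_left fun h' => h ⟨n, h'⟩
    choose f hf hfA using hA'
    simpa [hfA] using exists_measurableSet_iInter_eq_empty_of_continuous f hf (by simpa [hfA])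

section Projection

variable {Z : Type*}

/-- Enumerations, in increasing order, of `n` points of a section of `E`. -/
def sectionChains (E : Set (Z × ℝ)) (n : ℕ) : Set (Z × (Fin n → ℝ)) :=
  {p | StrictMono p.2 ∧ ∀ i, (p.1, p.2 i) ∈ E}

theorem measurableSet_sectionChains [MeasurableSpace Z] {E : Set (Z × ℝ)} (hE : MeasurableSet E)
    (n : ℕ) : MeasurableSet (sectionChains E n) := by
  have h₁ : MeasurableSet {p : Z × (Fin n → ℝ) | StrictMono p.2} := by
    simp only [StrictMono, Set.ofPred_forall]
    refine .iInter fun i => .iInter fun j => .iInter fun _ => measurableSet_lt ?_ ?_ <;> fun_prop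
  have h₂ : MeasurableSet {p : Z × (Fin n → ℝ) | ∀ i, (p.1, p.2 i) ∈ E} := by
    rw [Set.ofPred_forall]
    refine .iInter fun i => (show Measurable fun p : Z × (Fin n → ℝ) => (p.1, p.2 i) from ?_) hE
    fun_prop
  exact h₁.inter h₂

theorem exists_mem_sectionChains {E : Set (Z × ℝ)} {z : Z}
    (hfin : {r | (z, r) ∈ E}.Finite) {n : ℕ} (h : n ≤ {r | (z, r) ∈ E}.ncard) :
    z ∈ Prod.fst '' sectionChains E n := by
  rw [Set.ncard_eq_toFinset_card _ hfin] at h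
  refine ⟨(z, hfin.toFinset.orderEmbOfCardLe h), ⟨OrderEmbedding.strictMono _, fun i => ?_⟩, rfl⟩
  simpa using hfin.toFinset.orderEmbOfCardLe_mem h i

theorem le_ncard_of_mem_image_sectionChains {E : Set (Z × ℝ)} {z : Z}
    (hfin : {r | (z, r) ∈ E}.Finite) {n : ℕ} (h : z ∈ Prod.fst '' sectionChains E n) :
    n ≤ {r | (z, r) ∈ E}.ncard := by
  obtain ⟨⟨z, a⟩, ha, rfl⟩ := h
  have : (Set.range a).ncard = n := by
    rw [← Set.image_univ, Set.ncard_image_of_injective _ ha.1.injective]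
    simp
  exact this.symm.le.trans (Set.ncard_le_ncard (Set.range_subset_iff.2 ha.2) hfin)

variable [MeasurableSpace Z] [StandardBorelSpace Z]

theorem measurableSet_image_fst_of_ncard_le (n : ℕ) {E : Set (Z × ℝ)}
    (hE : MeasurableSet E) (hfin : ∀ z, {r | (z, r) ∈ E}.Finite)
    (hcard : ∀ z, {r | (z, r) ∈ E}.ncard ≤ n) : MeasurableSet (Prod.fst '' E) := by
  induction n generalizing E with
  | zero =>
    convert MeasurableSet.empty
    refine Set.eq_empty_of_forall_notMem ?_
    rintro _ ⟨⟨z, r⟩, h, rfl⟩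
    have := (Set.ncard_eq_zero (hfin z)).1 (Nat.le_zero.1 (hcard z))
    exact Set.eq_empty_iff_forall_notMem.1 this r h
  | succ n ih =>
    have hA : MeasurableSet (Prod.fst '' sectionChains E (n + 1)) := by
      refine (measurableSet_sectionChains hE _).image_of_measurable_injOn measurable_fst ?_
      have key {p : Z × (Fin (n + 1) → ℝ)} (hp : p ∈ sectionChains E (n + 1)) :
          Set.range p.2 = {r | (p.1, r) ∈ E} := by
        refine Set.eq_of_subset_of_ncard_le (Set.range_subset_iff.2 hp.2) ?_ (hfin _)
        rw [← Set.image_univ, Set.ncard_image_of_injective _ hp.1.injective]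
        simpa using hcard p.1
      rintro ⟨z, a⟩ ha ⟨_, b⟩ hb (rfl : z = _)
      exact congrArg _ ((StrictMono.range_inj ha.1 hb.1).1 ((key ha).trans (key hb).symm))
    have hsub (z : Z) :
        {r | (z, r) ∈ E \ Prod.fst ⁻¹' (Prod.fst '' sectionChains E (n + 1))} ⊆
          {r | (z, r) ∈ E} := fun r hr => hr.1
    have hdiff := ih (hE.diff (measurable_fst hA)) (fun z => (hfin z).subset (hsub z)) fun z => by
      by_cases hz : z ∈ Prod.fst '' sectionChains E (n + 1)
      · rw [show {r | (z, r) ∈ E \ Prod.fst ⁻¹' (Prod.fst '' sectionChains E (n + 1))} = ∅ from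
          Set.eq_empty_of_forall_notMem fun r hr => hr.2 hz]
        simp
      · have := mt (exists_mem_sectionChains (hfin z)) hz
        have := Set.ncard_le_ncard (hsub z) (hfin z)
        omega
    convert hA.union hdiff using 1
    ext z
    constructor
    · rintro ⟨⟨z, r⟩, h, rfl⟩
      by_cases hz : z ∈ Prod.fst '' sectionChains E (n + 1)
      exacts [.inl hz, .inr ⟨_, ⟨h, hz⟩, rfl⟩]
    · rintro (⟨⟨z, a⟩, h, rfl⟩ | ⟨p, h, rfl⟩)
      exacts [⟨_, h.2 0, rfl⟩, ⟨p, h.1, rfl⟩]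

theorem measurableSet_image_fst_real {E : Set (Z × ℝ)}
    (hE : MeasurableSet E) (hfin : ∀ z, {r | (z, r) ∈ E}.Finite) :
    MeasurableSet (Prod.fst '' E) := by
  let := upgradeStandardBorel Z
  obtain ⟨u, hu, hsub, hempty⟩ := exists_measurableSet_iInter_eq_empty_of_analyticSet
    (fun n => (measurableSet_sectionChains hE n).analyticSet_image measurable_fst) <| by
      refine Set.eq_empty_of_forall_notMem fun z hz => ?_
      have := le_ncard_of_mem_image_sectionChains (hfin z)
        (Set.mem_iInter.1 hz ({r | (z, r) ∈ E}.ncard + 1))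
      omega
  have hss (n : ℕ) (z : Z) : {r | (z, r) ∈ E \ Prod.fst ⁻¹' u n} ⊆ {r | (z, r) ∈ E} :=
    fun r hr => hr.1
  have h (n : ℕ) : MeasurableSet (Prod.fst '' (E \ Prod.fst ⁻¹' u n)) := by
    refine measurableSet_image_fst_of_ncard_le n (hE.diff (measurable_fst (hu n)))
      (fun z => (hfin z).subset (hss n z)) fun z => ?_
    by_cases hz : z ∈ u n
    · rw [show {r | (z, r) ∈ E \ Prod.fst ⁻¹' u n} = ∅ from
        Set.eq_empty_of_forall_notMem fun r hr => hr.2 hz]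
      simp
    · have := mt (exists_mem_sectionChains (hfin z)) (mt (@hsub n z) hz)
      have := Set.ncard_le_ncard (hss n z) (hfin z)
      omega
  convert MeasurableSet.iUnion h
  rw [← Set.image_iUnion, ← Set.sdiff_iInter, ← Set.preimage_iInter, hempty]
  simp

/-- The projection of a Borel set all of whose sections are finite is Borel. -/
theorem measurableSet_setOf_exists_of_finite {W : Type*} [MeasurableSpace W] [StandardBorelSpace W]
    {E : Set (Z × W)} (hE : MeasurableSet E) (hfin : ∀ z, {w | (z, w) ∈ E}.Finite) :
    MeasurableSet {z | ∃ w, (z, w) ∈ E} := by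
  have hemb : MeasurableEmbedding (Prod.map (id : Z → Z) (embeddingReal W)) :=
    MeasurableEmbedding.id.prodMap (measurableEmbedding_embeddingReal W)
  convert measurableSet_image_fst_real (hemb.measurableSet_image.2 hE) fun z => ?_
  · ext z
    simp [Set.image_image]
  · refine ((hfin z).image (embeddingReal W)).subset ?_
    rintro r ⟨⟨z, w⟩, h, hr⟩
    obtain ⟨rfl, rfl⟩ := Prod.mk.inj hr
    exact ⟨w, h, rfl⟩

/-- A Borel set with finite nonempty sections admits a Borel uniformization. -/
theorem exists_measurable_forall_mem_of_finite {W : Type*} [MeasurableSpace W]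
    [StandardBorelSpace W] {E : Set (Z × W)} (hE : MeasurableSet E)
    (hfin : ∀ z, {w | (z, w) ∈ E}.Finite) (hne : ∀ z, ∃ w, (z, w) ∈ E) :
    ∃ f : Z → W, Measurable f ∧ ∀ z, (z, f z) ∈ E := by
  have hemb := measurableEmbedding_embeddingReal W
  have hmin (z : Z) := (hfin z).exists_minimalFor (embeddingReal W) _ (hne z)
  choose f hfE hfmin using hmin
  refine ⟨f, (hemb.measurable_comp_iff).1 (measurable_of_Iio fun r => ?_), hfE⟩
  convert measurableSet_setOf_exists_of_finite
    (hE.inter (measurable_snd (hemb.measurable measurableSet_Iio : MeasurableSet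
      (embeddingReal W ⁻¹' Set.Iio r))))
    fun z => (hfin z).subset fun w hw => hw.1 using 1
  ext z
  constructor
  · exact fun h => ⟨f z, hfE z, h⟩
  · rintro ⟨w, hw, hwr⟩
    refine lt_of_le_of_lt ?_ (show embeddingReal W w < r from hwr)
    rcases le_total (embeddingReal W (f z)) (embeddingReal W w) with h | h
    exacts [h, hfmin z hw h]

end Projection

section Coloring

variable {Z : Type*} [MeasurableSpace Z] [StandardBorelSpace Z]

/-- **Kechris–Solecki–Todorcevic**: a locally finite Borel graph has a Borel coloring with
countably many colors. -/
theorem SimpleGraph.exists_measurable_nat_coloring (G : SimpleGraph Z)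
    (hG : MeasurableSet {p : Z × Z | G.Adj p.1 p.2}) (hfin : ∀ z, (G.neighborSet z).Finite) :
    ∃ χ : Z → ℕ, Measurable χ ∧ ∀ x y, G.Adj x y → χ x ≠ χ y := by
  let := upgradeStandardBorel Z
  obtain ⟨b, hbc, -, hb⟩ := TopologicalSpace.exists_countable_basis Z
  obtain ⟨U, hU⟩ : ∃ U : ℕ → Set Z, insert ∅ b = Set.range U :=
    (hbc.insert ∅).exists_eq_range (Set.insert_nonempty _ _)
  have hUmeas (n : ℕ) : MeasurableSet (U n) := by
    rcases (hU ▸ Set.mem_range_self n : U n ∈ insert ∅ b) with h | h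
    · simp [h]
    · exact (hb.isOpen h).measurableSet
  let C (n : ℕ) : Set Z := U n \ {z | ∃ y, G.Adj z y ∧ y ∈ U n}
  have hC (n : ℕ) : MeasurableSet (C n) :=
    (hUmeas n).diff (measurableSet_setOf_exists_of_finite
      (hG.inter (measurable_snd (hUmeas n))) fun z => (hfin z).subset fun y hy => hy.1)
  have hcover (z : Z) : ∃ n, z ∈ C n := by
    obtain ⟨t, ht, hzt, hsub⟩ := hb.exists_subset_of_mem_open
      (show z ∈ (G.neighborSet z)ᶜ by simp) (hfin z).isClosed.isOpen_compl
    obtain ⟨n, rfl⟩ : t ∈ Set.range U := hU ▸ Set.mem_insert_of_mem _ ht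
    exact ⟨n, hzt, fun ⟨y, hy, hyU⟩ => hsub hyU hy⟩
  classical
  refine ⟨fun z => Nat.find (hcover z), measurable_find hcover hC, fun x y hxy h => ?_⟩
  have hx := Nat.find_spec (hcover x)
  have hy := Nat.find_spec (hcover y)
  rw [← show Nat.find (hcover x) = Nat.find (hcover y) from h] at hy
  exact hx.2 ⟨y, hxy, hy.1⟩

/-- The graph of a Borel map into the space of finite subsets of a Polish space is Borel. -/
theorem measurableSet_setOf_mem_finset {Z Y : Type*} [MeasurableSpace Z] [TopologicalSpace Y]
    [MeasurableSpace Y] [PolishSpace Y] [BorelSpace Y] {L : Z → Finset Y}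
    (hL : ∀ U : Set Y, IsOpen U → MeasurableSet {z | ∃ y ∈ L z, y ∈ U}) :
    MeasurableSet {p : Z × Y | p.2 ∈ L p.1} := by
  obtain ⟨b, hbc, -, hb⟩ := TopologicalSpace.exists_countable_basis Y
  have : {p : Z × Y | p.2 ∈ L p.1} =
      ⋂ u ∈ b, {p | p.2 ∈ u → p.1 ∈ {z | ∃ y ∈ L z, y ∈ u}} := by
    ext ⟨z, y⟩
    simp only [Set.mem_ofPred_eq, Set.mem_iInter]
    refine ⟨fun h u _ hy => ⟨y, h, hy⟩, fun h => ?_⟩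
    by_contra hy
    obtain ⟨u, hu, hyu, hsub⟩ := hb.exists_subset_of_mem_open
      (show y ∈ (L z : Set Y)ᶜ from hy) (L z).finite_toSet.isClosed.isOpen_compl
    obtain ⟨y', hy', hyu'⟩ := h u hu hyu
    exact hsub hyu' hy'
  rw [this]
  refine .biInter hbc fun u hu => ?_
  have hu' := hb.isOpen hu
  exact (measurable_snd hu'.measurableSet).imp (measurable_fst (hL u hu'))

/-- Greedy list coloring: a locally finite Borel graph has a Borel coloring from any Borel
assignment of lists of size larger than the degree. -/
theorem SimpleGraph.exists_measurable_list_coloring {Y : Type*} [TopologicalSpace Y]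
    [MeasurableSpace Y] [PolishSpace Y] [BorelSpace Y] (G : SimpleGraph Z)
    (hG : MeasurableSet {p : Z × Z | G.Adj p.1 p.2}) (hfin : ∀ z, (G.neighborSet z).Finite)
    (L : Z → Finset Y) (hL : ∀ U : Set Y, IsOpen U → MeasurableSet {z | ∃ y ∈ L z, y ∈ U})
    (hcard : ∀ z, (G.neighborSet z).ncard < (L z).card) :
    ∃ c : Z → Y, Measurable c ∧ (∀ z, c z ∈ L z) ∧ ∀ x y, G.Adj x y → c x ≠ c y := by
  obtain ⟨χ, hχ, hχG⟩ := G.exists_measurable_nat_coloring hG hfin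
  have hLY := measurableSet_setOf_mem_finset hL
  have step (k : ℕ) (c : Z → Y) (hc : Measurable c) : ∃ c' : Z → Y, Measurable c' ∧
      (∀ z, χ z ≠ k → c' z = c z) ∧ ∀ z, χ z = k → c' z ∈ L z ∧ ∀ w, G.Adj z w → c' z ≠ c w := by
    have hE : MeasurableSet ({p : Z × Y | p.2 ∈ L p.1} \
        {p | ∃ w, G.Adj p.1 w ∧ c w = p.2}) := by
      refine hLY.diff (measurableSet_setOf_exists_of_finite
        (E := {q : (Z × Y) × Z | G.Adj q.1.1 q.2 ∧ c q.2 = q.1.2}) (.inter ?_ ?_) fun p =>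
          (hfin p.1).subset fun w hw => hw.1)
      · exact (show Measurable fun q : (Z × Y) × Z => (q.1.1, q.2) by fun_prop) hG
      · exact measurableSet_eq_fun (by fun_prop) (by fun_prop)
    obtain ⟨f, hf, hfE⟩ := exists_measurable_forall_mem_of_finite hE
      (fun z => (L z).finite_toSet.subset fun y hy => hy.1) fun z => by
        by_contra! h
        have hsub : (L z : Set Y) ⊆ c '' G.neighborSet z := fun y hy => by
          by_contra hy'
          exact h y ⟨hy, hy'⟩
        have := (Set.ncard_le_ncard hsub ((hfin z).image c)).trans (Set.ncard_image_le (hfin z))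
        rw [Set.ncard_coe_finset] at this
        exact (hcard z).not_ge this
    classical
    refine ⟨fun z => if χ z = k then f z else c z,
      .ite (hχ (measurableSet_singleton k)) hf hc, fun z hz => if_neg hz, fun z hz => ?_⟩
    simp only [if_pos hz]
    exact ⟨(hfE z).1, fun w hw h => (hfE z).2 ⟨w, hw, h.symm⟩⟩
  rcases isEmpty_or_nonempty Z with hZ | ⟨⟨z₀⟩⟩
  · exact ⟨isEmptyElim, measurable_of_empty _, isEmptyElim, isEmptyElim⟩
  obtain ⟨y₀, -⟩ := Finset.card_pos.1 (Nat.zero_lt_of_lt (hcard z₀))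
  choose next hnext hkeep hcolor using step
  let F (k : ℕ) : {c : Z → Y // Measurable c} :=
    k.rec ⟨fun _ => y₀, measurable_const⟩ fun k c => ⟨next k c.1 c.2, hnext k c.1 c.2⟩
  have hF (k : ℕ) (z : Z) (h : χ z + 1 ≤ k) : (F k).1 z = (F (χ z + 1)).1 z := by
    induction k, h using Nat.le_induction with
    | base => rfl
    | succ k hk ih => exact (hkeep k _ (F k).2 z (by omega)).trans ih
  have hlt {x y : Z} (hxy : G.Adj x y) (h : χ y < χ x) :
      (F (χ x + 1)).1 x ≠ (F (χ y + 1)).1 y := by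
    rw [← hF (χ x) y h]
    exact (hcolor (χ x) _ (F (χ x)).2 x rfl).2 y hxy
  refine ⟨fun z => (F (χ z + 1)).1 z, ?_, fun z => (hcolor (χ z) _ (F (χ z)).2 z rfl).1,
    fun x y hxy => ?_⟩
  · have : Measurable fun p : Z × ℕ => (F (p.2 + 1)).1 p.1 :=
      measurable_from_prod_countable_left fun k => (F (k + 1)).2
    exact this.comp (measurable_id.prodMk hχ)
  · rcases lt_or_gt_of_ne (hχG x y hxy) with h | h
    exacts [(hlt hxy.symm h).symm, hlt hxy h]

end Coloring

theorem stmt_14 {X : Type*} [MeasurableSpace X] [StandardBorelSpace X]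
    (G : SimpleGraph X) (hGmeas : MeasurableSet {p : X × X | G.Adj p.1 p.2})
    (hlf : ∀ x : X, (G.neighborSet x).Finite)
    (B : Set X) (hB : MeasurableSet B)
    (Y : Type*) [TopologicalSpace Y] [MeasurableSpace Y] [PolishSpace Y] [BorelSpace Y]
    (L : B → Finset Y)
    (hLmeas : ∀ U : Set Y, IsOpen U → MeasurableSet {x : B | ∃ y ∈ L x, y ∈ U})
    (hLcard : ∀ x : B, ((G.induce B).neighborSet x).ncard < (L x).card) :
    ∃ c : B → Y, Measurable c ∧ (∀ x : B, c x ∈ L x) ∧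
      ∀ x y : B, G.Adj (x : X) (y : X) → c x ≠ c y := by
  have := hB.standardBorel
  exact (G.induce B).exists_measurable_list_coloring
    ((show Measurable fun p : B × B => ((p.1 : X), (p.2 : X)) by fun_prop) hGmeas)
    (fun x => (hlf x).preimage Subtype.val_injective.injOn) L hLmeas hLcard
end
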